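/- arXiv:2506.07264 — 9 statements merged into one kernel-verified Lean document; each statement's English description precedes it below -/
import Mathlib

section
/- For all integers j ≥ k ≥ 1, the graph P(j,k,0) obtained from a triangle by attaching paths of lengths j and k at two of its vertices satisfies s⁺(P(j,k,0)) ≥ j + k + 3 + 1/25 (that is, s⁺(P(j,k,0)) ≥ j + k + 3.04). -/
open Matrix

namespace SquareEnergy

theorem adj_isHermitian {V : Type*} [Fintype V] [DecidableEq V] (G : SimpleGraph V)
    [DecidableRel G.Adj] : (G.adjMatrix ℝ).IsHermitian :=
  ((G.adjMatrix ℝ).conjTranspose_eq_transpose_of_trivial).trans (SimpleGraph.isSymm_adjMatrix G)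

/-- The eigenvalues of the adjacency matrix of `G`, as a function `V → ℝ`. -/
noncomputable def adjEig {V : Type*} [Fintype V] [DecidableEq V] (G : SimpleGraph V) : V → ℝ :=
  letI := Classical.decRel G.Adj
  (adj_isHermitian G).eigenvalues

/-- Positive square energy `s⁺(G)`. -/
noncomputable def sPlus {V : Type*} [Fintype V] [DecidableEq V] (G : SimpleGraph V) : ℝ :=
  ∑ i, if 0 < adjEig G i then (adjEig G i) ^ 2 else 0

/-- Underlying relation for `P(j,k,ℓ)`: a triangle on `Fin 3`, with a pendant path of `j`
extra vertices attached at triangle vertex `0`, a pendant path of `k` extra vertices attached at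
triangle vertex `1`, and a pendant path of `ℓ` extra vertices attached at triangle vertex `2`. -/
def trianglePathsRel (j k l : ℕ) :
    (Fin 3 ⊕ (Fin j ⊕ Fin k ⊕ Fin l)) → (Fin 3 ⊕ (Fin j ⊕ Fin k ⊕ Fin l)) → Prop
  | Sum.inl _, Sum.inl _ => True
  | Sum.inl x, Sum.inr (Sum.inl p) => x = 0 ∧ p.val = 0
  | Sum.inl x, Sum.inr (Sum.inr (Sum.inl q)) => x = 1 ∧ q.val = 0
  | Sum.inl x, Sum.inr (Sum.inr (Sum.inr r)) => x = 2 ∧ r.val = 0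
  | Sum.inr (Sum.inl p), Sum.inr (Sum.inl p') => p'.val = p.val + 1
  | Sum.inr (Sum.inr (Sum.inl q)), Sum.inr (Sum.inr (Sum.inl q')) => q'.val = q.val + 1
  | Sum.inr (Sum.inr (Sum.inr r)), Sum.inr (Sum.inr (Sum.inr r')) => r'.val = r.val + 1
  | _, _ => False

/-- The graph `P(j,k,ℓ)`: a triangle with pendant paths of `j`, `k` and `ℓ` additional vertices
attached at its three distinct vertices.  It has `3 + j + k + ℓ` vertices. -/
def trianglePaths (j k l : ℕ) : SimpleGraph (Fin 3 ⊕ (Fin j ⊕ Fin k ⊕ Fin l)) :=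
  SimpleGraph.fromRel (trianglePathsRel j k l)

/-- `x ↦ (T² + x²) arctan (x / T) - T x` is `O(1/T)`. -/
theorem abs_arctan_remainder_le (x : ℝ) {T : ℝ} (hT : 0 < T) :
    |(T ^ 2 + x ^ 2) * Real.arctan (x / T) - T * x| ≤ |x| ^ 3 / T := by
  have key : ∀ u : ℝ, 0 ≤ u → 0 ≤ (1 + u ^ 2) * Real.arctan u - u ∧
      (1 + u ^ 2) * Real.arctan u - u ≤ u ^ 3 := by
    intro u hu
    have h0 : 0 ≤ Real.arctan u := Real.arctan_nonneg.2 hu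
    have h1 : Real.arctan u ≤ u := by
      have := Real.le_tan h0 (Real.arctan_lt_pi_div_two u)
      rwa [Real.tan_arctan] at this
    have h2 : u / (1 + u ^ 2) ≤ Real.arctan u := by
      have hs := Real.sin_le (x := 2 * Real.arctan u) (by linarith)
      rw [Real.sin_two_mul, Real.sin_arctan, Real.cos_arctan] at hs
      have hq : √(1 + u ^ 2) * √(1 + u ^ 2) = 1 + u ^ 2 := Real.mul_self_sqrt (by positivity)
      have : u / (1 + u ^ 2) = u / √(1 + u ^ 2) * (1 / √(1 + u ^ 2)) := by
        rw [div_mul_div_comm, hq, mul_one]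
      linarith
    rw [div_le_iff₀ (by positivity)] at h2
    constructor
    · linarith
    · nlinarith [sq_nonneg u]
  have hneg : ∀ u : ℝ, |(1 + u ^ 2) * Real.arctan u - u| ≤ |u| ^ 3 := by
    intro u
    rcases le_total 0 u with hu | hu
    · rw [abs_of_nonneg (key u hu).1, abs_of_nonneg hu]; exact (key u hu).2
    · have := key (-u) (by linarith)
      rw [Real.arctan_neg] at this
      rw [abs_of_nonpos (by nlinarith [this.1]), abs_of_nonpos hu]
      nlinarith [this.2]
  have h := mul_le_mul_of_nonneg_left (hneg (x / T)) (sq_nonneg T)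
  rw [abs_div, abs_of_pos hT] at h
  calc |(T ^ 2 + x ^ 2) * Real.arctan (x / T) - T * x|
      = |T ^ 2 * ((1 + (x / T) ^ 2) * Real.arctan (x / T) - x / T)| := by
        congr 1; field_simp
    _ = T ^ 2 * |(1 + (x / T) ^ 2) * Real.arctan (x / T) - x / T| := by
        rw [abs_mul, abs_of_nonneg (sq_nonneg T)]
    _ ≤ T ^ 2 * (|x| / T) ^ 3 := h
    _ = |x| ^ 3 / T := by field_simp

open Filter Topology in
theorem tendsto_arctan_remainder_atTop (x : ℝ) :
    Tendsto (fun T : ℝ => (T ^ 2 + x ^ 2) * Real.arctan (x / T) - T * x) atTop (𝓝 0) := by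
  refine squeeze_zero_norm' (a := fun T => |x| ^ 3 / T) ?_ (tendsto_const_nhds.div_atTop tendsto_id)
  filter_upwards [eventually_gt_atTop 0] with T hT
  exact abs_arctan_remainder_le x hT

open Filter Topology in
theorem tendsto_arctan_div_zero (x : ℝ) :
    Tendsto (fun T : ℝ => (T ^ 2 + x ^ 2) * Real.arctan (x / T)) (𝓝[>] 0)
      (𝓝 (Real.pi / 2 * (x * |x|))) := by
  have hT : Tendsto (fun T : ℝ => T ^ 2 + x ^ 2) (𝓝[>] 0) (𝓝 (x ^ 2)) := by
    have : Continuous fun T : ℝ => T ^ 2 + x ^ 2 := by fun_prop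
    simpa using (this.tendsto 0).mono_left nhdsWithin_le_nhds
  rcases lt_trichotomy x 0 with hx | rfl | hx
  · have h1 : Tendsto (fun T : ℝ => x / T) (𝓝[>] 0) atBot := by
      simpa [div_eq_mul_inv] using tendsto_inv_nhdsGT_zero.const_mul_atTop_of_neg hx
    have := hT.mul ((Real.tendsto_arctan_atBot.mono_right nhdsWithin_le_nhds).comp h1)
    rw [abs_of_neg hx]
    convert this using 2 <;> first | rfl | ring
  · simp
  · have h1 : Tendsto (fun T : ℝ => x / T) (𝓝[>] 0) atTop := by
      simpa [div_eq_mul_inv] using tendsto_inv_nhdsGT_zero.const_mul_atTop hx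
    have := hT.mul ((Real.tendsto_arctan_atTop.mono_right nhdsWithin_le_nhds).comp h1)
    rw [abs_of_pos hx]
    convert this using 2 <;> first | rfl | ring

theorem hasDerivAt_arctan_div (x : ℝ) {T : ℝ} (hT : 0 < T) :
    HasDerivAt (fun T : ℝ => (T ^ 2 + x ^ 2) * Real.arctan (x / T))
      (2 * T * Real.arctan (x / T) - x) T := by
  have h1 : HasDerivAt (fun T : ℝ => x / T) (-x / T ^ 2) T := by
    simpa [div_eq_mul_inv] using (hasDerivAt_inv hT.ne').const_mul x
  have h2 : HasDerivAt (fun T : ℝ => T ^ 2 + x ^ 2) (2 * T) T := by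
    simpa using (hasDerivAt_pow 2 T).add_const (x ^ 2)
  refine (h2.fun_mul h1.arctan).congr_deriv ?_
  have : T ^ 2 + x ^ 2 ≠ 0 := by positivity
  field_simp
  ring

/-- Polar form of a complex number with positive real part. -/
theorem polar_arctan (x : ℝ) {t : ℝ} (ht : 0 < t) :
    (t + x * Complex.I : ℂ) =
      ((t * √(1 + (x / t) ^ 2) : ℝ) : ℂ) * Complex.exp ((Real.arctan (x / t) : ℝ) * Complex.I) := by
  have hs : 0 < √(1 + (x / t) ^ 2) := by positivity
  apply Complex.ext
  · rw [Complex.re_ofReal_mul, Complex.exp_ofReal_mul_I_re, Real.cos_arctan]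
    simp
    field_simp
  · rw [Complex.im_ofReal_mul, Complex.exp_ofReal_mul_I_im, Real.sin_arctan]
    simp
    field_simp

open Filter Topology in
/-- If the product `∏ (t + i λ)` always lies in the open fourth quadrant with controlled argument,
then `∑ λ |λ|` is bounded below. -/
theorem le_sum_mul_abs {ι : Type*} [Fintype ι] (x : ι → ℝ) (hsum : ∑ i, x i = 0)
    (b : ℝ → ℝ) (hb : ∀ t, 0 < t → 0 < b t) (hb' : ∀ t, 1 ≤ t → t ≤ 2 → b t ≤ 26)
    (hprod : ∀ t : ℝ, 0 < t → ∃ d : ℝ, 0 < d ∧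
      ∏ i, ((t : ℂ) + x i * Complex.I) = (d : ℂ) * (b t - 2 * Complex.I)) :
    2 / 25 ≤ ∑ i, x i * |x i| := by
  set θ : ℝ → ℝ := fun t => ∑ i, Real.arctan (x i / t) with hθ
  have hpolar : ∀ t, 0 < t → ∃ c, 0 < c ∧ Real.cos (θ t) = c * b t ∧ Real.sin (θ t) = -(c * 2) := by
    intro t ht
    obtain ⟨d, hd, h⟩ := hprod t ht
    set R : ℝ := ∏ i, (t * √(1 + (x i / t) ^ 2))
    have hR : 0 < R := Finset.prod_pos fun i _ => by positivity
    have h' : (d : ℂ) * (b t - 2 * Complex.I) = (R : ℂ) * Complex.exp ((θ t : ℝ) * Complex.I) := by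
      rw [← h, Finset.prod_congr rfl fun i _ => polar_arctan (x i) ht, Finset.prod_mul_distrib,
        ← Complex.exp_sum, ← Finset.sum_mul]
      simp [R, hθ]
    have hre := congrArg Complex.re h'
    have him := congrArg Complex.im h'
    rw [Complex.re_ofReal_mul, Complex.re_ofReal_mul, Complex.exp_ofReal_mul_I_re] at hre
    rw [Complex.im_ofReal_mul, Complex.im_ofReal_mul, Complex.exp_ofReal_mul_I_im] at him
    simp at hre him
    refine ⟨d / R, by positivity, ?_, ?_⟩
    · field_simp; linarith
    · field_simp; linarith
  have hcos : ∀ t, 0 < t → 0 < Real.cos (θ t) := by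
    intro t ht
    obtain ⟨c, hc, h, -⟩ := hpolar t ht
    rw [h]; exact mul_pos hc (hb t ht)
  have hθcont : ContinuousOn θ (Set.Ioi 0) := by
    refine continuousOn_finsetSum _ fun i _ => Real.continuous_arctan.comp_continuousOn ?_
    exact continuousOn_const.div continuousOn_id fun t ht => (ne_of_gt ht)
  have hθlim : Tendsto θ atTop (𝓝 0) := by
    have : ∀ i ∈ Finset.univ, Tendsto (fun t => Real.arctan (x i / t)) atTop (𝓝 0) := by
      intro i _
      have := (Real.continuous_arctan.tendsto 0).comp
        (tendsto_const_nhds (x := x i) |>.div_atTop tendsto_id)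
      simpa [Function.comp_def] using this
    simpa using tendsto_finsetSum _ this
  have hθlt : ∀ t, 0 < t → |θ t| < Real.pi / 2 := by
    intro t ht
    by_contra! hge
    have hev : ∀ᶠ s in atTop, |θ s| < Real.pi / 2 := by
      have := hθlim.abs
      rw [abs_zero] at this
      exact this.eventually_lt_const (by positivity)
    obtain ⟨s, hs, hts⟩ := (hev.and (eventually_ge_atTop t)).exists
    obtain ⟨r, hr, hrv⟩ := intermediate_value_Icc' hts
      ((hθcont.mono fun y hy => lt_of_lt_of_le ht hy.1).abs) ⟨hs.le, hge⟩
    have := hcos r (ht.trans_le hr.1)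
    rw [← Real.cos_abs] at this
    simp only at hrv
    rw [hrv, Real.cos_pi_div_two] at this
    exact lt_irrefl _ this
  have hθneg : ∀ t, 0 < t → θ t ≤ 0 := by
    intro t ht
    obtain ⟨c, hc, -, h⟩ := hpolar t ht
    by_contra! hpos
    have := Real.sin_pos_of_pos_of_lt_pi hpos (by
      have := (abs_lt.1 (hθlt t ht)).2; linarith [Real.pi_pos])
    linarith
  have hθle : ∀ t, 1 ≤ t → t ≤ 2 → θ t ≤ -(1 / 14) := by
    intro t h1 h2
    have ht : 0 < t := by linarith
    obtain ⟨c, hc, hcs, hsn⟩ := hpolar t ht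
    have hs := Real.sin_le (x := -θ t) (by linarith [hθneg t ht])
    rw [Real.sin_neg, hsn] at hs
    have h1' := Real.sin_sq_add_cos_sq (θ t)
    rw [hcs, hsn] at h1'
    have hbb : b t ^ 2 ≤ 26 ^ 2 := pow_le_pow_left₀ (hb t ht).le (hb' t h1 h2) 2
    have : 1 / 28 ≤ c := by
      by_contra! hlt
      have : c ^ 2 < (1 / 28) ^ 2 := pow_lt_pow_left₀ hlt hc.le (by norm_num)
      nlinarith [mul_le_mul_of_nonneg_left hbb (sq_nonneg c)]
    linarith
  set G : ℝ → ℝ := fun T => ∑ i, (T ^ 2 + x i ^ 2) * Real.arctan (x i / T) with hG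
  have hGderiv : ∀ T, 0 < T → HasDerivAt G (2 * T * θ T) T := by
    intro T hT
    refine (HasDerivAt.fun_sum fun i (_ : i ∈ Finset.univ) =>
      hasDerivAt_arctan_div (x i) hT).congr_deriv ?_
    rw [Finset.sum_sub_distrib, hsum, sub_zero, hθ, Finset.mul_sum]
  have hGanti : AntitoneOn G (Set.Ioi 0) := by
    refine antitoneOn_of_deriv_nonpos (convex_Ioi 0)
      (fun T hT => (hGderiv T hT).continuousAt.continuousWithinAt)
      (fun T hT => (hGderiv T (by simpa using hT)).differentiableAt.differentiableWithinAt) ?_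
    intro T hT
    rw [interior_Ioi] at hT
    rw [(hGderiv T hT).deriv]
    have hT' : (0 : ℝ) < T := hT
    nlinarith [hθneg T hT, mul_nonneg hT'.le (neg_nonneg.2 (hθneg T hT))]
  have hG12 : G 2 ≤ G 1 - 1 / 7 := by
    obtain ⟨r, hr, h⟩ := exists_hasDerivAt_eq_slope G (fun T => 2 * T * θ T) (by norm_num : (1 : ℝ) < 2)
      (fun T hT => (hGderiv T (by linarith [hT.1])).continuousAt.continuousWithinAt)
      (fun T hT => hGderiv T (by linarith [hT.1]))
    have := hθle r hr.1.le hr.2.le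
    have h' : 2 * r * θ r = G 2 - G 1 := by rw [h]; norm_num
    nlinarith [hr.1]
  have hG2 : 0 ≤ G 2 := by
    have hlim : Tendsto G atTop (𝓝 0) := by
      have := tendsto_finsetSum Finset.univ fun i (_ : i ∈ Finset.univ) =>
        tendsto_arctan_remainder_atTop (x i)
      simpa [Finset.sum_sub_distrib, ← Finset.mul_sum, hsum] using this
    refine le_of_tendsto hlim ?_
    filter_upwards [eventually_ge_atTop 2] with T hT
    exact hGanti (by norm_num) (by simp only [Set.mem_Ioi]; linarith) hT
  have hG1 : G 1 ≤ Real.pi / 2 * ∑ i, x i * |x i| := by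
    have hlim : Tendsto G (𝓝[>] 0) (𝓝 (Real.pi / 2 * ∑ i, x i * |x i|)) := by
      rw [Finset.mul_sum]
      exact tendsto_finsetSum Finset.univ fun i _ => tendsto_arctan_div_zero (x i)
    refine ge_of_tendsto hlim ?_
    filter_upwards [Ioc_mem_nhdsGT (zero_lt_one (α := ℝ))] with T hT
    exact hGanti hT.1 (by norm_num) hT.2
  have hpi := Real.pi_lt_d2
  by_contra! hlt
  nlinarith [Real.pi_pos]

open Complex in
/-- The matrix `t + i A` for the path on `n` vertices. -/
noncomputable def pathMatrix (t : ℝ) (n : ℕ) : Matrix (Fin n) (Fin n) ℂ :=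
  Matrix.of fun p q => if p = q then (t : ℂ) else
    if q.val = p.val + 1 ∨ p.val = q.val + 1 then I else 0

/-- The determinant of `pathMatrix`. -/
def pathDet (t : ℝ) : ℕ → ℝ
  | 0 => 1
  | 1 => t
  | n + 2 => t * pathDet t (n + 1) + pathDet t n

theorem pathDet_pos {t : ℝ} (ht : 0 < t) : ∀ n, 0 < pathDet t n
  | 0 => one_pos
  | 1 => ht
  | n + 2 => add_pos (mul_pos ht (pathDet_pos ht (n + 1))) (pathDet_pos ht n)

theorem pathDet_succ_ge {t : ℝ} (ht : 0 < t) : ∀ n, t * pathDet t n ≤ pathDet t (n + 1)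
  | 0 => by simp [pathDet]
  | n + 1 => by simpa [pathDet] using (pathDet_pos ht n).le

theorem pathMatrix_submatrix_succ (t : ℝ) (n : ℕ) :
    (pathMatrix t (n + 1)).submatrix Fin.succ Fin.succ = pathMatrix t n := by
  ext p q
  simp [pathMatrix]

theorem det_pathMatrix (t : ℝ) : ∀ n, (pathMatrix t n).det = pathDet t n
  | 0 => by simp [pathDet]
  | 1 => by simp [pathDet, pathMatrix]
  | n + 2 => by
    rw [det_succ_row_zero, Fin.sum_univ_succ, Fin.sum_univ_succ, Finset.sum_eq_zero]
    · have h1 : ((pathMatrix t (n + 2)).submatrix Fin.succ (Fin.succ 0).succAbove).det =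
          Complex.I * pathDet t n := by
        rw [det_succ_column_zero, Fin.sum_univ_succ, Finset.sum_eq_zero]
        · have h2 : ((pathMatrix t (n + 2)).submatrix Fin.succ (Fin.succ 0).succAbove).submatrix
              (Fin.succAbove 0) Fin.succ = pathMatrix t n := by
            ext p q
            simp [pathMatrix]
          rw [h2, det_pathMatrix t n]
          simp [pathMatrix]
        · intro i _
          simp [pathMatrix]
      rw [h1, Fin.succAbove_zero, pathMatrix_submatrix_succ, det_pathMatrix t (n + 1)]
      simp [pathMatrix, pathDet]
      linear_combination (-(pathDet t n : ℂ)) * Complex.I_mul_I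
    · intro i _
      simp [pathMatrix, Fin.ext_iff]

theorem pathMatrix_inv_zero_zero (t : ℝ) (n : ℕ) :
    (pathMatrix t (n + 1))⁻¹ 0 0 = ((pathDet t n / pathDet t (n + 1) : ℝ) : ℂ) := by
  rw [inv_def, Matrix.smul_apply, adjugate_fin_succ_eq_det_submatrix]
  simp [pathMatrix_submatrix_succ, det_pathMatrix, div_eq_inv_mul]

theorem prod_eigenvalues_eq_det {V : Type*} [Fintype V] [DecidableEq V] {A : Matrix V V ℝ}
    (hA : A.IsHermitian) (t : ℝ) :
    ∏ i, ((t : ℂ) + hA.eigenvalues i * Complex.I) =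
      ((t : ℂ) • (1 : Matrix V V ℂ) + Complex.I • A.map (fun r : ℝ => (r : ℂ))).det := by
  have h := congrArg (fun p => (p.map Complex.ofRealHom).eval (Complex.I * t)) hA.charpoly_eq
  simp only [← Matrix.charpoly_map, Matrix.eval_charpoly, Polynomial.map_prod,
    Polynomial.eval_prod] at h
  have h2 : (t : ℂ) • (1 : Matrix V V ℂ) + Complex.I • A.map (fun r : ℝ => (r : ℂ)) =
      (-Complex.I) • (Matrix.scalar V (Complex.I * t) - A.map Complex.ofRealHom) := by
    ext i j
    simp [Matrix.one_apply, Matrix.diagonal_apply]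
    split_ifs
    · linear_combination (t : ℂ) * Complex.I_mul_I
    · simp
  rw [h2, det_smul, h, Fintype.card, ← Finset.prod_const, ← Finset.prod_mul_distrib]
  refine Finset.prod_congr rfl fun i _ => ?_
  simp
  linear_combination (t : ℂ) * Complex.I_mul_I

theorem sum_eigenvalues_sq {V : Type*} [Fintype V] [DecidableEq V] {A : Matrix V V ℝ}
    (hA : A.IsHermitian) : ∑ i, hA.eigenvalues i ^ 2 = ∑ i, ∑ j, A i j ^ 2 := by
  have h : (A * A).trace = ∑ i, hA.eigenvalues i ^ 2 := by
    conv_lhs => rw [hA.spectral_theorem, ← map_mul]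
    rw [Unitary.conjStarAlgAut_apply, Matrix.trace_mul_comm, ← mul_assoc]
    simp [Matrix.trace, sq]
  rw [← h]
  refine Finset.sum_congr rfl fun i _ => ?_
  rw [Matrix.diag_apply, Matrix.mul_apply]
  refine Finset.sum_congr rfl fun j _ => ?_
  rw [sq, ← hA.apply j i]
  simp

/-- The adjacency matrix of the path on `n` vertices. -/
noncomputable def pathAdj (n : ℕ) : Matrix (Fin n) (Fin n) ℝ :=
  Matrix.of fun p q => if q.val = p.val + 1 ∨ p.val = q.val + 1 then 1 else 0

/-- The adjacency between the triangle and the pendant paths. -/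
noncomputable def attachMatrix (j k : ℕ) : Matrix (Fin 3) (Fin (j + 1) ⊕ Fin (k + 1) ⊕ Fin 0) ℝ :=
  Matrix.of fun x => Sum.elim (fun p => if x = 0 ∧ p = 0 then 1 else 0)
    (Sum.elim (fun q => if x = 1 ∧ q = 0 then 1 else 0) 0)

theorem adjMatrix_trianglePaths (j k : ℕ) [DecidableRel (trianglePaths (j + 1) (k + 1) 0).Adj] :
    (trianglePaths (j + 1) (k + 1) 0).adjMatrix ℝ =
      fromBlocks (Matrix.of fun x y => if x = y then 0 else 1) (attachMatrix j k)
        (attachMatrix j k)ᵀ (fromBlocks (pathAdj (j + 1)) 0 0 (fromBlocks (pathAdj (k + 1)) 0 0 0)) := by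
  have hne : ∀ {n} {p q : Fin n}, (q.val = p.val + 1 ∨ p.val = q.val + 1) → ¬ p = q := by
    rintro n p q h rfl
    omega
  ext x y
  rw [SimpleGraph.adjMatrix_apply]
  rcases x with x | p | p | p <;> rcases y with y | q | q | q <;>
    first
    | exact p.elim0
    | exact q.elim0
    | simp only [trianglePaths, SimpleGraph.fromRel_adj, trianglePathsRel, attachMatrix, pathAdj,
        fromBlocks_apply₁₁, fromBlocks_apply₁₂, fromBlocks_apply₂₁, fromBlocks_apply₂₂,
        Matrix.of_apply, Matrix.transpose_apply, Matrix.zero_apply, Sum.elim_inl, Sum.elim_inr,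
        Fin.val_eq_zero_iff, ne_eq, reduceCtorEq, not_false_eq_true, true_and, or_false, false_or,
        or_self, Sum.inl.injEq, Sum.inr.injEq, and_true, if_false, ite_not,
        and_iff_right_of_imp hne]

open Complex in
theorem det_trianglePaths (j k : ℕ) [DecidableRel (trianglePaths (j + 1) (k + 1) 0).Adj]
    {t : ℝ} (ht : 0 < t) :
    ((t : ℂ) • (1 : Matrix _ _ ℂ) + I •
      ((trianglePaths (j + 1) (k + 1) 0).adjMatrix ℝ).map (fun r : ℝ => (r : ℂ))).det =
    ((pathDet t (j + 1) * pathDet t (k + 1) : ℝ) : ℂ) *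
      (((t + pathDet t j / pathDet t (j + 1)) * (t + pathDet t k / pathDet t (k + 1)) * t + 3 * t +
        pathDet t j / pathDet t (j + 1) + pathDet t k / pathDet t (k + 1) : ℝ) - 2 * I) := by
  set B : Matrix (Fin 3) (Fin (j + 1) ⊕ Fin (k + 1) ⊕ Fin 0) ℂ :=
    I • (attachMatrix j k).map (fun r : ℝ => (r : ℂ)) with hB
  set D : Matrix (Fin (j + 1) ⊕ Fin (k + 1) ⊕ Fin 0) (Fin (j + 1) ⊕ Fin (k + 1) ⊕ Fin 0) ℂ :=
    fromBlocks (pathMatrix t (j + 1)) 0 0 (fromBlocks (pathMatrix t (k + 1)) 0 0 1) with hD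
  set W : Matrix (Fin (j + 1) ⊕ Fin (k + 1) ⊕ Fin 0) (Fin (j + 1) ⊕ Fin (k + 1) ⊕ Fin 0) ℂ :=
    fromBlocks (pathMatrix t (j + 1))⁻¹ 0 0 (fromBlocks (pathMatrix t (k + 1))⁻¹ 0 0 1) with hW
  have hunit : ∀ n, IsUnit (pathMatrix t n).det := fun n => by
    rw [det_pathMatrix, isUnit_iff_ne_zero]
    exact_mod_cast (pathDet_pos ht n).ne'
  have hWD : W * D = 1 := by
    simp [hW, hD, fromBlocks_multiply, nonsing_inv_mul _ (hunit _)]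
  let : Invertible D := invertibleOfLeftInverse D W hWD
  have hinv : ⅟D = W := rfl
  have hpath : ∀ n, (t : ℂ) • (1 : Matrix (Fin n) (Fin n) ℂ) +
      I • (pathAdj n).map (fun r : ℝ => (r : ℂ)) = pathMatrix t n := by
    intro n
    ext p q
    by_cases h : p = q
    · simp [pathMatrix, pathAdj, h]
    · simp [pathMatrix, pathAdj, h, apply_ite Complex.ofReal]
  have hmat : (t : ℂ) • (1 : Matrix _ _ ℂ) + I •
      ((trianglePaths (j + 1) (k + 1) 0).adjMatrix ℝ).map (fun r : ℝ => (r : ℂ)) =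
      fromBlocks !![(t : ℂ), I, I; I, t, I; I, I, t] B Bᵀ D := by
    have h3 : (t : ℂ) • (1 : Matrix (Fin 3) (Fin 3) ℂ) + I •
        (Matrix.of fun x y : Fin 3 => if x = y then (0 : ℝ) else 1).map (fun r : ℝ => (r : ℂ)) =
        !![(t : ℂ), I, I; I, t, I; I, I, t] := by
      ext x y
      fin_cases x <;> fin_cases y <;> simp
    rw [adjMatrix_trianglePaths, ← fromBlocks_one, ← fromBlocks_one, ← fromBlocks_one, ← h3, hD,
      ← hpath, ← hpath]
    simp only [fromBlocks_map, fromBlocks_smul, fromBlocks_add]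
    congr 1
    · simp [hB]
    · ext x y
      simp [hB]
    · congr 1
      · simp
      · ext x y
        simp
      · congr 1
        · ext x y
          simp
        · ext x y
          simp
        · ext x
          exact x.elim0
  rw [hmat, det_fromBlocks₂₂, hinv]
  have hdetD : D.det = ((pathDet t (j + 1) * pathDet t (k + 1) : ℝ) : ℂ) := by
    simp [hD, det_pathMatrix]
  have hBWB : B * W * Bᵀ = !![-((pathDet t j / pathDet t (j + 1) : ℝ) : ℂ), 0, 0;
      0, -((pathDet t k / pathDet t (k + 1) : ℝ) : ℂ), 0; 0, 0, 0] := by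
    rw [← pathMatrix_inv_zero_zero, ← pathMatrix_inv_zero_zero]
    ext x y
    fin_cases x <;> fin_cases y <;>
      simp [Matrix.mul_apply, hB, hW, attachMatrix, apply_ite Complex.ofReal]
    · linear_combination (pathMatrix t (j + 1))⁻¹ 0 0 * I_mul_I
    · linear_combination (pathMatrix t (k + 1))⁻¹ 0 0 * I_mul_I
  rw [hdetD, hBWB]
  congr 1
  rw [det_fin_three]
  simp
  generalize (pathDet t j / pathDet t (j + 1) : ℂ) = a
  generalize (pathDet t k / pathDet t (k + 1) : ℂ) = b
  linear_combination (-2 * t - a - b) * I_mul_I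

theorem sum_path_adj (n : ℕ) :
    ∑ p : Fin (n + 1), ∑ q : Fin (n + 1), pathAdj (n + 1) p q = 2 * n := by
  have h : ∑ p : Fin (n + 1), ∑ q : Fin (n + 1), (if q.val = p.val + 1 then (1 : ℝ) else 0) = n := by
    rw [Finset.sum_comm, Fin.sum_univ_succ]
    have : ∀ (i : Fin n) (p : Fin (n + 1)), i.val = p.val ↔ i.castSucc = p := by
      simp [Fin.ext_iff]
    simp [this]
  have h' := h
  rw [Finset.sum_comm] at h'
  rw [two_mul]
  nth_rw 1 [← h]
  rw [← h', ← Finset.sum_add_distrib]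
  refine Finset.sum_congr rfl fun p _ => ?_
  rw [← Finset.sum_add_distrib]
  refine Finset.sum_congr rfl fun q _ => ?_
  simp only [pathAdj, Matrix.of_apply]
  split_ifs <;> first | omega | norm_num

theorem sum_sq_adjMatrix_trianglePaths (j k : ℕ)
    [DecidableRel (trianglePaths (j + 1) (k + 1) 0).Adj] :
    ∑ x, ∑ y, (trianglePaths (j + 1) (k + 1) 0).adjMatrix ℝ x y ^ 2 = 2 * (j + k + 5) := by
  have hpath : ∀ n (p q : Fin n), pathAdj n p q ^ 2 = pathAdj n p q := by
    intro n p q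
    simp only [pathAdj, Matrix.of_apply]
    split_ifs <;> norm_num
  rw [adjMatrix_trianglePaths]
  simp only [Fintype.sum_sum_type, fromBlocks_apply₁₁, fromBlocks_apply₁₂, fromBlocks_apply₂₁,
    fromBlocks_apply₂₂, hpath, Finset.sum_add_distrib, sum_path_adj]
  simp [attachMatrix, Fin.sum_univ_three, ite_and, -Finset.sum_boole]
  ring

/-- For `j ≥ k ≥ 1`, `s⁺(P(j,k,0)) ≥ j + k + 3 + 1/25 = j + k + 3.04`. -/
theorem stmt_10 (j k : ℕ) (hk : 1 ≤ k) (hjk : k ≤ j) :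
    (j : ℝ) + k + 3 + 1 / 25 ≤ sPlus (trianglePaths j k 0) := by
  obtain ⟨k, rfl⟩ : ∃ m, k = m + 1 := ⟨k - 1, by omega⟩
  obtain ⟨j, rfl⟩ : ∃ m, j = m + 1 := ⟨j - 1, by omega⟩
  classical
  let := Classical.decRel (trianglePaths (j + 1) (k + 1) 0).Adj
  set hA := adj_isHermitian (trianglePaths (j + 1) (k + 1) 0)
  have hsum : ∑ i, hA.eigenvalues i = 0 := by
    have h := hA.trace_eq_sum_eigenvalues
    rw [SimpleGraph.trace_adjMatrix] at h
    simpa using h.symm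
  have hsq := (sum_eigenvalues_sq hA).trans (sum_sq_adjMatrix_trianglePaths j k)
  have hr : ∀ n t, 0 < t → 0 < pathDet t n / pathDet t (n + 1) ∧
      t * (pathDet t n / pathDet t (n + 1)) ≤ 1 := by
    intro n t ht
    refine ⟨div_pos (pathDet_pos ht n) (pathDet_pos ht (n + 1)), ?_⟩
    rw [← mul_div_assoc, div_le_one (pathDet_pos ht (n + 1))]
    exact pathDet_succ_ge ht n
  have hodd : 2 / 25 ≤ ∑ i, hA.eigenvalues i * |hA.eigenvalues i| := by
    refine le_sum_mul_abs _ hsum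
      (fun t => (t + pathDet t j / pathDet t (j + 1)) * (t + pathDet t k / pathDet t (k + 1)) * t +
        3 * t + pathDet t j / pathDet t (j + 1) + pathDet t k / pathDet t (k + 1)) ?_ ?_ ?_
    · intro t ht
      have h1 := (hr j t ht).1
      have h2 := (hr k t ht).1
      positivity
    · intro t h1 h2
      have ht : 0 < t := by linarith
      obtain ⟨hj, hj'⟩ := hr j t ht
      obtain ⟨hk, hk'⟩ := hr k t ht
      set a := pathDet t j / pathDet t (j + 1)
      set b := pathDet t k / pathDet t (k + 1)
      have ha : a ≤ 1 := by nlinarith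
      have hb : b ≤ 1 := by nlinarith
      have : (t + a) * (t + b) * t ≤ 3 * 3 * 2 := by gcongr <;> linarith
      linarith
    · intro t ht
      refine ⟨_, mul_pos (pathDet_pos ht (j + 1)) (pathDet_pos ht (k + 1)), ?_⟩
      rw [prod_eigenvalues_eq_det hA]
      exact det_trianglePaths j k ht
  have hplus : sPlus (trianglePaths (j + 1) (k + 1) 0) =
      (∑ i, hA.eigenvalues i ^ 2 + ∑ i, hA.eigenvalues i * |hA.eigenvalues i|) / 2 := by
    rw [← Finset.sum_add_distrib, Finset.sum_div]
    refine Finset.sum_congr rfl fun i _ => ?_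
    change (if 0 < hA.eigenvalues i then hA.eigenvalues i ^ 2 else 0) = _
    split_ifs with h
    · rw [abs_of_pos h]; ring
    · rw [abs_of_nonpos (not_lt.1 h)]; ring
  rw [hplus, hsq]
  push_cast
  linarith

end SquareEnergy
end

section
/- Let P_ℓ be the path graph on ℓ vertices, let A = A⁺ − A⁻ be the spectral decomposition of its adjacency matrix into positive and negative parts, and let u be an endpoint (leaf) of the path. Then the diagonal entry (A⁻)_{u,u} ≤ 1/2. Moreover, if ℓ ≥ 10, then (A⁻)_{u,u} ≤ 43/100. -/
open Matrix

namespace SquareEnergy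

instance pathGraphAdjDecidable (n : ℕ) : DecidableRel (SimpleGraph.pathGraph n).Adj :=
  fun u v => decidable_of_iff (u.val + 1 = v.val ∨ v.val + 1 = u.val)
    SimpleGraph.pathGraph_adj.symm

/-- The number of walks of length `k` on the half-line `0 - 1 - 2 - ⋯` from `0` to `i`. -/
def halfLineWalks : ℕ → ℕ → ℕ
  | 0, 0 => 1
  | 0, _ + 1 => 0
  | k + 1, 0 => halfLineWalks k 1
  | k + 1, i + 1 => halfLineWalks k i + halfLineWalks k (i + 2)

theorem halfLineWalks_eq_zero {k i : ℕ} (h : k < i) : halfLineWalks k i = 0 := by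
  induction k generalizing i with
  | zero =>
    obtain ⟨i, rfl⟩ := Nat.exists_eq_succ_of_ne_zero h.ne'
    rfl
  | succ k ih =>
    obtain ⟨i, rfl⟩ := Nat.exists_eq_succ_of_ne_zero (Nat.ne_zero_of_lt h)
    simp [halfLineWalks, ih (show k < i by omega), ih (show k < i + 2 by omega)]

/-- The powers of the adjacency matrix of a path count walks on the half-line as long as the walks
are too short to notice the other endpoint. -/
theorem pathGraph_adjMatrix_pow_apply_zero {n k : ℕ} (hk : k ≤ n) (i : Fin (n + 1)) :
    ((SimpleGraph.pathGraph (n + 1)).adjMatrix ℝ ^ k) i 0 = halfLineWalks k i := by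
  induction k generalizing i with
  | zero =>
    rcases i with ⟨_ | i, hi⟩
    · simp [halfLineWalks]
    · simp [halfLineWalks, Fin.ext_iff]
  | succ k ih =>
    have hsum : ((SimpleGraph.pathGraph (n + 1)).adjMatrix ℝ ^ (k + 1)) i 0 =
        ∑ j ∈ Finset.range (n + 1),
          if i.val + 1 = j ∨ j + 1 = i.val then (halfLineWalks k j : ℝ) else 0 := by
      rw [pow_succ', Matrix.mul_apply, ← Fin.sum_univ_eq_sum_range
        (fun j => if i.val + 1 = j ∨ j + 1 = i.val then (halfLineWalks k j : ℝ) else 0)]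
      refine Finset.sum_congr rfl fun j _ => ?_
      rw [ih (by omega), SimpleGraph.adjMatrix_apply, ite_mul, one_mul, zero_mul]
      exact if_congr SimpleGraph.pathGraph_adj rfl rfl
    rw [hsum]
    rcases i with ⟨_ | i, hi⟩
    · have h1 : 1 < n + 1 := by omega
      simp [halfLineWalks, h1]
    · have hsplit : ∀ j : ℕ, (if i + 1 + 1 = j ∨ j + 1 = i + 1 then (halfLineWalks k j : ℝ) else 0)
          = (if i = j then (halfLineWalks k j : ℝ) else 0)
            + (if i + 2 = j then (halfLineWalks k j : ℝ) else 0) := by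
        intro j
        split_ifs <;> first | omega | simp
      have hlast : n + 1 ≤ i + 2 → halfLineWalks k (i + 2) = 0 :=
        fun h => halfLineWalks_eq_zero (by omega)
      simp only [hsplit, Finset.sum_add_distrib, Finset.sum_ite_eq, Finset.mem_range,
        halfLineWalks, Nat.cast_add]
      rw [if_pos (by omega)]
      split_ifs with h
      · rfl
      · rw [hlast (by omega), Nat.cast_zero]

theorem pathGraph_adjMatrix_sq_pow_apply_zero {n k : ℕ} (hk : k ≤ n) :
    (((SimpleGraph.pathGraph (n + 1)).adjMatrix ℝ ^ 2) ^ k) 0 0 =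
      ((∑ i ∈ Finset.range (k + 1), halfLineWalks k i ^ 2 : ℕ) : ℝ) := by
  set A := (SimpleGraph.pathGraph (n + 1)).adjMatrix ℝ with hA
  have hsymm : (A ^ k)ᵀ = A ^ k := by
    rw [Matrix.transpose_pow, hA, SimpleGraph.transpose_adjMatrix]
  have hsubset : Finset.range (k + 1) ⊆ Finset.range (n + 1) :=
    Finset.range_subset_range.2 (by omega)
  rw [Finset.sum_subset hsubset fun i _ hi => by
      rw [halfLineWalks_eq_zero (by simpa using hi)]; rfl,
    ← pow_mul, mul_comm, pow_mul, sq, Matrix.mul_apply, Nat.cast_sum,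
    ← Fin.sum_univ_eq_sum_range (fun i => ((halfLineWalks k i ^ 2 : ℕ) : ℝ))]
  refine Finset.sum_congr rfl fun i _ => ?_
  have h := congrFun (congrFun hsymm 0) i
  rw [Matrix.transpose_apply] at h
  rw [← h, hA, pathGraph_adjMatrix_pow_apply_zero hk]
  push_cast
  ring

/-- Nonnegativity of the functional `p ↦ p(B)ᵤᵤ` on polynomials of the form `X ^ j * c ^ 2`,
for `B` positive semidefinite. -/
theorem sum_mul_pow_apply_nonneg {ι : Type*} [Fintype ι] [DecidableEq ι] {B : Matrix ι ι ℝ}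
    (hB : B.PosSemidef) (u : ι) {d : ℕ} (c : Fin d → ℝ) (j : ℕ) :
    0 ≤ ∑ a : Fin d, ∑ b : Fin d, c a * c b * (B ^ (a.val + j + b.val)) u u := by
  set G : Matrix ι ι ℝ := ∑ a : Fin d, c a • B ^ a.val with hG
  have hGG : Gᴴ = G := by
    simp only [hG, Matrix.conjTranspose_sum, Matrix.conjTranspose_smul, star_trivial,
      Matrix.conjTranspose_pow, hB.isHermitian.eq]
  have h := ((hB.pow j).conjTranspose_mul_mul_same G).diag_nonneg (i := u)
  rw [hGG] at h
  refine h.trans_eq ?_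
  simp only [hG, Finset.sum_mul, Finset.mul_sum, Matrix.sum_apply]
  rw [Finset.sum_comm]
  refine Finset.sum_congr rfl fun a _ => Finset.sum_congr rfl fun b _ => ?_
  simp only [smul_mul_assoc, mul_smul_comm, Matrix.smul_apply, smul_eq_mul, pow_add]
  ring

theorem add_sq_eq_sub_sq {ι : Type*} [Fintype ι] [DecidableEq ι] {Ap Am : Matrix ι ι ℝ}
    (hAp : Ap.IsHermitian) (hAm : Am.IsHermitian) (hmul : Ap * Am = 0) :
    (Ap + Am) ^ 2 = (Ap - Am) ^ 2 := by
  have hmul' : Am * Ap = 0 := by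
    rw [← hAp.eq, ← hAm.eq, ← Matrix.conjTranspose_mul, hmul, Matrix.conjTranspose_zero]
  simp [sq, add_mul, mul_add, sub_mul, mul_sub, hmul, hmul']

/-- The bounds at the endpoint `0`. -/
theorem negPart_apply_zero_le {n : ℕ} {Ap Am : Matrix (Fin (n + 1)) (Fin (n + 1)) ℝ}
    (hAp : Ap.PosSemidef) (hAm : Am.PosSemidef) (hmul : Ap * Am = 0)
    (hdecomp : (SimpleGraph.pathGraph (n + 1)).adjMatrix ℝ = Ap - Am) :
    Am 0 0 ≤ 1 / 2 ∧ (9 ≤ n → Am 0 0 ≤ 43 / 100) := by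
  have hB : (Ap + Am).PosSemidef := hAp.add hAm
  have hsq := add_sq_eq_sub_sq hAp.isHermitian hAm.isHermitian hmul
  rw [← hdecomp] at hsq
  obtain ⟨m, hm⟩ : ∃ m : ℕ → ℝ, ∀ k, m k = ((Ap + Am) ^ k) 0 0 := ⟨_, fun _ => rfl⟩
  have heven : ∀ k ≤ n, m (2 * k) =
      ((∑ i ∈ Finset.range (k + 1), halfLineWalks k i ^ 2 : ℕ) : ℝ) := fun k hk => by
    rw [hm, pow_mul, hsq, pathGraph_adjMatrix_sq_pow_apply_zero hk]
  have hnonneg : ∀ {d : ℕ} (c : Fin d → ℝ) (j : ℕ),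
      0 ≤ ∑ a : Fin d, ∑ b : Fin d, c a * c b * m (a.val + j + b.val) := fun c j => by
    simpa only [hm] using sum_mul_pow_apply_nonneg hB 0 c j
  have hm0 : m 0 = 1 := by simp [hm]
  have hm1 : m 1 = 2 * Am 0 0 := by
    have h := congrFun (congrFun hdecomp 0) 0
    simp only [SimpleGraph.adjMatrix_apply, SimpleGraph.irrefl, if_false, Matrix.sub_apply] at h
    rw [hm, pow_one, Matrix.add_apply]
    linarith
  constructor
  · have hm2 : m 2 ≤ 1 := by
      rcases Nat.eq_zero_or_pos n with rfl | hn
      · rw [hm, hsq]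
        simp [sq, Matrix.mul_apply]
      · exact (heven 1 hn).trans_le (by norm_num [Finset.sum_range_succ, halfLineWalks])
    have h := hnonneg ![1, -1] 0
    simp [Fin.sum_univ_succ] at h
    linarith
  · intro hn
    have hm2 : m 2 = 1 := (heven 1 (by omega)).trans (by norm_cast)
    have hm4 : m 4 = 2 := (heven 2 (by omega)).trans (by norm_cast)
    have hm6 : m 6 = 5 := (heven 3 (by omega)).trans (by norm_cast)
    have hm8 : m 8 = 14 := (heven 4 (by omega)).trans (by norm_cast)
    have hm10 : m 10 = 42 := (heven 5 (by omega)).trans (by norm_cast)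
    have hm12 : m 12 = 132 := (heven 6 (by omega)).trans (by norm_cast)
    have hm14 : m 14 = 429 := (heven 7 (by omega)).trans (by norm_cast)
    have hm16 : m 16 = 1430 := (heven 8 (by omega)).trans (by norm_cast)
    have hm18 : m 18 = 4862 := (heven 9 (by omega)).trans (by norm_cast)
    have h := hnonneg ![-50388, 325865, -703800, 677000, -300000, 50000]
    have h0 := h 0
    have h1 := h 1
    have h2 := h 2
    have h3 := h 3
    have h4 := h 4
    have h5 := h 5
    have h6 := h 6
    have h7 := h 7
    have h8 := h 8
    simp [Fin.sum_univ_succ, hm0, hm1, hm2, hm4, hm6, hm8, hm10, hm12, hm14, hm16, hm18]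
      at h0 h1 h2 h3 h4 h5 h6 h7 h8
    linarith

/-- For the path `P_ℓ` with spectral decomposition `A = A⁺ − A⁻` of its adjacency matrix and an
endpoint `u` of the path, the diagonal entry `(A⁻)_{u,u}` is at most `1/2`; moreover, if
`ℓ ≥ 10` it is at most `43/100`. -/
theorem stmt_11 (l : ℕ) (Ap Am : Matrix (Fin l) (Fin l) ℝ)
    (hAp : Ap.PosSemidef) (hAm : Am.PosSemidef) (hmul : Ap * Am = 0)
    (hdecomp : (SimpleGraph.pathGraph l).adjMatrix ℝ = Ap - Am)
    (u : Fin l) (hu : u.val = 0 ∨ u.val = l - 1) :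
    Am u u ≤ 1 / 2 ∧ (10 ≤ l → Am u u ≤ 43 / 100) := by
  obtain _ | n := l
  · exact u.elim0
  rw [show 10 ≤ n + 1 ↔ 9 ≤ n by omega]
  rcases hu with hu | hu
  · obtain rfl : u = 0 := Fin.ext hu
    exact negPart_apply_zero_le hAp hAm hmul hdecomp
  · obtain rfl : u = Fin.rev 0 := Fin.ext (by simpa using hu)
    refine negPart_apply_zero_le (hAp.submatrix Fin.rev) (hAm.submatrix Fin.rev) ?_ ?_
    · have h := Matrix.submatrix_mul_equiv Ap Am Fin.rev Fin.revPerm Fin.rev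
      rw [hmul] at h
      exact h
    · have h := congrArg (fun M => M.submatrix Fin.rev Fin.rev) hdecomp
      refine Eq.trans ?_ h
      ext i j
      simp only [Matrix.submatrix_apply, SimpleGraph.adjMatrix_apply]
      refine if_congr ?_ rfl rfl
      rw [SimpleGraph.pathGraph_adj, SimpleGraph.pathGraph_adj, Fin.val_rev, Fin.val_rev]
      omega

end SquareEnergy
end

section
/- Let P_ℓ be the path graph on ℓ ≥ 200 vertices, labeled 1, 2, …, ℓ along the path, and let A = A⁺ − A⁻ be the spectral decomposition of its adjacency matrix into positive and negative parts. Then for every j with 100 ≤ j ≤ ℓ − 100, the entry (A⁻)_{j, j+2} ≥ 21/100. -/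
open Matrix

namespace SquareEnergy

open Real Finset

section PositivePart

variable {ι : Type*} [Fintype ι]

lemma dotProduct_self_mulVec_of_isHermitian {B : Matrix ι ι ℝ} (hB : B.IsHermitian) (v : ι → ℝ) :
    (B *ᵥ v) ⬝ᵥ (B *ᵥ v) = v ⬝ᵥ (B *ᵥ (B *ᵥ v)) := by
  have hT : Bᵀ = B := by simpa using hB.eq
  rw [dotProduct_mulVec v, ← mulVec_transpose, hT]

lemma mulVec_eq_zero_of_mulVec_mulVec {B : Matrix ι ι ℝ} (hB : B.PosSemidef) {v : ι → ℝ} {c : ℝ}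
    (hc : c ≤ 0) (h : B *ᵥ (B *ᵥ v) = c • (B *ᵥ v)) : B *ᵥ v = 0 := by
  have h1 := dotProduct_self_mulVec_of_isHermitian hB.isHermitian v
  rw [h, dotProduct_smul, smul_eq_mul] at h1
  have h2 : 0 ≤ v ⬝ᵥ (B *ᵥ v) := by simpa using hB.dotProduct_mulVec_nonneg v
  have h3 : 0 ≤ (B *ᵥ v) ⬝ᵥ (B *ᵥ v) := by simpa using dotProduct_star_self_nonneg (B *ᵥ v)
  exact dotProduct_self_eq_zero.mp (le_antisymm (by nlinarith) h3)

/-- The positive part acts on an eigenvector by the positive part of the eigenvalue. -/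
lemma posPart_mulVec_eigenvector {P N : Matrix ι ι ℝ} (hP : P.PosSemidef) (hN : N.PosSemidef)
    (hPN : P * N = 0) {v : ι → ℝ} {c : ℝ} (h : (P - N) *ᵥ v = c • v) :
    P *ᵥ v = max c 0 • v := by
  have hNP : N * P = 0 := by
    have := congrArg conjTranspose hPN
    rwa [conjTranspose_mul, hP.isHermitian.eq, hN.isHermitian.eq, conjTranspose_zero] at this
  rcases le_total c 0 with hc | hc
  · rw [max_eq_right hc, zero_smul]
    refine mulVec_eq_zero_of_mulVec_mulVec hP hc ?_
    rw [← mulVec_smul, ← h, mulVec_mulVec, mulVec_mulVec, mul_sub, hPN, sub_zero]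
  · have hN0 : N *ᵥ v = 0 := by
      refine mulVec_eq_zero_of_mulVec_mulVec hN (neg_nonpos.mpr hc) ?_
      rw [neg_smul, ← mulVec_smul, ← h, mulVec_mulVec, mulVec_mulVec, mul_sub, hNP, zero_sub,
        neg_mulVec, neg_neg]
    rw [max_eq_left hc, ← h, sub_mulVec, hN0, sub_zero]

end PositivePart

section TrigSums

lemma two_mul_sin_mul_sum_cos (β : ℝ) (N : ℕ) :
    2 * sin β * ∑ m ∈ range N, cos (2 * m * β) = sin ((2 * N - 1) * β) + sin β := by
  induction N with
  | zero => simp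
  | succ N ih =>
    rw [sum_range_succ, mul_add, ih]
    have e1 : (2 * ((N + 1 : ℕ) : ℝ) - 1) * β = 2 * N * β + β := by push_cast; ring
    have e2 : (2 * (N : ℝ) - 1) * β = 2 * N * β - β := by ring
    rw [e1, e2, sin_add, sin_sub]
    ring

lemma sum_cos_eq {β : ℝ} (hβ : sin β ≠ 0) (N : ℕ) :
    ∑ m ∈ range N, cos (2 * m * β) = sin ((2 * N - 1) * β) / (2 * sin β) + 1 / 2 := by
  rw [div_add_div _ _ (by positivity) two_ne_zero, eq_div_iff (by positivity)]
  linear_combination 2 * two_mul_sin_mul_sum_cos β N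

lemma sin_mul_pi_div_pos {n L : ℝ} (hn : 0 < n) (hnL : n < 2 * L) : 0 < sin (n * (π / (2 * L))) := by
  have hL : 0 < 2 * L := hn.trans hnL
  refine sin_pos_of_pos_of_lt_pi (by positivity) ?_
  rw [mul_div_assoc', div_lt_iff₀ hL]
  nlinarith [pi_pos]

lemma sum_cos_full {L n : ℕ} (hn : 0 < n) (hnL : n < 2 * L) :
    ∑ m ∈ range L, cos (2 * m * (n * (π / (2 * L)))) = (1 - (-1) ^ n) / 2 := by
  have hs : 0 < sin (n * (π / (2 * L))) :=
    sin_mul_pi_div_pos (by exact_mod_cast hn) (by exact_mod_cast hnL)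
  have hL : (L : ℝ) ≠ 0 := by
    have : L ≠ 0 := by omega
    exact_mod_cast this
  have e : (2 * (L : ℝ) - 1) * (n * (π / (2 * L))) = n * π - n * (π / (2 * L)) := by
    field_simp
  rw [sum_cos_eq hs.ne', e, sin_sub, sin_nat_mul_pi, cos_nat_mul_pi]
  generalize sin (n * (π / (2 * L))) = s at hs
  have := hs.ne'
  field_simp
  ring

/-- Discrete orthogonality of sines. -/
lemma sum_sin_mul_sin {L a b : ℕ} (ha : 0 < a) (hb : 0 < b) (haL : a < L) (hbL : b < L) :
    ∑ m ∈ range L, sin (2 * m * (a * (π / (2 * L)))) * sin (2 * m * (b * (π / (2 * L)))) =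
      if a = b then (L : ℝ) / 2 else 0 := by
  wlog hab : a ≤ b generalizing a b
  · simp_rw [eq_comm (a := a), ← this hb ha hbL haL (by omega), mul_comm]
  obtain ⟨d, rfl⟩ := Nat.exists_eq_add_of_le hab
  have key : ∀ m : ℕ, sin (2 * m * (a * (π / (2 * L)))) *
      sin (2 * m * ((a + d : ℕ) * (π / (2 * L)))) =
      (cos (2 * m * (d * (π / (2 * L)))) - cos (2 * m * ((2 * a + d : ℕ) * (π / (2 * L))))) / 2 := by
    intro m
    have e1 : 2 * (m : ℝ) * (d * (π / (2 * L))) =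
        2 * m * ((a + d : ℕ) * (π / (2 * L))) - 2 * m * (a * (π / (2 * L))) := by push_cast; ring
    have e2 : 2 * (m : ℝ) * ((2 * a + d : ℕ) * (π / (2 * L))) =
        2 * m * ((a + d : ℕ) * (π / (2 * L))) + 2 * m * (a * (π / (2 * L))) := by push_cast; ring
    rw [e1, e2, cos_sub, cos_add]
    ring
  simp_rw [key]
  rw [← sum_div, sum_sub_distrib, sum_cos_full (n := 2 * a + d) (by omega) (by omega), pow_add,
    pow_mul]
  rcases Nat.eq_zero_or_pos d with rfl | hd
  · simp
  · rw [sum_cos_full hd (by omega), if_neg (by omega)]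
    simp

end TrigSums

section PathEigenvectors

/-- The eigenvectors of the path on `l` vertices. -/
noncomputable def pathEigenvector (l m : ℕ) (i : Fin l) : ℝ :=
  sin (2 * m * (((i : ℕ) + 1 : ℕ) * (π / (2 * (l + 1 : ℕ)))))

lemma adjMatrix_mulVec_pathEigenvector (l m : ℕ) :
    (SimpleGraph.pathGraph l).adjMatrix ℝ *ᵥ pathEigenvector l m =
      (2 * cos (2 * m * (π / (2 * (l + 1 : ℕ))))) • pathEigenvector l m := by
  ext i
  set x : ℝ := π / (2 * (l + 1 : ℕ)) with hx
  have hsplit : ∀ k : Fin l, (SimpleGraph.pathGraph l).adjMatrix ℝ i k * pathEigenvector l m k =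
      (if (i : ℕ) + 1 = k then pathEigenvector l m k else 0) +
        (if (k : ℕ) + 1 = i then pathEigenvector l m k else 0) := by
    intro k
    rw [SimpleGraph.adjMatrix_apply]
    simp only [SimpleGraph.pathGraph_adj]
    split_ifs <;> first | omega | simp
  have hup : ∑ k : Fin l, (if (i : ℕ) + 1 = k then pathEigenvector l m k else 0) =
      sin (2 * m * (((i : ℕ) + 2 : ℕ) * x)) := by
    by_cases h : (i : ℕ) + 1 < l
    · rw [sum_eq_single (⟨i + 1, h⟩ : Fin l)]
      · simp [pathEigenvector, hx, add_assoc, one_add_one_eq_two]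
      · intro b _ hb
        rw [if_neg]
        intro hb'
        exact hb (Fin.ext hb'.symm)
      · simp
    · have hi : (i : ℕ) + 2 = l + 1 := by omega
      have hl0 : ((l + 1 : ℕ) : ℝ) ≠ 0 := by positivity
      have e : 2 * (m : ℝ) * ((l + 1 : ℕ) * x) = m * π := by rw [hx]; field_simp
      rw [hi, e, sin_nat_mul_pi]
      refine sum_eq_zero fun k _ => if_neg ?_
      omega
  have hdown : ∑ k : Fin l, (if (k : ℕ) + 1 = i then pathEigenvector l m k else 0) =
      sin (2 * m * ((i : ℕ) * x)) := by
    by_cases h : 0 < (i : ℕ)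
    · rw [sum_eq_single (⟨i - 1, by omega⟩ : Fin l)]
      · have : (i : ℕ) - 1 + 1 = i := by omega
        simp only [pathEigenvector, this, if_true, hx]
      · intro b _ hb
        rw [if_neg]
        intro hb'
        exact hb (Fin.ext (by simp; omega))
      · simp
    · have hi : (i : ℕ) = 0 := by omega
      rw [hi]
      simp
  simp only [mulVec, dotProduct, hsplit, sum_add_distrib, hup, hdown, Pi.smul_apply, smul_eq_mul]
  have e0 : pathEigenvector l m i = sin (2 * m * (((i : ℕ) + 1 : ℕ) * x)) := rfl
  have e1 : 2 * (m : ℝ) * (((i : ℕ) + 2 : ℕ) * x) =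
      2 * m * (((i : ℕ) + 1 : ℕ) * x) + 2 * m * x := by push_cast; ring
  have e2 : 2 * (m : ℝ) * ((i : ℕ) * x) =
      2 * m * (((i : ℕ) + 1 : ℕ) * x) - 2 * m * x := by push_cast; ring
  rw [e0, e1, e2, sin_add, sin_sub]
  ring

lemma single_eq_sum_pathEigenvector (l : ℕ) (k : Fin l) :
    Pi.single k (1 : ℝ) =
      ∑ m ∈ range (l + 1), (2 / (l + 1 : ℕ) * pathEigenvector l m k) • pathEigenvector l m := by
  ext i
  have h := sum_sin_mul_sin (L := l + 1) (a := k + 1) (b := i + 1) (by omega) (by omega)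
    (by omega) (by omega)
  simp only [Finset.sum_apply, Pi.smul_apply, smul_eq_mul, mul_assoc]
  rw [← mul_sum]
  unfold pathEigenvector
  rw [h]
  have hl0 : ((l + 1 : ℕ) : ℝ) ≠ 0 := by positivity
  by_cases hik : i = k
  · subst hik
    simp only [Pi.single_eq_same, if_true]
    field_simp
  · rw [Pi.single_eq_of_ne hik, if_neg, mul_zero]
    intro h'
    exact hik (Fin.ext (by omega))

lemma posPart_apply_eq_sum {l : ℕ} {P N : Matrix (Fin l) (Fin l) ℝ} (hP : P.PosSemidef)
    (hN : N.PosSemidef) (hPN : P * N = 0) (h : (SimpleGraph.pathGraph l).adjMatrix ℝ = P - N)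
    (i k : Fin l) :
    P i k = 2 / (l + 1 : ℕ) * ∑ m ∈ range ((l + 1) / 2 + 1),
      2 * cos (2 * m * (π / (2 * (l + 1 : ℕ)))) *
        (pathEigenvector l m k * pathEigenvector l m i) := by
  have hv (m : ℕ) : P *ᵥ pathEigenvector l m =
      max (2 * cos (2 * m * (π / (2 * (l + 1 : ℕ))))) 0 • pathEigenvector l m :=
    posPart_mulVec_eigenvector hP hN hPN (h ▸ adjMatrix_mulVec_pathEigenvector l m)
  have h1 : P i k = (P *ᵥ Pi.single k 1) i := by simp
  rw [h1, single_eq_sum_pathEigenvector, mulVec_sum]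
  simp only [mulVec_smul, hv, Finset.sum_apply, Pi.smul_apply, smul_eq_mul, mul_assoc]
  rw [← mul_sum]
  congr 1
  symm
  refine sum_subset_zero_on_sdiff (fun m hm => ?_) (fun m hm => ?_) fun m hm => ?_
  · simp only [Finset.mem_range] at hm ⊢
    omega
  · simp only [Finset.mem_sdiff, Finset.mem_range] at hm
    have hm1 : ((l + 1 : ℕ) : ℝ) ≤ 2 * m := by
      have : l + 1 ≤ 2 * m := by omega
      exact_mod_cast this
    have hm2 : (m : ℝ) ≤ (l + 1 : ℕ) := by exact_mod_cast hm.1.le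
    have hcos : cos (2 * m * (π / (2 * (l + 1 : ℕ)))) ≤ 0 := by
      apply cos_nonpos_of_pi_div_two_le_of_le
      · rw [mul_div_assoc', div_le_div_iff₀ (by positivity) (by positivity)]
        nlinarith [pi_pos]
      · rw [mul_div_assoc', div_le_iff₀ (by positivity)]
        nlinarith [pi_pos]
    rw [mul_assoc] at hcos
    rw [max_eq_right (by linarith)]
    ring
  · simp only [Finset.mem_range] at hm
    have hm1 : 2 * (m : ℝ) ≤ (l + 1 : ℕ) := by
      have : 2 * m ≤ l + 1 := by omega
      exact_mod_cast this
    have hcos : 0 ≤ cos (2 * m * (π / (2 * (l + 1 : ℕ)))) := by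
      apply cos_nonneg_of_neg_pi_div_two_le_of_le
      · have : 0 ≤ 2 * (m : ℝ) * (π / (2 * (l + 1 : ℕ))) := by positivity
        linarith [pi_pos]
      · rw [mul_div_assoc', div_le_div_iff₀ (by positivity) (by positivity)]
        nlinarith [pi_pos]
    rw [mul_assoc] at hcos
    rw [max_eq_left (by linarith)]
    ring

end PathEigenvectors

section Estimates

lemma le_sin_of_le_of_le_pi_sub {x a : ℝ} (hx : 0 ≤ x) (h1 : 199 * x ≤ a) (h2 : a ≤ π - 199 * x) :
    100 * x ≤ sin a := by
  have aux : ∀ y, 199 * x ≤ y → y ≤ π / 2 → 100 * x ≤ sin y := by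
    intro y hy1 hy2
    refine le_trans ?_ (mul_le_sin (by linarith) hy2)
    rw [div_mul_eq_mul_div, le_div_iff₀ pi_pos]
    nlinarith [pi_lt_d2]
  rcases le_total a (π / 2) with h | h
  · exact aux a h1 h
  · rw [← sin_pi_sub]
    exact aux _ (by linarith) (by linarith)

lemma abs_inv_sin_sub_inv_sin_le {x a : ℝ} (hx : 0 < x) (ha : 100 * x ≤ sin a)
    (hb : 100 * x ≤ sin (a + 2 * x)) :
    |1 / sin a - 1 / sin (a + 2 * x)| ≤ 1 / (5000 * x) := by
  have ha0 : 0 < sin a := by linarith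
  have hb0 : 0 < sin (a + 2 * x) := by linarith
  have hd : |sin (a + 2 * x) - sin a| ≤ 2 * x := by
    have e : sin (a + 2 * x) - sin a = 2 * sin x * cos (a + x) := by
      have e1 : a + 2 * x = (a + x) + x := by ring
      have e2 : sin a = sin ((a + x) - x) := by ring_nf
      rw [e1, e2, sin_add, sin_sub]
      ring
    rw [e, abs_mul, abs_mul, abs_two]
    have h1 : |sin x| ≤ x := by simpa [abs_of_pos hx] using abs_sin_le_abs (x := x)
    nlinarith [abs_cos_le_one (a + x), abs_nonneg (sin x), abs_nonneg (cos (a + x))]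
  rw [div_sub_div _ _ ha0.ne' hb0.ne', one_mul, mul_one, abs_div, abs_of_pos (mul_pos ha0 hb0),
    div_le_div_iff₀ (by positivity) (by positivity)]
  nlinarith [mul_le_mul ha hb (by positivity) ha0.le]

lemma abs_cot_sub_cot_le {x a : ℝ} (hx : 0 < x) (ha : 100 * x ≤ sin a)
    (hb : 100 * x ≤ sin (a + 2 * x)) :
    |cos a / sin a - cos (a + 2 * x) / sin (a + 2 * x)| ≤ 1 / (5000 * x) := by
  have ha0 : 0 < sin a := by linarith
  have hb0 : 0 < sin (a + 2 * x) := by linarith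
  have hd : |cos a * sin (a + 2 * x) - sin a * cos (a + 2 * x)| ≤ 2 * x := by
    have e : cos a * sin (a + 2 * x) - sin a * cos (a + 2 * x) = sin (2 * x) := by
      have e1 : 2 * x = (a + 2 * x) - a := by ring
      conv_rhs => rw [e1, sin_sub]
      ring
    rw [e]
    simpa [abs_of_pos hx] using abs_sin_le_abs (x := 2 * x)
  rw [div_sub_div _ _ ha0.ne' hb0.ne', abs_div, abs_of_pos (mul_pos ha0 hb0),
    div_le_div_iff₀ (by positivity) (by positivity)]
  nlinarith [mul_le_mul ha hb (by positivity) ha0.le]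

lemma le_inv_sin_sub_inv_sin {x : ℝ} (hx : 0 < x) (hx' : x < 1 / 100) :
    999 / (3000 * x) ≤ 1 / (2 * sin x) - 1 / (2 * sin (3 * x)) := by
  have h1 : 0 < sin x := sin_pos_of_pos_of_lt_pi hx (by linarith [pi_gt_three])
  have h3 : 0 < sin (3 * x) := sin_pos_of_pos_of_lt_pi (by linarith) (by linarith [pi_gt_three])
  have e : 1 / (2 * sin x) - 1 / (2 * sin (3 * x)) = cos (2 * x) / sin (3 * x) := by
    have hs : sin (3 * x) - sin x = 2 * cos (2 * x) * sin x := by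
      have e1 : sin (3 * x) = sin (2 * x + x) := by ring_nf
      rw [e1, sin_add, sin_two_mul, cos_two_mul]
      ring
    field_simp
    linarith
  have hc := one_sub_sq_div_two_le_cos (x := 2 * x)
  have hs : sin (3 * x) ≤ 3 * x := sin_le (by linarith)
  rw [e, div_le_div_iff₀ (by positivity) h3]
  nlinarith

lemma le_cot_sub_cot {x : ℝ} (hx : 0 < x) (hx' : x < 1 / 100) :
    999 / (3000 * x) ≤ cos x / (2 * sin x) - cos (3 * x) / (2 * sin (3 * x)) := by
  have h1 : 0 < sin x := sin_pos_of_pos_of_lt_pi hx (by linarith [pi_gt_three])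
  have h3 : 0 < sin (3 * x) := sin_pos_of_pos_of_lt_pi (by linarith) (by linarith [pi_gt_three])
  have e : cos x / (2 * sin x) - cos (3 * x) / (2 * sin (3 * x)) = cos x / sin (3 * x) := by
    have hs : cos x * sin (3 * x) - sin x * cos (3 * x) = 2 * sin x * cos x := by
      have e1 : sin (2 * x) = sin (3 * x - x) := by ring_nf
      rw [← sin_two_mul, e1, sin_sub]
      ring
    field_simp
    linarith
  have hc := one_sub_sq_div_two_le_cos (x := x)
  have hs : sin (3 * x) ≤ 3 * x := sin_le (by linarith)
  rw [e, div_le_div_iff₀ (by positivity) h3]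
  nlinarith

lemma sin_nat_add_half_mul_pi (j : ℕ) : sin ((2 * j + 1) * (π / 2)) = (-1) ^ j := by
  have e : (2 * (j : ℝ) + 1) * (π / 2) = π / 2 + j * π := by ring
  rw [e, sin_add_nat_mul_pi, sin_pi_div_two, mul_one]

lemma cos_nat_add_half_mul_pi (j : ℕ) : cos ((2 * j + 1) * (π / 2)) = 0 := by
  have e : (2 * (j : ℝ) + 1) * (π / 2) = π / 2 + j * π := by ring
  rw [e, cos_add_nat_mul_pi, cos_pi_div_two, mul_zero]

lemma abs_neg_one_pow_mul (j : ℕ) (t : ℝ) : |(-1) ^ j * t| = |t| := by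
  rw [abs_mul, abs_neg_one_pow, one_mul]

/-- The half-range trigonometric sum which computes the entry at `(j, j + 2)`. -/
lemma le_sum_cos_combination {L j : ℕ} (hL : 201 ≤ L) (hj1 : 100 ≤ j) (hj2 : j + 101 ≤ L) :
    21 / 100 * (L : ℝ) ≤ ∑ m ∈ range (L / 2 + 1),
      (cos (2 * m * (π / (2 * L))) + cos (2 * m * (3 * (π / (2 * L)))) -
        cos (2 * m * ((2 * j + 1) * (π / (2 * L)))) -
        cos (2 * m * ((2 * j + 3) * (π / (2 * L))))) := by
  have hLr : (201 : ℝ) ≤ L := by exact_mod_cast hL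
  have hjr : (100 : ℝ) ≤ j := by exact_mod_cast hj1
  have hjL : (j : ℝ) + 101 ≤ L := by exact_mod_cast hj2
  have hL0 : (0 : ℝ) < L := by linarith
  set x : ℝ := π / (2 * L) with hx
  have hx0 : 0 < x := by positivity
  have hxL : L * x = π / 2 := by rw [hx]; field_simp
  have hx1 : x < 1 / 100 := by nlinarith [pi_lt_d2]
  set a : ℝ := (2 * j + 1) * x with ha
  have hb : (2 * (j : ℝ) + 3) * x = a + 2 * x := by rw [ha]; ring
  have hsa : 100 * x ≤ sin a :=
    le_sin_of_le_of_le_pi_sub hx0.le (by nlinarith) (by nlinarith)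
  have hsb : 100 * x ≤ sin (a + 2 * x) :=
    le_sin_of_le_of_le_pi_sub hx0.le (by nlinarith) (by nlinarith)
  have h1 : 0 < sin x := sin_pos_of_pos_of_lt_pi hx0 (by linarith [pi_gt_three])
  have h3 : 0 < sin (3 * x) := sin_pos_of_pos_of_lt_pi (by linarith) (by linarith [pi_gt_three])
  have hfin : 21 / 100 * (L : ℝ) ≤ 999 / (3000 * x) - 1 / (5000 * x) / 2 := by
    have e : 999 / (3000 * x) - 1 / (5000 * x) / 2 = (999 / 3000 - 1 / 10000) / x := by
      field_simp
      norm_num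
    rw [e, le_div_iff₀ hx0, mul_assoc, hxL]
    linarith [pi_lt_d2]
  rw [sum_sub_distrib, sum_sub_distrib, sum_add_distrib, hb, sum_cos_eq h1.ne', sum_cos_eq h3.ne',
    sum_cos_eq (by linarith : sin a ≠ 0), sum_cos_eq (by linarith : sin (a + 2 * x) ≠ 0)]
  have hodd3 : (3 : ℝ) * (π / 2) = (2 * (1 : ℕ) + 1) * (π / 2) := by push_cast; ring
  have hoddb : (2 * (j : ℝ) + 3) * (π / 2) = (2 * (j + 1 : ℕ) + 1) * (π / 2) := by push_cast; ring
  rcases Nat.even_or_odd' L with ⟨M, hM | hM⟩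
  · have hN : 2 * ((L / 2 + 1 : ℕ) : ℝ) - 1 = L + 1 := by
      have : 2 * (L / 2 + 1) = L + 2 := by omega
      have h' : 2 * ((L / 2 + 1 : ℕ) : ℝ) = L + 2 := by exact_mod_cast this
      linarith
    have s1 : sin ((L + 1) * x) = cos x := by
      rw [add_mul, hxL, one_mul, sin_add, sin_pi_div_two, cos_pi_div_two]; ring
    have s3 : sin ((L + 1) * (3 * x)) = -cos (3 * x) := by
      have e : (L + 1) * (3 * x) = 3 * (π / 2) + 3 * x := by rw [← hxL]; ring
      rw [e, sin_add, hodd3, sin_nat_add_half_mul_pi, cos_nat_add_half_mul_pi]; ring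
    have sa : sin ((L + 1) * a) = (-1) ^ j * cos a := by
      have e : (L + 1) * a = (2 * j + 1) * (π / 2) + a := by rw [← hxL, ha]; ring
      rw [e, sin_add, sin_nat_add_half_mul_pi, cos_nat_add_half_mul_pi]; ring
    have sb : sin ((L + 1) * (a + 2 * x)) = -(-1) ^ j * cos (a + 2 * x) := by
      have e : (L + 1) * (a + 2 * x) = (2 * j + 3) * (π / 2) + (a + 2 * x) := by
        rw [← hxL, ha]; ring
      rw [e, sin_add, hoddb, sin_nat_add_half_mul_pi, cos_nat_add_half_mul_pi]; ring
    rw [hN, s1, s3, sa, sb]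
    have hmain := le_cot_sub_cot hx0 hx1
    have herr := abs_cot_sub_cot_le hx0 hsa hsb
    rw [← abs_neg_one_pow_mul j] at herr
    have herr' := (abs_le.mp herr).2
    calc _ ≤ _ := hfin
      _ ≤ (cos x / (2 * sin x) - cos (3 * x) / (2 * sin (3 * x))) -
          ((-1) ^ j * (cos a / sin a - cos (a + 2 * x) / sin (a + 2 * x))) / 2 := by linarith
      _ = _ := by ring
  · have hN : 2 * ((L / 2 + 1 : ℕ) : ℝ) - 1 = L := by
      have : 2 * (L / 2 + 1) = L + 1 := by omega
      have h' : 2 * ((L / 2 + 1 : ℕ) : ℝ) = L + 1 := by exact_mod_cast this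
      linarith
    have s3 : sin (L * (3 * x)) = -1 := by
      have e : L * (3 * x) = 3 * (π / 2) := by rw [← hxL]; ring
      rw [e, hodd3, sin_nat_add_half_mul_pi, pow_one]
    have sa : sin (L * a) = (-1) ^ j := by
      have e : L * a = (2 * j + 1) * (π / 2) := by rw [← hxL, ha]; ring
      rw [e, sin_nat_add_half_mul_pi]
    have sb : sin (L * (a + 2 * x)) = -(-1) ^ j := by
      have e : L * (a + 2 * x) = (2 * j + 3) * (π / 2) := by rw [← hxL, ha]; ring
      rw [e, hoddb, sin_nat_add_half_mul_pi]; ring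
    rw [hN, hxL, sin_pi_div_two, s3, sa, sb]
    have hmain := le_inv_sin_sub_inv_sin hx0 hx1
    have herr := abs_inv_sin_sub_inv_sin_le hx0 hsa hsb
    rw [← abs_neg_one_pow_mul j] at herr
    have herr' := (abs_le.mp herr).2
    calc _ ≤ _ := hfin
      _ ≤ (1 / (2 * sin x) - 1 / (2 * sin (3 * x))) -
          ((-1) ^ j * (1 / sin a - 1 / sin (a + 2 * x))) / 2 := by linarith
      _ = _ := by ring

end Estimates

/-- For the path `P_ℓ` on `ℓ ≥ 200` vertices (labelled `1, …, ℓ`, so `0, …, ℓ - 1` here) with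
spectral decomposition `A = A⁺ − A⁻` of its adjacency matrix, for every `j` with
`100 ≤ j ≤ ℓ − 100` the entry of `A⁻` at the (1-based) position `(j, j + 2)` is at least
`21/100`. -/
theorem stmt_12 (l : ℕ) (hl : 200 ≤ l) (Ap Am : Matrix (Fin l) (Fin l) ℝ)
    (hAp : Ap.PosSemidef) (hAm : Am.PosSemidef) (hmul : Ap * Am = 0)
    (hdecomp : (SimpleGraph.pathGraph l).adjMatrix ℝ = Ap - Am)
    (j : ℕ) (hj1 : 100 ≤ j) (hj2 : j ≤ l - 100) :
    21 / 100 ≤ Am ⟨j - 1, by omega⟩ ⟨j + 1, by omega⟩ := by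
  have hentry : Am ⟨j - 1, by omega⟩ ⟨j + 1, by omega⟩ =
      Ap ⟨j - 1, by omega⟩ ⟨j + 1, by omega⟩ := by
    have h := congrFun (congrFun hdecomp ⟨j - 1, by omega⟩) ⟨j + 1, by omega⟩
    rw [SimpleGraph.adjMatrix_apply, if_neg, Matrix.sub_apply] at h
    · linarith
    · rw [SimpleGraph.pathGraph_adj]
      simp only
      omega
  rw [hentry, posPart_apply_eq_sum hAp hAm hmul hdecomp]
  have hsum := le_sum_cos_combination (L := l + 1) (j := j) (by omega) hj1 (by omega)
  have hl0 : (0 : ℝ) < ((l + 1 : ℕ) : ℝ) := by positivity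
  have hj : j - 1 + 1 = j := by omega
  rw [div_mul_eq_mul_div, le_div_iff₀ hl0, mul_sum]
  refine hsum.trans_eq (sum_congr rfl fun m _ => ?_)
  simp only [pathEigenvector, hj]
  set x : ℝ := π / (2 * (l + 1 : ℕ))
  have product_to_sum (t u : ℝ) : cos t + cos (3 * t) - cos (u - t) - cos (u + t) =
      2 * (2 * cos t * (sin (u / 2 + t) * sin (u / 2 - t))) := by
    have e3 : cos t + cos (3 * t) = 2 * cos t * cos (2 * t) := by
      have e : 3 * t = 2 * t + t := by ring
      have e' : cos t = cos (2 * t - t) := by ring_nf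
      rw [e]
      nth_rewrite 1 [e']
      rw [cos_add, cos_sub]
      ring
    have e2 : cos (2 * t) = cos ((u / 2 + t) - (u / 2 - t)) := by ring_nf
    have eu : cos u = cos ((u / 2 + t) + (u / 2 - t)) := by ring_nf
    have : cos t + cos (3 * t) - cos (u - t) - cos (u + t) =
        2 * cos t * (cos (2 * t) - cos u) := by
      rw [e3, cos_add u t, cos_sub u t]; ring
    rw [this, e2, eu, cos_sub (u / 2 + t) (u / 2 - t), cos_add (u / 2 + t) (u / 2 - t)]
    ring
  convert product_to_sum (2 * m * x) (2 * m * ((2 * j + 2) * x)) using 4 <;>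
    (try push_cast) <;> ring_nf

end SquareEnergy
end

section
/- Let G be a connected claw-free simple graph and let K be a clique of order k in G. Then the graph G − V(K), obtained by deleting the vertices of K, has at most k + 1 connected components. -/
namespace SquareEnergy

/-- `G` is claw-free: it has no induced subgraph isomorphic to `K_{1,3}`. -/
def ClawFree {V : Type*} (G : SimpleGraph V) : Prop :=
  IsEmpty (completeBipartiteGraph (Fin 1) (Fin 3) ↪g G)

/-- In a claw-free graph, three distinct neighbours of a vertex are not pairwise nonadjacent. -/
theorem ClawFree.adj_or_adj_or_adj {V : Type*} {G : SimpleGraph V} (h : ClawFree G) {v a b c : V}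
    (ha : G.Adj v a) (hb : G.Adj v b) (hc : G.Adj v c) (hab : a ≠ b) (hac : a ≠ c) (hbc : b ≠ c) :
    G.Adj a b ∨ G.Adj a c ∨ G.Adj b c := by
  by_contra! hn
  obtain ⟨nab, nac, nbc⟩ := hn
  let f : Fin 1 ⊕ Fin 3 → V := Sum.elim (fun _ => v) ![a, b, c]
  refine h.false ⟨⟨f, ?_⟩, fun {x y} => (?_ : G.Adj (f x) (f y) ↔ _)⟩
  · rintro (i | i) (j | j) hij
    · simp [Subsingleton.elim i j]
    · fin_cases j <;> simp [f] at hij <;> subst hij <;> simp at ha hb hc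
    · fin_cases i <;> simp [f] at hij <;> subst hij <;> simp at ha hb hc
    · fin_cases i <;> fin_cases j <;> simp_all [f]
  · revert x y
    rintro (i | i) (j | j)
    · simp [f]
    · fin_cases j <;> simp [f, ha, hb, hc]
    · fin_cases i <;> simp [f, ha.symm, hb.symm, hc.symm]
    · fin_cases i <;> fin_cases j <;> simp [f, nab, nac, nbc, G.adj_comm b a, G.adj_comm c a, G.adj_comm c b]

/-- The components of `G - S` that contain a neighbour of `v`. -/
def touchedComponents {V : Type*} (G : SimpleGraph V) (S : Set V) (v : V) :
    Set (G.induce Sᶜ).ConnectedComponent :=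
  {C | ∃ z : ↥Sᶜ, (G.induce Sᶜ).connectedComponentMk z = C ∧ G.Adj v z}

/-- Following a walk from a vertex outside `S`, one either reaches a neighbour of `S`, or the
whole walk avoids `S`. -/
theorem exists_mem_touchedComponents_or_reachable {V : Type*} {G : SimpleGraph V} {S : Set V}
    {x y : V} (p : G.Walk x y) (hx : x ∈ Sᶜ) :
    (∃ w ∈ S, (G.induce Sᶜ).connectedComponentMk ⟨x, hx⟩ ∈ touchedComponents G S w) ∨
      ∃ hy : y ∈ Sᶜ, (G.induce Sᶜ).Reachable ⟨x, hx⟩ ⟨y, hy⟩ := by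
  induction p with
  | nil => exact .inr ⟨hx, .rfl⟩
  | @cons u v w h p ih =>
    by_cases hv : v ∈ S
    · exact .inl ⟨v, hv, ⟨u, hx⟩, rfl, h.symm⟩
    · have huv : (G.induce Sᶜ).Reachable ⟨u, hx⟩ ⟨v, hv⟩ :=
        SimpleGraph.Adj.reachable (G := G.induce Sᶜ) h
      rw [SimpleGraph.ConnectedComponent.eq.2 huv]
      exact (ih hv).imp_right fun ⟨hy, hr⟩ => ⟨hy, huv.trans hr⟩

/-- Vertices in different components of `G - S` are distinct and nonadjacent in `G`. -/
theorem ne_and_not_adj_of_connectedComponentMk_ne {V : Type*} {G : SimpleGraph V} {S : Set V}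
    {x y : ↥Sᶜ}
    (h : (G.induce Sᶜ).connectedComponentMk x ≠ (G.induce Sᶜ).connectedComponentMk y) :
    (x : V) ≠ y ∧ ¬ G.Adj x y :=
  ⟨fun e => h (congrArg _ (Subtype.ext e)), fun e => h <| SimpleGraph.ConnectedComponent.eq.2 <|
    SimpleGraph.Adj.reachable (G := G.induce Sᶜ) e⟩

theorem ClawFree.ncard_touchedComponents_le_two {V : Type*} [Finite V] {G : SimpleGraph V}
    (h : ClawFree G) (S : Set V) (v : V) : (touchedComponents G S v).ncard ≤ 2 := by
  by_contra! hlt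
  obtain ⟨A, B, C, ⟨a, rfl, ha⟩, ⟨b, rfl, hb⟩, ⟨c, rfl, hc⟩, hab, hac, hbc⟩ :=
    (Set.two_lt_ncard_iff).1 hlt
  have hab := ne_and_not_adj_of_connectedComponentMk_ne hab
  have hac := ne_and_not_adj_of_connectedComponentMk_ne hac
  have hbc := ne_and_not_adj_of_connectedComponentMk_ne hbc
  have := h.adj_or_adj_or_adj ha hb hc hab.1 hac.1 hbc.1
  tauto

/-- If `v ∈ S` touches two components of `G - S`, then every neighbour `u ∈ S` of `v` touches one
of the components touched by `v`. -/
theorem ClawFree.touchedComponents_inter_nonempty {V : Type*} [Finite V] {G : SimpleGraph V}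
    (h : ClawFree G) {S : Set V} {u v : V} (hu : u ∈ S) (huv : G.Adj v u)
    (hv : 1 < (touchedComponents G S v).ncard) :
    (touchedComponents G S u ∩ touchedComponents G S v).Nonempty := by
  obtain ⟨A, B, ⟨a, rfl, ha⟩, ⟨b, rfl, hb⟩, hab⟩ := (Set.one_lt_ncard_iff).1 hv
  have hab := ne_and_not_adj_of_connectedComponentMk_ne hab
  rcases h.adj_or_adj_or_adj ha hb huv hab.1 (fun e => a.2 (e ▸ hu)) (fun e => b.2 (e ▸ hu))
    with e | e | e
  · exact absurd e hab.2
  · exact ⟨_, ⟨a, rfl, e.symm⟩, ⟨a, rfl, ha⟩⟩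
  · exact ⟨_, ⟨b, rfl, e.symm⟩, ⟨b, rfl, hb⟩⟩

/-- A family of sets indexed by `K`, each of size at most two, such that any two-element member
meets every other member, has a union of size at most `K.card + 1`. -/
theorem ncard_biUnion_le_card_add_one {α ι : Type*} [Finite α] [DecidableEq ι] (K : Finset ι)
    (N : ι → Set α) (hN : ∀ v ∈ K, (N v).ncard ≤ 2)
    (hmeet : ∀ v ∈ K, ∀ u ∈ K, u ≠ v → 1 < (N v).ncard → (N u ∩ N v).Nonempty) :
    (⋃ v ∈ K, N v).ncard ≤ K.card + 1 := by
  by_cases hex : ∃ v ∈ K, 1 < (N v).ncard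
  · obtain ⟨v, hv, h1⟩ := hex
    have hsub : (⋃ u ∈ K, N u) ⊆ N v ∪ ⋃ u ∈ K.erase v, (N u \ N v) := by
      intro x hx
      simp only [Set.mem_iUnion, Set.mem_union, Finset.mem_erase, Set.mem_sdiff] at hx ⊢
      grind
    have hdiff : ∀ u ∈ K.erase v, (N u \ N v).ncard ≤ 1 := fun u hu => by
      obtain ⟨huv, huK⟩ := Finset.mem_erase.1 hu
      have hpos := (Set.ncard_pos).2 (hmeet v hv u huK huv h1)
      have hadd := Set.ncard_inter_add_ncard_sdiff_eq_ncard (N u) (N v)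
      have := hN u huK
      omega
    have hsum := (Finset.set_ncard_biUnion_le (K.erase v) fun u => N u \ N v).trans
      (Finset.sum_le_card_nsmul _ _ 1 hdiff)
    have hle := (Set.ncard_le_ncard hsub).trans (Set.ncard_union_le _ _)
    have hcard := Finset.card_erase_add_one hv
    have := hN v hv
    rw [smul_eq_mul, mul_one] at hsum
    omega
  · push Not at hex
    have hsum := (Finset.set_ncard_biUnion_le K N).trans (Finset.sum_le_card_nsmul _ _ 1 hex)
    rw [smul_eq_mul, mul_one] at hsum
    omega

/-- If `G` is a connected claw-free graph and `K` is a clique of order `k` in `G`, then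
`G − V(K)` has at most `k + 1` connected components. -/
theorem stmt_13 {V : Type*} [Fintype V] [DecidableEq V] (G : SimpleGraph V)
    (hconn : G.Connected) (hclaw : ClawFree G)
    (k : ℕ) (K : Finset V) (hK : G.IsNClique k K) :
    Nat.card (G.induce ((K : Set V)ᶜ)).ConnectedComponent ≤ k + 1 := by
  obtain ⟨hclique, rfl⟩ := hK
  rcases K.eq_empty_or_nonempty with rfl | ⟨y, hy⟩
  · have : Subsingleton (G.induce (((∅ : Finset V) : Set V)ᶜ)).ConnectedComponent := by
      refine ⟨fun A B => ?_⟩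
      induction A using SimpleGraph.ConnectedComponent.ind with | _ a
      induction B using SimpleGraph.ConnectedComponent.ind with | _ b
      obtain ⟨p⟩ := hconn.preconnected a b
      rcases exists_mem_touchedComponents_or_reachable p a.2 with ⟨w, hw, -⟩ | ⟨_, hr⟩
      · simp at hw
      · exact SimpleGraph.ConnectedComponent.eq.2 hr
    simpa using Finite.card_le_one_iff_subsingleton |>.2 this
  · have hcover : ⋃ v ∈ K, touchedComponents G K v = Set.univ := by
      refine Set.eq_univ_of_forall fun A => ?_
      induction A using SimpleGraph.ConnectedComponent.ind with | _ a
      obtain ⟨p⟩ := hconn.preconnected a y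
      rcases exists_mem_touchedComponents_or_reachable p a.2 with ⟨w, hw, hmem⟩ | ⟨hy', -⟩
      · exact Set.mem_biUnion (Finset.mem_coe.1 hw) hmem
      · exact absurd hy hy'
    rw [← Set.ncard_univ, ← hcover]
    exact ncard_biUnion_le_card_add_one K _
      (fun v _ => hclaw.ncard_touchedComponents_le_two _ v)
      fun v hv u hu huv => hclaw.touchedComponents_inter_nonempty hu (hclique hv hu huv.symm)

end SquareEnergy
end

section
/- Let G be a simple graph of order n with domination number γ(G) = 2. Then λ_1(G)² + λ_2(G)² ≥ n − 2, where λ_1(G) ≥ λ_2(G) are the two largest eigenvalues of the adjacency matrix of G. -/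
open Matrix

namespace SquareEnergy

/-- The largest adjacency eigenvalue `λ₁(G)`. -/
noncomputable def lambda1 {V : Type*} [Fintype V] [DecidableEq V] (G : SimpleGraph V) : ℝ :=
  sSup (Set.range (adjEig G))

/-- The second largest adjacency eigenvalue `λ₂(G)` (the maximum over pairs of distinct
eigenvalue indices of the smaller of the two eigenvalues). -/
noncomputable def lambda2 {V : Type*} [Fintype V] [DecidableEq V] (G : SimpleGraph V) : ℝ :=
  sSup {x : ℝ | ∃ i j : V, i ≠ j ∧ x = min (adjEig G i) (adjEig G j)}

/-- `S` is a dominating set of `G`: every vertex outside `S` has a neighbour in `S`. -/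
def IsDominatingSet {V : Type*} (G : SimpleGraph V) (S : Finset V) : Prop :=
  ∀ v : V, v ∉ S → ∃ u ∈ S, G.Adj u v

/-- The domination number of `G`: the minimum size of a dominating set. -/
noncomputable def dominationNumber {V : Type*} (G : SimpleGraph V) : ℕ :=
  sInf {k : ℕ | ∃ S : Finset V, S.card = k ∧ IsDominatingSet G S}

theorem _root_.Matrix.IsHermitian.dotProduct_mulVec_eq_sum {V : Type*} [Fintype V] [DecidableEq V]
    {M : Matrix V V ℝ} (hM : M.IsHermitian) (x : V → ℝ) :
    x ⬝ᵥ M *ᵥ x =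
      ∑ i, hM.eigenvalues i * inner ℝ (hM.eigenvectorBasis i) (WithLp.toLp 2 x) ^ 2 := by
  have hM' : Mᵀ = M := by rw [← conjTranspose_eq_transpose_of_trivial]; exact hM
  have hx : x ⬝ᵥ M *ᵥ x = inner ℝ (WithLp.toLp 2 x) (WithLp.toLp 2 (M *ᵥ x)) := by
    simp [EuclideanSpace.inner_toLp_toLp, dotProduct_comm]
  rw [hx, ← hM.eigenvectorBasis.sum_inner_mul_inner]
  refine Finset.sum_congr rfl fun i _ => ?_
  have h : inner ℝ (hM.eigenvectorBasis i) (WithLp.toLp 2 (M *ᵥ x)) =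
      hM.eigenvalues i * inner ℝ (hM.eigenvectorBasis i) (WithLp.toLp 2 x) := by
    simp only [EuclideanSpace.inner_eq_star_dotProduct, star_trivial]
    rw [dotProduct_comm, dotProduct_mulVec, ← mulVec_transpose, hM', hM.mulVec_eigenvectorBasis,
      smul_dotProduct, smul_eq_mul, dotProduct_comm]
  rw [h, real_inner_comm]
  ring

theorem inner_sq_add_inner_sq_le {E : Type*} [NormedAddCommGroup E] [InnerProductSpace ℝ E]
    {e p q : E} (he : inner ℝ e e = 1) (hp : inner ℝ p p = 1) (hq : inner ℝ q q = 1)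
    (hpq : inner ℝ p q = 0) : inner ℝ e p ^ 2 + inner ℝ e q ^ 2 ≤ 1 := by
  have h := real_inner_self_nonneg (x := e - inner ℝ e p • p - inner ℝ e q • q)
  simp only [inner_sub_left, inner_sub_right, real_inner_smul_left, real_inner_smul_right, he, hp,
    hq, hpq, real_inner_comm e p, real_inner_comm e q, real_inner_comm p q] at h
  simp only [real_inner_comm p e, real_inner_comm q e] at h ⊢
  linarith

theorem adjEig_le_lambda1 {V : Type*} [Fintype V] [DecidableEq V] (G : SimpleGraph V) (i : V) :
    adjEig G i ≤ lambda1 G :=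
  le_csSup (Set.finite_range _).bddAbove (Set.mem_range_self i)

theorem exists_adjEig_eq_lambda1 {V : Type*} [Fintype V] [DecidableEq V] [Nonempty V]
    (G : SimpleGraph V) : ∃ i, adjEig G i = lambda1 G :=
  (Set.range_nonempty _).csSup_mem (Set.finite_range (adjEig G))

theorem adjEig_le_lambda2 {V : Type*} [Fintype V] [DecidableEq V] (G : SimpleGraph V) {i j : V}
    (hij : i ≠ j) (hj : adjEig G j = lambda1 G) : adjEig G i ≤ lambda2 G := by
  refine le_csSup ⟨lambda1 G, ?_⟩ ⟨i, j, hij, ?_⟩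
  · rintro x ⟨k, l, -, rfl⟩
    exact (min_le_left _ _).trans (adjEig_le_lambda1 G k)
  · rw [hj, min_eq_left (adjEig_le_lambda1 G i)]

theorem lambda2_le_lambda1 {V : Type*} [Fintype V] [DecidableEq V] [Nontrivial V]
    (G : SimpleGraph V) : lambda2 G ≤ lambda1 G := by
  obtain ⟨i, j, hij⟩ := exists_pair_ne V
  refine csSup_le ⟨_, i, j, hij, rfl⟩ ?_
  rintro x ⟨k, l, -, rfl⟩
  exact (min_le_left _ _).trans (adjEig_le_lambda1 G k)

theorem dotProduct_adjMatrix_mulVec_eq_sum {V : Type*} [Fintype V] [DecidableEq V]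
    (G : SimpleGraph V) [DecidableRel G.Adj] :
    ∃ b : OrthonormalBasis V ℝ (EuclideanSpace ℝ V), ∀ x : V → ℝ,
      x ⬝ᵥ G.adjMatrix ℝ *ᵥ x = ∑ i, adjEig G i * inner ℝ (b i) (WithLp.toLp 2 x) ^ 2 := by
  let inst := Classical.decRel G.Adj
  refine ⟨(adj_isHermitian G).eigenvectorBasis, fun x => ?_⟩
  rw [show adjEig G = (adj_isHermitian G).eigenvalues from rfl,
    ← (adj_isHermitian G).dotProduct_mulVec_eq_sum]
  congr!

theorem sum_inner_toLp_sq {V : Type*} [Fintype V]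
    (b : OrthonormalBasis V ℝ (EuclideanSpace ℝ V)) (x : V → ℝ) :
    ∑ i, inner ℝ (b i) (WithLp.toLp 2 x) ^ 2 = x ⬝ᵥ x := by
  have h := b.sum_inner_mul_inner (WithLp.toLp 2 x) (WithLp.toLp 2 x)
  simp only [EuclideanSpace.inner_toLp_toLp, star_trivial] at h
  rw [← h]
  exact Finset.sum_congr rfl fun i _ => by rw [real_inner_comm, sq]

/-- The Rayleigh quotient of the adjacency matrix is at most `λ₁`. -/
theorem dotProduct_adjMatrix_mulVec_le_lambda1 {V : Type*} [Fintype V] [DecidableEq V]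
    (G : SimpleGraph V) [DecidableRel G.Adj] {p : V → ℝ} (hp : p ⬝ᵥ p = 1) :
    p ⬝ᵥ G.adjMatrix ℝ *ᵥ p ≤ lambda1 G := by
  obtain ⟨b, hb⟩ := dotProduct_adjMatrix_mulVec_eq_sum G
  calc p ⬝ᵥ G.adjMatrix ℝ *ᵥ p = _ := hb p
    _ ≤ ∑ i, lambda1 G * inner ℝ (b i) (WithLp.toLp 2 p) ^ 2 :=
      Finset.sum_le_sum fun i _ =>
        mul_le_mul_of_nonneg_right (adjEig_le_lambda1 G i) (sq_nonneg _)
    _ = lambda1 G := by rw [← Finset.mul_sum, sum_inner_toLp_sq, hp, mul_one]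

/-- Ky Fan's inequality for the sum of the two largest adjacency eigenvalues. -/
theorem add_dotProduct_adjMatrix_mulVec_le {V : Type*} [Fintype V] [DecidableEq V] [Nontrivial V]
    (G : SimpleGraph V) [DecidableRel G.Adj] {p q : V → ℝ} (hp : p ⬝ᵥ p = 1) (hq : q ⬝ᵥ q = 1)
    (hpq : p ⬝ᵥ q = 0) :
    p ⬝ᵥ G.adjMatrix ℝ *ᵥ p + q ⬝ᵥ G.adjMatrix ℝ *ᵥ q ≤ lambda1 G + lambda2 G := by
  obtain ⟨b, hb⟩ := dotProduct_adjMatrix_mulVec_eq_sum G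
  obtain ⟨j, hj⟩ := exists_adjEig_eq_lambda1 G
  set w : V → ℝ := fun i =>
    inner ℝ (b i) (WithLp.toLp 2 p) ^ 2 + inner ℝ (b i) (WithLp.toLp 2 q) ^ 2 with hw
  have hw0 (i : V) : 0 ≤ w i := by positivity
  have hw1 : w j ≤ 1 := inner_sq_add_inner_sq_le (by simp)
    ((EuclideanSpace.inner_toLp_toLp _ _).trans hp) ((EuclideanSpace.inner_toLp_toLp _ _).trans hq)
    ((EuclideanSpace.inner_toLp_toLp _ _).trans ((dotProduct_comm _ _).trans hpq))
  have hsum : ∑ i, w i = 2 := by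
    rw [hw, Finset.sum_add_distrib, sum_inner_toLp_sq, sum_inner_toLp_sq, hp, hq]; norm_num
  have hj' := Finset.add_sum_erase Finset.univ w (Finset.mem_univ j)
  calc _ = ∑ i, adjEig G i * w i := by
        rw [hb, hb, ← Finset.sum_add_distrib]
        exact Finset.sum_congr rfl fun i _ => by rw [hw, mul_add]
    _ = lambda1 G * w j + ∑ i ∈ Finset.univ.erase j, adjEig G i * w i := by
        rw [← hj, Finset.add_sum_erase Finset.univ (fun i => adjEig G i * w i) (Finset.mem_univ j)]
    _ ≤ lambda1 G * w j + ∑ i ∈ Finset.univ.erase j, lambda2 G * w i := by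
        gcongr with i hi
        · exact adjEig_le_lambda2 G (Finset.ne_of_mem_erase hi) hj
    _ = lambda1 G * w j + lambda2 G * (2 - w j) := by
        rw [← Finset.mul_sum, ← hsum, ← hj']; ring
    _ ≤ lambda1 G + lambda2 G := by
        nlinarith [mul_nonneg (sub_nonneg.2 (lambda2_le_lambda1 G)) (sub_nonneg.2 hw1)]

/-- A star with centre `u` and leaves `s` supports a unit vector whose Rayleigh quotient is at
least `√|s|`. -/
theorem exists_star_vector {V : Type*} [Fintype V] [DecidableEq V] (G : SimpleGraph V)
    [DecidableRel G.Adj] (u : V) (s : Finset V) (hs : ∀ x ∈ s, G.Adj u x) :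
    ∃ p : V → ℝ, (∀ x, x ≠ u → x ∉ s → p x = 0) ∧ p ⬝ᵥ p = 1 ∧
      √(s.card : ℝ) ≤ p ⬝ᵥ G.adjMatrix ℝ *ᵥ p := by
  have hus : u ∉ s := fun h => G.loopless.irrefl u (hs u h)
  rcases s.eq_empty_or_nonempty with rfl | hne
  · exact ⟨Pi.single u 1, fun x hx _ => Pi.single_eq_of_ne hx _, by simp, by simp⟩
  have hk : (0 : ℝ) < s.card := by exact_mod_cast hne.card_pos
  have hsq := Real.sq_sqrt hk.le
  set r := √(s.card : ℝ)
  set f : V → ℝ := fun x => if x ∈ s then 1 else 0 with hf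
  set g : V → ℝ := Pi.single u r + f with hg
  have hfu : f u = 0 := by simp [hf, hus]
  have hff : f ⬝ᵥ f = s.card := by simp [hf, dotProduct]
  have hgg : g ⬝ᵥ g = 2 * s.card := by
    simp only [hg, add_dotProduct, dotProduct_add, single_dotProduct, dotProduct_single,
      Pi.add_apply, Pi.single_eq_same, hfu, hff]
    linarith
  have hf0 (x : V) : 0 ≤ f x := by simp only [hf]; split_ifs <;> norm_num
  have hMf : (G.adjMatrix ℝ *ᵥ f) u = s.card := by
    have hsub : G.neighborFinset u ∩ s = s :=
      Finset.inter_eq_right.2 fun x hx => by simpa using hs x hx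
    simp [hf, SimpleGraph.adjMatrix_mulVec_apply, hsub]
  have hfM : (f ᵥ* G.adjMatrix ℝ) u = s.card := by
    rw [← hMf, ← mulVec_transpose, SimpleGraph.transpose_adjMatrix]
  have hfMf : 0 ≤ f ⬝ᵥ G.adjMatrix ℝ *ᵥ f := by
    refine Finset.sum_nonneg fun x _ => mul_nonneg (hf0 x) ?_
    rw [SimpleGraph.adjMatrix_mulVec_apply]
    exact Finset.sum_nonneg fun y _ => hf0 y
  have hgMg : 2 * r * s.card ≤ g ⬝ᵥ G.adjMatrix ℝ *ᵥ g := by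
    have h1 : f ⬝ᵥ G.adjMatrix ℝ *ᵥ Pi.single u r = s.card * r := by
      rw [dotProduct_mulVec, dotProduct_single, hfM]
    have h2 : 0 ≤ r * (G.adjMatrix ℝ *ᵥ Pi.single u r) u := by
      simp
    simp only [hg, mulVec_add, add_dotProduct, dotProduct_add, h1]
    simp only [single_dotProduct, hMf]
    linarith
  have hc : (√(2 * (s.card : ℝ)))⁻¹ * (√(2 * (s.card : ℝ)))⁻¹ = (2 * (s.card : ℝ))⁻¹ := by
    rw [← mul_inv, Real.mul_self_sqrt (by positivity)]
  refine ⟨(√(2 * (s.card : ℝ)))⁻¹ • g, fun x hxu hxs => ?_, ?_, ?_⟩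
  · simp [hg, hf, hxu, hxs]
  · rw [smul_dotProduct, dotProduct_smul, smul_smul, hc, hgg, smul_eq_mul]
    exact inv_mul_cancel₀ (by positivity)
  · rw [mulVec_smul, smul_dotProduct, dotProduct_smul, smul_smul, hc, smul_eq_mul,
      inv_mul_eq_div, le_div_iff₀ (by positivity)]
    linarith

/-- If `G` has order `n` and domination number `2`, then `λ₁(G)² + λ₂(G)² ≥ n − 2`. -/
theorem stmt_14 {V : Type*} [Fintype V] [DecidableEq V] (G : SimpleGraph V) [DecidableRel G.Adj]
    (hdom : dominationNumber G = 2) :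
    (Fintype.card V : ℝ) - 2 ≤ lambda1 G ^ 2 + lambda2 G ^ 2 := by
  obtain ⟨S, hS, hSdom⟩ : ∃ S : Finset V, S.card = 2 ∧ IsDominatingSet G S := by
    have h : dominationNumber G ∈ {k : ℕ | ∃ S : Finset V, S.card = k ∧ IsDominatingSet G S} :=
      Nat.sInf_mem ⟨_, Finset.univ, rfl, fun v hv => absurd (Finset.mem_univ v) hv⟩
    rwa [hdom] at h
  obtain ⟨u, v, huv, rfl⟩ := Finset.card_eq_two.1 hS
  have : Nontrivial V := ⟨u, v, huv⟩
  set s : Finset V := (({u, v} : Finset V)ᶜ).filter (G.Adj u) with hs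
  set t : Finset V := (({u, v} : Finset V)ᶜ).filter (fun x => ¬ G.Adj u x) with ht
  have hcard : (s.card : ℝ) + t.card = Fintype.card V - 2 := by
    have h1 : s.card + t.card = ({u, v} : Finset V)ᶜ.card :=
      Finset.card_filter_add_card_filter_not _
    have h2 := Finset.card_compl_add_card ({u, v} : Finset V)
    rw [hS, ← h1] at h2
    rw [← h2]; push_cast; ring
  obtain ⟨p, hp0, hp1, hpM⟩ := exists_star_vector G u s fun x hx => (Finset.mem_filter.1 hx).2
  obtain ⟨q, hq0, hq1, hqM⟩ := exists_star_vector G v t fun x hx => by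
    obtain ⟨hx, hux⟩ := Finset.mem_filter.1 hx
    obtain ⟨y, hy, hyx⟩ := hSdom x (Finset.mem_compl.1 hx)
    rcases Finset.mem_insert.1 hy with rfl | hy
    · exact absurd hyx hux
    · rwa [Finset.mem_singleton.1 hy] at hyx
  have hpq : p ⬝ᵥ q = 0 := by
    refine Finset.sum_eq_zero fun x _ => ?_
    by_cases hx : x = u ∨ x ∈ s
    · rw [hq0 x, mul_zero] <;> rcases hx with rfl | hx <;> simp_all
    · rw [not_or] at hx
      rw [hp0 x hx.1 hx.2, zero_mul]
  have hL1 := dotProduct_adjMatrix_mulVec_le_lambda1 G hp1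
  have hL2 := dotProduct_adjMatrix_mulVec_le_lambda1 G hq1
  have hsum := add_dotProduct_adjMatrix_mulVec_le G hp1 hq1 hpq
  set a := √(s.card : ℝ)
  set b := √(t.card : ℝ)
  have ha : 0 ≤ a := Real.sqrt_nonneg _
  have hb : 0 ≤ b := Real.sqrt_nonneg _
  have hab : (Fintype.card V : ℝ) - 2 = a ^ 2 + b ^ 2 := by
    rw [Real.sq_sqrt (by positivity), Real.sq_sqrt (by positivity), hcard]
  rw [hab]
  rcases le_total (a + b) (lambda1 G) with h | h
  · nlinarith [sq_nonneg (lambda2 G), mul_nonneg ha hb]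
  · nlinarith [mul_nonneg (sub_nonneg.2 (hpM.trans hL1)) (sub_nonneg.2 (hqM.trans hL2)),
      pow_le_pow_left₀ (sub_nonneg.2 h)
        (show a + b - lambda1 G ≤ lambda2 G by linarith) 2]

end SquareEnergy
end

section
/- For all integers k ≥ ℓ ≥ 0, the graph H(k,ℓ) of order n = k + ℓ + 5, obtained from a 5-cycle v₁v₂v₃v₄v₅ by attaching k pendant leaves at v₁ and ℓ pendant leaves at v₃, satisfies s⁺(H(k,ℓ)) ≥ n − 1. -/
open Matrix

namespace SquareEnergy

/-- The graph `H(k,ℓ)`: a 5-cycle `v₁v₂v₃v₄v₅` (here `0,1,2,3,4` on `Fin 5`) with `k` pendant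
leaves attached at `v₁` (vertex `0`) and `ℓ` pendant leaves attached at `v₃` (vertex `2`).
Its order is `k + ℓ + 5`. -/
def pentagonLeaves (k l : ℕ) : SimpleGraph (Fin 5 ⊕ (Fin k ⊕ Fin l)) :=
  SimpleGraph.fromRel (fun a b =>
    match a, b with
    | Sum.inl x, Sum.inl y => y.val = x.val + 1 ∨ (x.val = 0 ∧ y.val = 4)
    | Sum.inl x, Sum.inr (Sum.inl _) => x = 0
    | Sum.inl x, Sum.inr (Sum.inr _) => x = 2
    | _, _ => False)

/-- If the Hermitian matrix `A` vanishes off the rows and columns in `C`, then at most `#C` of its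
eigenvalues have a given strict sign (that of `σ`). -/
theorem card_filter_eigenvalues_le {V : Type*} [Fintype V] [DecidableEq V] {A : Matrix V V ℝ}
    (hA : A.IsHermitian) (σ : ℝ) (C : Finset V) (hC : ∀ i ∉ C, ∀ j ∉ C, A i j = 0) :
    (Finset.univ.filter fun i => 0 < σ * hA.eigenvalues i).card ≤ C.card := by
  by_contra! hlt
  set P := Finset.univ.filter fun i => 0 < σ * hA.eigenvalues i with hP
  let b := hA.eigenvectorBasis
  let F : (P → ℝ) →ₗ[ℝ] (C → ℝ) :=
    (Matrix.of fun (r : C) (i : P) => b i r).mulVecLin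
  have hker : LinearMap.ker F ≠ ⊥ := LinearMap.ker_ne_bot_of_finrank_lt (by simpa using hlt)
  obtain ⟨c, hc, hc0⟩ := (Submodule.ne_bot_iff _).mp hker
  let x : EuclideanSpace ℝ V := ∑ i : P, c i • b i
  have hx (r : V) : x r = ∑ i : P, c i * b i r := by simp [x]
  have hxC (r : V) (hr : r ∈ C) : x r = 0 := by
    have := congrFun (LinearMap.mem_ker.mp hc) ⟨r, hr⟩
    rw [hx]
    simpa [F, Matrix.mulVec, dotProduct, mul_comm] using this
  have hAx : A *ᵥ ⇑x = ⇑(∑ i : P, (c i * hA.eigenvalues i) • b i) := by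
    have : (⇑x : V → ℝ) = ∑ i : P, c i • ⇑(b i) := by
      ext r
      simp [hx]
    rw [this, Matrix.mulVec_sum]
    ext r
    simp only [Matrix.mulVec_smul, b, hA.mulVec_eigenvectorBasis]
    simp [mul_assoc]
  have hquad : ∑ r, x r * (A *ᵥ ⇑x) r = 0 := by
    refine Finset.sum_eq_zero fun r _ => ?_
    by_cases hr : r ∈ C
    · simp [hxC r hr]
    · refine mul_eq_zero_of_right _ (Finset.sum_eq_zero fun s _ => ?_)
      by_cases hs : s ∈ C
      · simp [hxC s hs]
      · simp [hC r hr s hs]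
  have hspec : ∑ r, x r * (A *ᵥ ⇑x) r = ∑ i : P, c i * (c i * hA.eigenvalues i) := by
    have hon : Orthonormal ℝ fun i : P => b i :=
      b.orthonormal.comp _ Subtype.val_injective
    have := hon.inner_sum c (fun i => c i * hA.eigenvalues i) Finset.univ
    rw [hAx]
    simp only [conj_trivial] at this
    rw [← this, PiLp.inner_apply]
    simp [x, mul_comm]
  obtain ⟨i, hi⟩ := Function.ne_iff.mp hc0
  have hpos : 0 < ∑ i : P, c i ^ 2 * (σ * hA.eigenvalues i) := by
    refine Finset.sum_pos' (fun j _ => ?_) ⟨i, Finset.mem_univ _, ?_⟩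
    · exact mul_nonneg (sq_nonneg _) (Finset.mem_filter.mp j.2).2.le
    · exact mul_pos (sq_pos_of_ne_zero hi) (Finset.mem_filter.mp i.2).2
  have : ∑ i : P, c i ^ 2 * (σ * hA.eigenvalues i) = 0 := by
    rw [← mul_zero σ, ← hquad, hspec, Finset.mul_sum]
    exact Finset.sum_congr rfl fun _ _ => by ring
  exact hpos.ne' this

theorem det_one_add_smul_eq_prod {V : Type*} [Fintype V] [DecidableEq V] {A : Matrix V V ℝ}
    (hA : A.IsHermitian) (t : ℝ) :
    (1 + t • A).det = ∏ i, (1 + hA.eigenvalues i * t) := by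
  rcases eq_or_ne t 0 with rfl | ht
  · simp
  have h1 : (1 + t • A) = (-t) • (Matrix.scalar V (-t⁻¹) - A) := by
    ext i j
    by_cases hij : i = j
    · subst hij
      simp [ht, mul_sub]
    · simp [hij]
  rw [h1, Matrix.det_smul, ← Matrix.eval_charpoly, hA.charpoly_eq, Polynomial.eval_prod,
    Fintype.card, ← Finset.prod_const, ← Finset.prod_mul_distrib]
  refine Finset.prod_congr rfl fun i _ => ?_
  simp
  field_simp
  ring

/-- At most three nonnegative numbers can be padded with zeros to exactly three. -/
theorem exists_three_of_card_le {ι : Type*} (s : Finset ι) (f : ι → ℝ) (hs : s.card ≤ 3)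
    (hf : ∀ i ∈ s, 0 ≤ f i) :
    ∃ x y z : ℝ, 0 ≤ x ∧ 0 ≤ y ∧ 0 ≤ z ∧ ∑ i ∈ s, f i ^ 2 = x ^ 2 + y ^ 2 + z ^ 2 ∧
      ∀ t, ∏ i ∈ s, (1 + f i * t) = (1 + x * t) * (1 + y * t) * (1 + z * t) := by
  classical
  obtain h | h | h | h : s.card = 0 ∨ s.card = 1 ∨ s.card = 2 ∨ s.card = 3 := by lia
  · obtain rfl := Finset.card_eq_zero.mp h
    exact ⟨0, 0, 0, by simp⟩
  · obtain ⟨a, rfl⟩ := Finset.card_eq_one.mp h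
    exact ⟨f a, 0, 0, by simpa using hf⟩
  · obtain ⟨a, b, hab, rfl⟩ := Finset.card_eq_two.mp h
    exact ⟨f a, f b, 0, hf a (by simp), hf b (by simp), le_rfl, by simp [hab],
      fun t => by simp [hab]⟩
  · obtain ⟨a, b, c, hab, hac, hbc, rfl⟩ := Finset.card_eq_three.mp h
    exact ⟨f a, f b, f c, hf a (by simp), hf b (by simp), hf c (by simp),
      by simp [hab, hac, hbc, add_assoc], fun t => by simp [hab, hac, hbc, mul_assoc]⟩

theorem pentagonLeaves_adj_cycle (k l : ℕ) (i j : Fin 5) :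
    (pentagonLeaves k l).Adj (Sum.inl i) (Sum.inl j) ↔ j = i + 1 ∨ i = j + 1 := by
  fin_cases i <;> fin_cases j <;> simp [pentagonLeaves]

theorem pentagonLeaves_adj_cycle_leaf (k l : ℕ) (i : Fin 5) (j : Fin k ⊕ Fin l) :
    (pentagonLeaves k l).Adj (Sum.inl i) (Sum.inr j) ↔
      Sum.elim (fun _ => i = 0) (fun _ => i = 2) j := by
  cases j <;> simp [pentagonLeaves]

theorem pentagonLeaves_not_adj_leaf (k l : ℕ) (i j : Fin k ⊕ Fin l) :
    ¬ (pentagonLeaves k l).Adj (Sum.inr i) (Sum.inr j) := by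
  simp [pentagonLeaves]

theorem adjMatrix_pentagonLeaves (k l : ℕ) [DecidableRel (pentagonLeaves k l).Adj] :
    (pentagonLeaves k l).adjMatrix ℝ =
      fromBlocks (Matrix.of fun i j => if j = i + 1 ∨ i = j + 1 then 1 else 0)
        (Matrix.of fun i => Sum.elim (fun _ => if i = 0 then 1 else 0)
          (fun _ => if i = 2 then 1 else 0))
        (Matrix.of fun i => Sum.elim (fun _ => if i = 0 then 1 else 0)
          (fun _ => if i = 2 then 1 else 0))ᵀ 0 := by
  ext (i | i) (j | j)
  · simp [SimpleGraph.adjMatrix_apply, pentagonLeaves_adj_cycle]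
  · cases j <;> simp [SimpleGraph.adjMatrix_apply, pentagonLeaves_adj_cycle_leaf]
  · cases i <;> simp [SimpleGraph.adjMatrix_apply, SimpleGraph.adj_comm _ (Sum.inr _) (Sum.inl _),
      pentagonLeaves_adj_cycle_leaf]
  · simp [SimpleGraph.adjMatrix_apply, pentagonLeaves_not_adj_leaf]

theorem det_one_add_smul_pentagonLeaves (k l : ℕ) [DecidableRel (pentagonLeaves k l).Adj] (t : ℝ) :
    (1 + t • (pentagonLeaves k l).adjMatrix ℝ).det =
      1 - (k + l + 5) * t ^ 2 + (5 + 3 * k + 3 * l + k * l) * t ^ 4 + 2 * t ^ 5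
        - (k + l + k * l) * t ^ 6 := by
  let L : Matrix (Fin 5) (Fin k ⊕ Fin l) ℝ := Matrix.of fun i =>
    Sum.elim (fun _ => if i = 0 then t else 0) (fun _ => if i = 2 then t else 0)
  let C : Matrix (Fin 5) (Fin 5) ℝ :=
    !![1, t, 0, 0, t; t, 1, t, 0, 0; 0, t, 1, t, 0; 0, 0, t, 1, t; t, 0, 0, t, 1]
  have hblock : 1 + t • (pentagonLeaves k l).adjMatrix ℝ = fromBlocks C L Lᵀ 1 := by
    rw [adjMatrix_pentagonLeaves]
    ext (i | i | i) (j | j | j)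
    · fin_cases i <;> fin_cases j <;> simp [C]
    all_goals simp [L, Matrix.one_apply]
  have hschur : C - L * Lᵀ = !![1 - k * t ^ 2, t, 0, 0, t; t, 1, t, 0, 0;
      0, t, 1 - l * t ^ 2, t, 0; 0, 0, t, 1, t; t, 0, 0, t, 1] := by
    ext i j
    fin_cases i <;> fin_cases j <;> simp [C, L, Matrix.mul_apply, sq]
  rw [hblock, det_fromBlocks_one₂₂, hschur]
  simp [Matrix.det_succ_row_zero, Fin.sum_univ_succ, Fin.succAbove]
  ring

theorem coeffs_eq_zero {a₁ a₂ a₃ a₄ a₅ a₆ : ℝ}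
    (h : ∀ t : ℝ, a₁ * t + a₂ * t ^ 2 + a₃ * t ^ 3 + a₄ * t ^ 4 + a₅ * t ^ 5 + a₆ * t ^ 6 = 0) :
    a₁ = 0 ∧ a₂ = 0 ∧ a₃ = 0 ∧ a₄ = 0 ∧ a₅ = 0 ∧ a₆ = 0 := by
  have h1 := h 1
  have h2 := h (-1)
  have h3 := h 2
  have h4 := h (-2)
  have h5 := h 3
  have h6 := h (-3)
  norm_num at h1 h2 h3 h4 h5 h6
  refine ⟨?_, ?_, ?_, ?_, ?_, ?_⟩ <;> linarith

/-- Elementary symmetric functions of three nonnegative numbers satisfy `9 e₃ ≤ e₁ e₂`. -/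
theorem nine_mul_le_esymm {x y z : ℝ} (hx : 0 ≤ x) (hy : 0 ≤ y) (hz : 0 ≤ z) :
    9 * (x * y * z) ≤ (x + y + z) * (x * y + y * z + z * x) := by
  nlinarith [mul_nonneg hx (sq_nonneg (y - z)), mul_nonneg hy (sq_nonneg (z - x)),
    mul_nonneg hz (sq_nonneg (x - y))]

theorem sq_sum_lower_bound {k l x y z u v w : ℝ} (hk : 0 ≤ k) (hl : 0 ≤ l)
    (hx : 0 ≤ x) (hy : 0 ≤ y) (hz : 0 ≤ z) (hu : 0 ≤ u) (hv : 0 ≤ v) (hw : 0 ≤ w)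
    (h : ∀ t : ℝ, (1 + x * t) * (1 + y * t) * (1 + z * t) *
        ((1 + u * -t) * (1 + v * -t) * (1 + w * -t)) =
      1 - (k + l + 5) * t ^ 2 + (5 + 3 * k + 3 * l + k * l) * t ^ 4 + 2 * t ^ 5
        - (k + l + k * l) * t ^ 6) :
    k + l + 5 - 1 ≤ x ^ 2 + y ^ 2 + z ^ 2 := by
  have hp := nine_mul_le_esymm hx hy hz
  have hq := nine_mul_le_esymm hu hv hw
  set e₁ := x + y + z with he₁
  set e₂ := x * y + y * z + z * x with he₂
  set e₃ := x * y * z with he₃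
  set f₁ := u + v + w with hf₁
  set f₂ := u * v + v * w + w * u with hf₂
  set f₃ := u * v * w with hf₃
  have he₁0 : 0 ≤ e₁ := by positivity
  have he₂0 : 0 ≤ e₂ := by positivity
  have he₃0 : 0 ≤ e₃ := by positivity
  have hf₂0 : 0 ≤ f₂ := by positivity
  have hf₃0 : 0 ≤ f₃ := by positivity
  obtain ⟨h1, h2, h3, h4, h5, -⟩ := coeffs_eq_zero (a₁ := e₁ - f₁)
    (a₂ := e₂ + f₂ - e₁ * f₁ + (k + l + 5)) (a₃ := e₃ - f₃ + e₁ * f₂ - e₂ * f₁)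
    (a₄ := e₂ * f₂ - e₁ * f₃ - e₃ * f₁ - (5 + 3 * k + 3 * l + k * l))
    (a₅ := e₃ * f₂ - e₂ * f₃ - 2) (a₆ := -(e₃ * f₃) + (k + l + k * l)) fun t => by
      have ht := h t
      simp only [he₁, he₂, he₃, hf₁, hf₂, hf₃]
      linear_combination ht
  have hef : f₁ = e₁ := by linarith
  rw [hef] at hq h2 h3 h4
  have hsq : x ^ 2 + y ^ 2 + z ^ 2 = e₁ ^ 2 - 2 * e₂ := by
    simp only [he₁, he₂]
    ring
  have hkl : 0 ≤ k * l := mul_nonneg hk hl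
  have hm : 4 ≤ e₂ + f₂ := by
    have hef₂ : 4 ≤ e₂ * f₂ := by linarith [mul_nonneg he₁0 hf₃0, mul_nonneg he₃0 he₁0]
    exact (pow_le_pow_iff_left₀ (by norm_num) (by linarith) two_ne_zero).mp
      (by linarith [sq_nonneg (e₂ - f₂)])
  have he₁2 : 2 ≤ e₁ := (pow_le_pow_iff_left₀ (by norm_num) he₁0 two_ne_zero).mp (by linarith)
  have hem : 2 * 4 ≤ e₁ * (e₂ + f₂) := mul_le_mul he₁2 hm (by norm_num) he₁0
  have hδ : (e₂ - f₂) * (e₁ * (e₂ + f₂) - (e₃ + f₃)) = 4 := by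
    linear_combination (-(e₂ + f₂)) * h3 + 2 * h5
  rw [hsq]
  by_contra! hlt
  have hgt : 1 < e₂ - f₂ := by linarith
  have hgap : 4 < e₁ * (e₂ + f₂) - (e₃ + f₃) := by linarith
  linarith [mul_pos (sub_pos.mpr hgt) (sub_pos.mpr hgap)]

theorem card_filter_eigenvalues_pentagonLeaves_le (k l : ℕ)
    [DecidableRel (pentagonLeaves k l).Adj] (σ : ℝ) :
    (Finset.univ.filter fun i =>
      0 < σ * (adj_isHermitian (pentagonLeaves k l)).eigenvalues i).card ≤ 3 := by
  refine card_filter_eigenvalues_le _ σ {Sum.inl 0, Sum.inl 2, Sum.inl 3} ?_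
  rw [adjMatrix_pentagonLeaves]
  rintro (i | i | i) hi (j | j | j) hj
  · fin_cases i <;> fin_cases j <;> simp_all
  all_goals simp_all

/-- For `k ≥ ℓ ≥ 0`, the graph `H(k,ℓ)` of order `n = k + ℓ + 5` satisfies `s⁺ ≥ n − 1`. -/
theorem stmt_15 (k l : ℕ) (hkl : l ≤ k) :
    (k : ℝ) + l + 5 - 1 ≤ sPlus (pentagonLeaves k l) := by
  let := Classical.decRel (pentagonLeaves k l).Adj
  have hcard := card_filter_eigenvalues_pentagonLeaves_le k l
  have hdet (t : ℝ) := (det_one_add_smul_eq_prod (adj_isHermitian (pentagonLeaves k l)) t).symm.trans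
    (det_one_add_smul_pentagonLeaves k l t)
  change _ ≤ ∑ i, if 0 < (adj_isHermitian (pentagonLeaves k l)).eigenvalues i then
    (adj_isHermitian (pentagonLeaves k l)).eigenvalues i ^ 2 else 0
  generalize (adj_isHermitian (pentagonLeaves k l)).eigenvalues = ev at hcard hdet ⊢
  obtain ⟨x, y, z, hx, hy, hz, hsum, hpos⟩ := exists_three_of_card_le
    (Finset.univ.filter fun i => 0 < ev i) ev (by simpa using hcard 1)
    fun i hi => (Finset.mem_filter.mp hi).2.le
  obtain ⟨u, v, w, hu, hv, hw, -, hneg⟩ := exists_three_of_card_le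
    (Finset.univ.filter fun i => ev i < 0) (fun i => -ev i) (by simpa using hcard (-1))
    fun i hi => neg_nonneg.mpr (Finset.mem_filter.mp hi).2.le
  rw [← Finset.sum_filter, hsum]
  refine sq_sum_lower_bound k.cast_nonneg l.cast_nonneg hx hy hz hu hv hw fun t => ?_
  rw [← hdet t, ← hpos, ← hneg, Finset.prod_filter, Finset.prod_filter, ← Finset.prod_mul_distrib]
  refine Finset.prod_congr rfl fun i _ => ?_
  rcases lt_trichotomy (ev i) 0 with hi | hi | hi
  · simp [hi, hi.le]
  · simp [hi]
  · simp [hi, hi.le]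

end SquareEnergy
end

section
/- Let G be a connected simple graph of order n such that α(G)·ω(G) ≤ n/17, where α(G) is the independence number and ω(G) is the clique number of G. Then s⁺(G) ≥ n and s⁻(G) ≥ n. -/
open Matrix

namespace SquareEnergy

/-- Negative square energy `s⁻(G)`. -/
noncomputable def sMinus {V : Type*} [Fintype V] [DecidableEq V] (G : SimpleGraph V) : ℝ :=
  ∑ i, if adjEig G i < 0 then (adjEig G i) ^ 2 else 0

/-- The clique number `ω(G)`: the maximum size of a set of pairwise adjacent vertices. -/
noncomputable def cliqueNum {V : Type*} (G : SimpleGraph V) : ℕ :=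
  sSup {k : ℕ | ∃ s : Finset V, G.IsNClique k s}

/-- The independence number `α(G)`: the maximum size of a set of pairwise non-adjacent
vertices, i.e. the clique number of the complement. -/
noncomputable def indepNum {V : Type*} (G : SimpleGraph V) : ℕ :=
  sSup {k : ℕ | ∃ s : Finset V, Gᶜ.IsNClique k s}

/-- The Motzkin–Straus inequality: a nonnegative weighting of the vertices of a graph all of whose
cliques have at most `ω` vertices. -/
theorem motzkin_straus {V : Type*} [Fintype V] [DecidableEq V] (G : SimpleGraph V)
    [DecidableRel G.Adj] {ω : ℕ} (hω : ∀ s : Finset V, G.IsClique s → s.card ≤ ω)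
    (x : V → ℝ) (hx : ∀ i, 0 ≤ x i) :
    ω * (x ⬝ᵥ G.adjMatrix ℝ *ᵥ x) ≤ (ω - 1) * (∑ i, x i) ^ 2 := by
  induction hk : (Finset.univ.filter fun i => x i ≠ 0).card using Nat.strong_induction_on
    generalizing x with
  | _ k ih =>
  by_cases hc : G.IsClique (Finset.univ.filter fun i => x i ≠ 0 : Finset V)
  · have hquad : x ⬝ᵥ G.adjMatrix ℝ *ᵥ x = (∑ i, x i) ^ 2 - ∑ i, x i ^ 2 := by
      have hrow : ∀ i, x i * (G.adjMatrix ℝ *ᵥ x) i = x i * ∑ j, x j - x i ^ 2 := by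
        intro i
        by_cases hi : x i = 0
        · simp [hi]
        · have : (G.adjMatrix ℝ *ᵥ x) i = ∑ j, x j - x i := by
            rw [← Finset.add_sum_erase _ _ (Finset.mem_univ i), add_sub_cancel_left]
            rw [mulVec, dotProduct, ← Finset.add_sum_erase _ _ (Finset.mem_univ i)]
            simp only [SimpleGraph.adjMatrix_apply, SimpleGraph.irrefl, if_false, zero_mul, zero_add]
            refine Finset.sum_congr rfl fun j hj => ?_
            by_cases hj0 : x j = 0
            · simp [hj0]
            · rw [if_pos, one_mul]
              exact hc (by simpa using hi) (by simpa using hj0) (Finset.ne_of_mem_erase hj).symm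
          rw [this]; ring
      rw [dotProduct, Finset.sum_congr rfl fun i _ => hrow i, Finset.sum_sub_distrib,
        ← Finset.sum_mul, sq (∑ i, x i)]
    have hcs : (∑ i, x i) ^ 2 ≤ ω * ∑ i, x i ^ 2 := by
      have h1 := sq_sum_le_card_mul_sum_sq (s := Finset.univ.filter fun i => x i ≠ 0) (f := x)
      have h2 : ∑ i with x i ≠ 0, x i = ∑ i, x i := Finset.sum_filter_ne_zero _
      have h3 : ∑ i with x i ≠ 0, x i ^ 2 ≤ ∑ i, x i ^ 2 :=
        Finset.sum_le_sum_of_subset_of_nonneg (Finset.filter_subset _ _)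
          fun i _ _ => sq_nonneg _
      rw [h2] at h1
      refine h1.trans (mul_le_mul (by exact_mod_cast hω _ hc) h3
        (Finset.sum_nonneg fun i _ => sq_nonneg _) (by positivity))
    rw [hquad]
    linarith
  · obtain ⟨i, j, hi, hj, hij, hadj, hle⟩ : ∃ i j, x i ≠ 0 ∧ x j ≠ 0 ∧ i ≠ j ∧ ¬ G.Adj i j ∧
        (G.adjMatrix ℝ *ᵥ x) j ≤ (G.adjMatrix ℝ *ᵥ x) i := by
      simp only [SimpleGraph.IsClique, Set.Pairwise] at hc
      push Not at hc
      obtain ⟨i, hi, j, hj, hij, hadj⟩ := hc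
      simp only [Finset.coe_filter, Finset.mem_univ, true_and, Set.mem_ofPred_eq] at hi hj
      rcases le_total ((G.adjMatrix ℝ *ᵥ x) j) ((G.adjMatrix ℝ *ᵥ x) i) with h | h
      · exact ⟨i, j, hi, hj, hij, hadj, h⟩
      · exact ⟨j, i, hj, hi, hij.symm, fun h => hadj h.symm, h⟩
    set d : V → ℝ := Pi.single i 1 - Pi.single j 1 with hd
    set y : V → ℝ := x + x j • d with hy
    have hyv : ∀ v, y v = if v = j then 0 else if v = i then x i + x j else x v := by
      intro v
      by_cases hvj : v = j
      · subst hvj; simp [hy, hd, hij.symm]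
      · by_cases hvi : v = i
        · subst hvi; simp [hy, hd, hvj]
        · simp [hy, hd, hvi, hvj]
    have hsum : ∑ v, y v = ∑ v, x v := by
      simp [hy, hd, Finset.sum_add_distrib, ← Finset.mul_sum]
    have hdx : d ⬝ᵥ G.adjMatrix ℝ *ᵥ x
        = (G.adjMatrix ℝ *ᵥ x) i - (G.adjMatrix ℝ *ᵥ x) j := by
      simp [hd, sub_dotProduct]
    have hxd : x ⬝ᵥ G.adjMatrix ℝ *ᵥ d = d ⬝ᵥ G.adjMatrix ℝ *ᵥ x := by
      rw [dotProduct_mulVec, ← mulVec_transpose, G.transpose_adjMatrix, dotProduct_comm]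
    have hdd : d ⬝ᵥ G.adjMatrix ℝ *ᵥ d = 0 := by
      have hadj' : ¬ G.Adj j i := fun h => hadj h.symm
      simp [hd, sub_dotProduct, mulVec_sub, hadj, hadj']
    have hq : x ⬝ᵥ G.adjMatrix ℝ *ᵥ x ≤ y ⬝ᵥ G.adjMatrix ℝ *ᵥ y := by
      have : y ⬝ᵥ G.adjMatrix ℝ *ᵥ y = x ⬝ᵥ G.adjMatrix ℝ *ᵥ x
          + 2 * x j * ((G.adjMatrix ℝ *ᵥ x) i - (G.adjMatrix ℝ *ᵥ x) j) := by
        rw [hy, mulVec_add, dotProduct_add, add_dotProduct, add_dotProduct, mulVec_smul,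
          dotProduct_smul, dotProduct_smul, smul_dotProduct, smul_dotProduct, hdd, hxd, hdx]
        simp only [smul_eq_mul]
        ring
      rw [this]
      nlinarith [hx j, mul_nonneg (hx j) (sub_nonneg.2 hle)]
    have hcard : (Finset.univ.filter fun v => y v ≠ 0).card < k := by
      rw [← hk]
      refine Finset.card_lt_card (Finset.ssubset_iff_of_subset ?_ |>.2 ⟨j, ?_, ?_⟩)
      · intro v hv
        simp only [Finset.mem_filter, Finset.mem_univ, true_and] at hv ⊢
        rw [hyv] at hv
        by_cases hvj : v = j
        · simp [hvj] at hv
        · by_cases hvi : v = i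
          · rwa [hvi]
          · simpa [hvi, hvj] using hv
      · simpa using hj
      · simp [hyv]
    have hy0 : ∀ v, 0 ≤ y v := by
      intro v
      rw [hyv]
      split_ifs
      · exact le_rfl
      · exact add_nonneg (hx i) (hx j)
      · exact hx v
    have := ih _ hcard y hy0 rfl
    rw [hsum] at this
    exact (mul_le_mul_of_nonneg_left hq (Nat.cast_nonneg ω)).trans this

/-- Testing `A` (for `σ = 1`) or `-A` (for `σ = -1`) against the positive semidefinite matrix
`B * B` bounds the sum of the squares of the positive, resp. negative, eigenvalues of `A`. -/
theorem sum_signed_sq_eigenvalues_ge {V : Type*} [Fintype V] [DecidableEq V] {A : Matrix V V ℝ}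
    (hA : A.IsHermitian) {B : Matrix V V ℝ} (hB : B.IsSymm)
    {σ : ℝ} (hσ : σ ^ 2 = 1) :
    2 * (σ * (A * (B * B)).trace) - ((B * B) * (B * B)).trace ≤
      ∑ i, if 0 < σ * hA.eigenvalues i then hA.eigenvalues i ^ 2 else 0 := by
  set U : Matrix V V ℝ := hA.eigenvectorUnitary.1
  have hUU : U * Uᵀ = 1 := by
    have := Unitary.coe_mul_star_self hA.eigenvectorUnitary
    rwa [Unitary.coe_star, star_eq_conjTranspose, conjTranspose_eq_transpose_of_trivial] at this
  have hspec : A = U * diagonal hA.eigenvalues * Uᵀ := by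
    have := hA.spectral_theorem
    rw [Unitary.conjStarAlgAut_apply] at this
    simpa [star_eq_conjTranspose, conjTranspose_eq_transpose_of_trivial] using this
  set N : Matrix V V ℝ := Uᵀ * (B * B) * U with hN
  have hBB : (B * B)ᵀ = B * B := by rw [transpose_mul, hB.eq]
  have hNs : Nᵀ = N := by
    rw [hN, transpose_mul, transpose_mul, hBB, transpose_transpose, Matrix.mul_assoc Uᵀ]
  have hN0 : ∀ i, 0 ≤ N i i := by
    intro i
    have : N = (B * U)ᵀ * (B * U) := by
      rw [transpose_mul, hB.eq, hN]; simp only [Matrix.mul_assoc]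
    rw [this, mul_apply]
    exact Finset.sum_nonneg fun j _ => by rw [transpose_apply]; exact mul_self_nonneg _
  have h1 : (A * (B * B)).trace = ∑ i, hA.eigenvalues i * N i i := by
    have : (A * (B * B)).trace = (diagonal hA.eigenvalues * N).trace := by
      conv_lhs => rw [hspec]
      rw [hN, Matrix.mul_assoc, Matrix.mul_assoc, trace_mul_comm]
      simp only [Matrix.mul_assoc]
    rw [this, trace]
    simp [diagonal_mul]
  have h2 : ∑ i, N i i ^ 2 ≤ ((B * B) * (B * B)).trace := by
    have : ((B * B) * (B * B)).trace = (N * N).trace := by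
      have : N * N = Uᵀ * ((B * B) * (B * B) * U) := by
        calc N * N = Uᵀ * (B * B) * (U * Uᵀ) * (B * B) * U := by
              rw [hN]; simp only [Matrix.mul_assoc]
          _ = _ := by rw [hUU]; simp only [Matrix.mul_assoc, Matrix.mul_one]
      rw [this, trace_mul_comm Uᵀ, Matrix.mul_assoc _ U, hUU, Matrix.mul_one]
    rw [this, trace]
    refine Finset.sum_le_sum fun i _ => ?_
    rw [diag_apply, mul_apply, sq]
    refine Finset.single_le_sum (f := fun j => N i j * N j i) (fun j _ => ?_) (Finset.mem_univ i)
    rw [← congrFun (congrFun hNs j) i, transpose_apply]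
    exact mul_self_nonneg _
  have h3 : 2 * (σ * ∑ i, hA.eigenvalues i * N i i) - ∑ i, N i i ^ 2 ≤
      ∑ i, if 0 < σ * hA.eigenvalues i then hA.eigenvalues i ^ 2 else 0 := by
    rw [Finset.mul_sum, Finset.mul_sum, ← Finset.sum_sub_distrib]
    refine Finset.sum_le_sum fun i _ => ?_
    split_ifs with h
    · have : (σ * hA.eigenvalues i) ^ 2 = hA.eigenvalues i ^ 2 := by rw [mul_pow, hσ, one_mul]
      nlinarith [sq_nonneg (σ * hA.eigenvalues i - N i i)]
    · nlinarith [hN0 i, mul_nonneg (neg_nonneg.2 (not_lt.1 h)) (hN0 i)]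
  rw [h1]
  linarith

/-- Symmetric edge weights minimising `5 ∑ F i j ^ 2 + ∑ (1 - ∑ F i j) ^ 2`, described by the
optimality conditions in terms of the defects `1 - ∑ F i j`. -/
theorem exists_optimal_weights {V : Type*} [Fintype V] [DecidableEq V] (G : SimpleGraph V) :
    ∃ (F : V → V → ℝ) (a : V → ℝ), (∀ i, ∑ j, F i j = 1 - a i) ∧ (∀ i j, F i j = F j i) ∧
      (∀ i j, 0 ≤ F i j) ∧ (∀ i j, ¬ G.Adj i j → F i j = 0) ∧
      (∀ i j, G.Adj i j → a i + a j ≤ 10 * F i j) ∧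
      (∀ i j, F i j * (10 * F i j - (a i + a j)) = 0) := by
  set C : Set (V → V → ℝ) :=
    {F | (∀ i j, F i j = F j i) ∧ ∀ i j, ¬ G.Adj i j → F i j = 0} ∩ Set.Icc 0 1 with hC
  have hcomp : IsCompact C := by
    refine isCompact_Icc.inter_left ?_
    simp only [Set.ofPred_and, Set.ofPred_forall]
    refine IsClosed.inter ?_ ?_
    · exact isClosed_iInter fun i => isClosed_iInter fun j =>
        isClosed_eq (by fun_prop) (by fun_prop)
    · exact isClosed_iInter fun i => isClosed_iInter fun j => isClosed_iInter fun _ =>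
        isClosed_eq (by fun_prop) (by fun_prop)
  set P : (V → V → ℝ) → ℝ := fun F =>
    5 * ∑ i, ∑ j, F i j ^ 2 + ∑ i, (1 - ∑ j, F i j) ^ 2 with hP
  obtain ⟨F, ⟨⟨hsymm, hsupp⟩, hF0, hF1⟩, hmin⟩ :=
    hcomp.exists_isMinOn (f := P) ⟨0, by simp [hC]⟩ (by fun_prop)
  set a : V → ℝ := fun i => 1 - ∑ j, F i j with ha
  have hF0' : ∀ i j, 0 ≤ F i j := fun i j => hF0 i j
  have hF1' : ∀ i j, F i j ≤ 1 := fun i j => hF1 i j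
  have ha1 : ∀ i, a i ≤ 1 := fun i => sub_le_self _ (Finset.sum_nonneg fun j _ => hF0' i j)
  -- the first-order condition along the edge `ij`
  have key : ∀ i j, G.Adj i j → ∀ c : ℝ, 0 ≤ F i j + c → F i j + c ≤ 1 →
      0 ≤ c * (10 * F i j - (a i + a j)) := by
    intro i j hij c hc0 hc1
    set E : V → V → ℝ := fun u v => (if u = i then 1 else 0) * (if v = j then 1 else 0) +
      (if u = j then 1 else 0) * (if v = i then 1 else 0) with hE
    have hne := hij.ne
    have hP' : ∀ t : ℝ, P (F + (t * c) • E) = P F +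
        t * (2 * (c * (10 * F i j - (a i + a j)))) + t ^ 2 * (12 * c ^ 2) := by
      intro t
      have hrow : ∀ u, ∑ v, E u v = (if u = i then 1 else 0) + (if u = j then 1 else 0) := by
        intro u
        simp [hE, Finset.sum_add_distrib]
      have hFE : ∑ u, ∑ v, F u v * E u v = 2 * F i j := by
        simp only [hE, mul_add, Finset.sum_add_distrib]
        simp [hsymm j i, two_mul]
      have hEE : ∑ u, ∑ v, E u v ^ 2 = 2 := by
        have : ∀ u v, E u v ^ 2 = E u v := by
          intro u v
          by_cases h1 : u = i <;> by_cases h2 : u = j <;> simp_all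
        simp only [this]
        simp only [hrow, Finset.sum_add_distrib]
        norm_num
      have hae : ∑ u, a u * ∑ v, E u v = a i + a j := by
        simp [hrow, mul_add, Finset.sum_add_distrib]
      have hee : ∑ u, (∑ v, E u v) ^ 2 = 2 := by
        have : ∀ u, (∑ v, E u v) ^ 2 = ∑ v, E u v := by
          intro u
          rw [hrow]
          by_cases h1 : u = i <;> by_cases h2 : u = j <;> simp_all
        simp only [this]
        simp only [hrow, Finset.sum_add_distrib]
        norm_num
      have h1 : ∑ u, ∑ v, (F u v + t * c * E u v) ^ 2 = ∑ u, ∑ v, F u v ^ 2 +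
          2 * (t * c) * ∑ u, ∑ v, F u v * E u v + (t * c) ^ 2 * ∑ u, ∑ v, E u v ^ 2 := by
        simp only [Finset.mul_sum, ← Finset.sum_add_distrib]
        exact Finset.sum_congr rfl fun u _ => Finset.sum_congr rfl fun v _ => by ring
      have h2 : ∑ u, (1 - ∑ v, (F u v + t * c * E u v)) ^ 2 = ∑ u, a u ^ 2 -
          2 * (t * c) * ∑ u, a u * ∑ v, E u v + (t * c) ^ 2 * ∑ u, (∑ v, E u v) ^ 2 := by
        rw [Finset.mul_sum, Finset.mul_sum, ← Finset.sum_sub_distrib, ← Finset.sum_add_distrib]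
        refine Finset.sum_congr rfl fun u _ => ?_
        rw [Finset.sum_add_distrib, ← Finset.mul_sum]
        ring
      simp only [hP, Pi.add_apply, Pi.smul_apply, smul_eq_mul, h1, h2, hFE, hEE, hae, hee]
      ring
    have hmem : ∀ t : ℝ, 0 ≤ t → t ≤ 1 → F + (t * c) • E ∈ C := by
      intro t ht0 ht1
      have hval : ∀ u v, (F + (t * c) • E) u v = F u v ∨
          (G.Adj u v ∧ F u v = F i j ∧ (F + (t * c) • E) u v = F i j + t * c) := by
        intro u v
        by_cases h1 : u = i ∧ v = j
        · obtain ⟨rfl, rfl⟩ := h1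
          right; simp [hE, hij, hne]
        · by_cases h2 : u = j ∧ v = i
          · obtain ⟨rfl, rfl⟩ := h2
            right; simp [hE, hij.symm, hne.symm, hsymm u v]
          · left
            simp only [Pi.add_apply, Pi.smul_apply, hE, ite_zero_mul_ite_zero, if_neg h1, if_neg h2,
              add_zero, smul_zero]
      refine ⟨⟨fun u v => ?_, fun u v huv => ?_⟩, fun u v => ?_, fun u v => ?_⟩
      · simp only [Pi.add_apply, Pi.smul_apply, hE, hsymm u v, smul_eq_mul]
        ring
      · rcases hval u v with h | ⟨h, _⟩
        · rw [h, hsupp u v huv]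
        · exact absurd h huv
      · rcases hval u v with h | ⟨_, _, h⟩ <;> rw [h]
        · exact hF0' u v
        · simp only [Pi.zero_apply]; nlinarith [hF0' i j]
      · rcases hval u v with h | ⟨_, _, h⟩ <;> rw [h]
        · exact hF1' u v
        · simp only [Pi.one_apply]; nlinarith [hF1' i j]
    by_contra! hneg
    set b := c * (10 * F i j - (a i + a j))
    have hc2 : 0 ≤ c ^ 2 := sq_nonneg c
    set t : ℝ := -b / (-b + 12 * c ^ 2 + 1)
    have hden : 0 < -b + 12 * c ^ 2 + 1 := by linarith
    have ht0 : 0 < t := div_pos (by linarith) hden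
    have ht : t * (-b + 12 * c ^ 2 + 1) = -b := div_mul_cancel₀ _ hden.ne'
    have ht1 : t ≤ 1 := by rw [div_le_one hden]; linarith
    have h1 := hmin (hmem t ht0.le ht1)
    rw [Set.mem_ofPred_eq, hP'] at h1
    have h2 : 0 ≤ t * (2 * b + t * (12 * c ^ 2)) := by linarith
    have h3 : 0 ≤ 2 * b + t * (12 * c ^ 2) := nonneg_of_mul_nonneg_right h2 ht0
    nlinarith
  refine ⟨F, a, fun i => by simp [ha], hsymm, hF0', hsupp, fun i j hij => ?_, fun i j => ?_⟩
  · rcases (hF1' i j).lt_or_eq with h | h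
    · have := key i j hij (1 - F i j) (by linarith) (by linarith)
      have := nonneg_of_mul_nonneg_right this (by linarith)
      linarith
    · rw [h]; linarith [ha1 i, ha1 j]
  · by_cases hij : G.Adj i j
    · have h1 := key i j hij (-F i j) (by linarith) (by linarith)
      have h2 : 0 ≤ 10 * F i j - (a i + a j) := by
        rcases (hF1' i j).lt_or_eq with h | h
        · have := key i j hij (1 - F i j) (by linarith) (by linarith)
          exact nonneg_of_mul_nonneg_right this (by linarith)
        · rw [h]; linarith [ha1 i, ha1 j]
      have h3 := mul_nonneg (hF0' i j) h2
      linarith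
    · rw [hsupp i j hij, zero_mul]

theorem card_le_cliqueNum {V : Type*} [Fintype V] (G : SimpleGraph V) (s : Finset V)
    (hs : G.IsClique s) : s.card ≤ cliqueNum G := by
  refine le_csSup ⟨Fintype.card V, ?_⟩ ⟨s, hs, rfl⟩
  rintro k ⟨t, ht⟩
  exact ht.card_eq ▸ t.card_le_univ

/-- The dual form of the Motzkin–Straus inequality, in terms of independent sets. -/
theorem sq_sum_le_indepNum_mul {V : Type*} [Fintype V] [DecidableEq V] (G : SimpleGraph V)
    [DecidableRel G.Adj] (x : V → ℝ) (hx : ∀ i, 0 ≤ x i) :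
    (∑ i, x i) ^ 2 ≤ indepNum G * (∑ i, x i ^ 2 + x ⬝ᵥ G.adjMatrix ℝ *ᵥ x) := by
  have h := motzkin_straus Gᶜ (card_le_cliqueNum Gᶜ) x hx
  have hsum : x ⬝ᵥ x + x ⬝ᵥ G.adjMatrix ℝ *ᵥ x + x ⬝ᵥ Gᶜ.adjMatrix ℝ *ᵥ x = (∑ i, x i) ^ 2 := by
    have h1 := congrArg (fun M => x ⬝ᵥ M *ᵥ x)
      (G.one_add_adjMatrix_add_compl_adjMatrix_eq_of_one (α := ℝ))
    simp only [add_mulVec, dotProduct_add, one_mulVec] at h1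
    rw [← SimpleGraph.compl_adjMatrix_eq_adjMatrix_compl, h1]
    simp [dotProduct, mulVec, ← Finset.sum_mul, sq]
  have hxx : x ⬝ᵥ x = ∑ i, x i ^ 2 := Finset.sum_congr rfl fun i _ => (sq (x i)).symm
  change (indepNum G : ℝ) * _ ≤ ((indepNum G : ℝ) - 1) * _ at h
  rw [hxx] at hsum
  have : x ⬝ᵥ Gᶜ.adjMatrix ℝ *ᵥ x = (∑ i, x i) ^ 2 - (∑ i, x i ^ 2 + x ⬝ᵥ G.adjMatrix ℝ *ᵥ x) := by
    linarith
  rw [this] at h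
  linarith

theorem trace_fourth_le {V : Type*} [Fintype V] {F : Matrix V V ℝ} (hF : F.IsSymm)
    (hF0 : ∀ i j, 0 ≤ F i j) (hrow : ∀ i, ∑ j, F i j ≤ 2) :
    ((F * F) * (F * F)).trace ≤ 4 * (F * F).trace := by
  have hsymm : ∀ i j, F i j = F j i := fun i j => (hF.apply i j).symm
  have h2 : (F * F).trace = ∑ j, ∑ k, F j k ^ 2 := by
    simp only [trace, diag_apply, mul_apply]
    exact Finset.sum_congr rfl fun i _ => Finset.sum_congr rfl fun j _ => by
      rw [hsymm j i, sq]
  have hFF : ∀ i k, (F * F) i k = (F * F) k i := fun i k => by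
    simp only [mul_apply]
    exact Finset.sum_congr rfl fun j _ => by rw [hsymm i j, hsymm j k, mul_comm]
  have hentry : ∀ i k, (F * F) i k ^ 2 ≤ 2 * ∑ j, F i j * F j k ^ 2 := by
    intro i k
    have hcs := Finset.sum_sq_le_sum_mul_sum_of_sq_le_mul Finset.univ
      (r := fun j => F i j * F j k) (f := fun j => F i j) (g := fun j => F i j * F j k ^ 2)
      (fun j _ => hF0 i j) (fun j _ => mul_nonneg (hF0 i j) (sq_nonneg _))
      (fun j _ => le_of_eq (by ring))
    rw [mul_apply]
    exact hcs.trans (mul_le_mul_of_nonneg_right (hrow i)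
      (Finset.sum_nonneg fun j _ => mul_nonneg (hF0 i j) (sq_nonneg _)))
  calc ((F * F) * (F * F)).trace = ∑ i, ∑ k, (F * F) i k ^ 2 := by
        simp only [trace, diag_apply]
        refine Finset.sum_congr rfl fun i _ => ?_
        rw [mul_apply]
        exact Finset.sum_congr rfl fun k _ => by rw [hFF k i, sq]
    _ ≤ ∑ i, ∑ k, 2 * ∑ j, F i j * F j k ^ 2 :=
        Finset.sum_le_sum fun i _ => Finset.sum_le_sum fun k _ => hentry i k
    _ = 2 * ∑ j, (∑ i, F j i) * ∑ k, F j k ^ 2 := by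
        simp only [← Finset.mul_sum]
        congr 1
        calc ∑ i, ∑ k, ∑ j, F i j * F j k ^ 2 = ∑ i, ∑ j, ∑ k, F i j * F j k ^ 2 :=
              Finset.sum_congr rfl fun i _ => Finset.sum_comm
          _ = ∑ j, ∑ i, ∑ k, F i j * F j k ^ 2 := Finset.sum_comm
          _ = _ := Finset.sum_congr rfl fun j _ => by
              rw [Finset.sum_mul]
              exact Finset.sum_congr rfl fun i _ => by rw [← Finset.mul_sum, hsymm i j]
    _ ≤ 2 * ∑ j, 2 * ∑ k, F j k ^ 2 := by
        refine mul_le_mul_of_nonneg_left (Finset.sum_le_sum fun j _ => ?_) zero_le_two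
        exact mul_le_mul_of_nonneg_right (hrow j) (Finset.sum_nonneg fun k _ => sq_nonneg _)
    _ = 4 * (F * F).trace := by
        rw [h2, ← Finset.mul_sum]; ring

/-- Edge weights on `G` with their defects `a`, whose total defect is controlled by the
independence number. -/
theorem exists_good_weights {V : Type*} [Fintype V] [DecidableEq V] (G : SimpleGraph V)
    [DecidableRel G.Adj] :
    ∃ (F : Matrix V V ℝ) (a : V → ℝ), F.IsSymm ∧ (∀ i j, 0 ≤ F i j) ∧
      (∀ i j, 5 * F i j ≤ G.adjMatrix ℝ i j) ∧ (∀ i, ∑ j, F i j = 1 - a i) ∧ (∀ i, -1 ≤ a i) ∧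
      ∑ i, a i = ∑ i, a i ^ 2 + 5 * (F * F).trace ∧ ∑ i, a i ≤ 5 * indepNum G := by
  obtain ⟨F, a, hrow, hsymm, hF0, hsupp, hopt, hcompl⟩ := exists_optimal_weights G
  have ha1 : ∀ i, a i ≤ 1 := fun i => by
    have := hrow i ▸ Finset.sum_nonneg fun j (_ : j ∈ Finset.univ) => hF0 i j
    linarith
  have hF5 : ∀ i j, 5 * F i j ≤ 1 := fun i j => by
    by_contra! h
    rcases mul_eq_zero.1 (hcompl i j) with h0 | h0
    · linarith
    · linarith [ha1 i, ha1 j]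
  have htr : (Matrix.of F * Matrix.of F).trace = ∑ i, ∑ j, F i j ^ 2 := by
    simp only [trace, diag_apply, mul_apply, of_apply]
    exact Finset.sum_congr rfl fun i _ => Finset.sum_congr rfl fun j _ => by
      rw [hsymm j i, sq]
  have htr0 : 0 ≤ ∑ i, ∑ j, F i j ^ 2 :=
    Finset.sum_nonneg fun i _ => Finset.sum_nonneg fun j _ => sq_nonneg _
  have hp : ∑ i, a i = ∑ i, a i ^ 2 + 5 * (Matrix.of F * Matrix.of F).trace := by
    have h1 : ∑ i, ∑ j, F i j * a i = ∑ i, a i * (1 - a i) :=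
      Finset.sum_congr rfl fun i _ => by rw [← Finset.sum_mul, hrow, mul_comm]
    have h2 : ∑ i, ∑ j, F i j * a j = ∑ i, a i * (1 - a i) := by
      rw [Finset.sum_comm, ← h1]
      exact Finset.sum_congr rfl fun i _ => Finset.sum_congr rfl fun j _ => by rw [hsymm]
    have h3 : ∑ i, ∑ j, F i j * (10 * F i j - (a i + a j)) = 0 :=
      Finset.sum_eq_zero fun i _ => Finset.sum_eq_zero fun j _ => hcompl i j
    have h4 : ∑ i, ∑ j, F i j * (10 * F i j - (a i + a j)) = 10 * ∑ i, ∑ j, F i j ^ 2 -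
        (∑ i, ∑ j, F i j * a i + ∑ i, ∑ j, F i j * a j) := by
      simp only [Finset.mul_sum, ← Finset.sum_add_distrib, ← Finset.sum_sub_distrib]
      exact Finset.sum_congr rfl fun i _ => Finset.sum_congr rfl fun j _ => by ring
    have h5 : ∑ i, a i * (1 - a i) = ∑ i, a i - ∑ i, a i ^ 2 := by
      rw [← Finset.sum_sub_distrib]
      exact Finset.sum_congr rfl fun i _ => by ring
    rw [htr]
    linarith
  refine ⟨Matrix.of F, a, Matrix.IsSymm.ext fun i j => hsymm j i, hF0, fun i j => ?_, hrow,
    fun i => ?_, hp, ?_⟩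
  · rw [SimpleGraph.adjMatrix_apply, of_apply]
    split_ifs with h
    · exact hF5 i j
    · rw [hsupp i j h, mul_zero]
  · by_contra! h
    have : ∑ j, F i j = 0 := Finset.sum_eq_zero fun j _ => by
      rcases mul_eq_zero.1 (hcompl i j) with h0 | h0
      · exact h0
      · linarith [ha1 j, hF0 i j]
    linarith [hrow i]
  · set b : V → ℝ := fun i => max (a i) 0
    have hquad : b ⬝ᵥ G.adjMatrix ℝ *ᵥ b ≤ 25 * ∑ i, ∑ j, F i j ^ 2 := by
      simp only [dotProduct, mulVec, Finset.mul_sum]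
      refine Finset.sum_le_sum fun i _ => Finset.sum_le_sum fun j _ => ?_
      rw [SimpleGraph.adjMatrix_apply]
      split_ifs with h
      · have h1 := hopt i j h
        rcases le_total (a i) 0 with hi | hi
        · simp only [b, max_eq_right hi, zero_mul]; positivity
        · rcases le_total (a j) 0 with hj | hj
          · simp only [b, max_eq_right hj, mul_zero]; positivity
          · simp only [b, max_eq_left hi, max_eq_left hj]
            nlinarith [sq_nonneg (a i - a j), pow_le_pow_left₀ (add_nonneg hi hj) h1 2]
      · simp only [zero_mul, mul_zero]; positivity
    have hb2 : ∑ i, b i ^ 2 ≤ ∑ i, a i ^ 2 := Finset.sum_le_sum fun i _ => by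
      rcases le_total (a i) 0 with hi | hi
      · simp only [b, max_eq_right hi]; nlinarith [sq_nonneg (a i)]
      · simp only [b, max_eq_left hi]; exact le_rfl
    have hpb : ∑ i, a i ≤ ∑ i, b i := Finset.sum_le_sum fun i _ => le_max_left _ _
    have ha2 : 0 ≤ ∑ i, a i ^ 2 := Finset.sum_nonneg fun i _ => sq_nonneg _
    have hms := sq_sum_le_indepNum_mul G b fun i => le_max_right _ _
    rw [htr] at hp
    have hp0 : 0 ≤ ∑ i, a i := by linarith
    have h1 : (∑ i, a i) ^ 2 ≤ indepNum G * (5 * ∑ i, a i) :=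
      (pow_le_pow_left₀ hp0 hpb 2).trans
        (hms.trans (mul_le_mul_of_nonneg_left (by linarith) (Nat.cast_nonneg _)))
    rcases hp0.eq_or_lt with h0 | h0
    · rw [← h0]; positivity
    · nlinarith

/-- Testing the adjacency matrix against `(1 + σ • F) ^ 2`. -/
theorem sum_signed_sq_eigenvalues_ge_of_weights {V : Type*} [Fintype V] [DecidableEq V]
    {A : Matrix V V ℝ} (hA : A.IsHermitian) (hA0 : A.trace = 0) {F : Matrix V V ℝ}
    (hF : F.IsSymm) (hF0 : F.trace = 0) {σ : ℝ} (hσ : σ ^ 2 = 1) :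
    4 * (A * F).trace + 2 * σ * (A * (F * F)).trace - (Fintype.card V + 6 * (F * F).trace +
        4 * σ * (F * (F * F)).trace + ((F * F) * (F * F)).trace) ≤
      ∑ i, if 0 < σ * hA.eigenvalues i then hA.eigenvalues i ^ 2 else 0 := by
  have hB : (1 + σ • F).IsSymm := by
    rw [Matrix.IsSymm, transpose_add, transpose_one, transpose_smul, hF.eq]
  have h := sum_signed_sq_eigenvalues_ge hA hB hσ
  have h2 : (1 + σ • F) * (1 + σ • F) = 1 + (2 * σ) • F + F * F := by
    simp only [mul_add, add_mul, mul_one, one_mul, smul_mul_assoc, mul_smul_comm, smul_add,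
      smul_smul]
    rw [← sq σ, hσ, one_smul]
    module
  have h4 : (1 + (2 * σ) • F + F * F) * (1 + (2 * σ) • F + F * F) =
      1 + (4 * σ) • F + (6 : ℝ) • (F * F) + (4 * σ) • (F * (F * F)) + (F * F) * (F * F) := by
    have h6 : (6 : ℝ) = 2 + (2 * σ) * (2 * σ) := by linear_combination (-4) * hσ
    rw [h6]
    simp only [mul_add, add_mul, mul_one, one_mul, smul_mul_assoc, mul_smul_comm, Matrix.mul_assoc]
    module
  rw [h2, h4] at h
  simp only [mul_add, mul_one, mul_smul_comm, trace_add, trace_smul, trace_one, smul_eq_mul, hA0,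
    hF0] at h
  linear_combination h - (4 * (A * F).trace) * hσ

/-- If `G` is a connected graph of order `n` with `α(G)·ω(G) ≤ n/17`, then both `s⁺(G) ≥ n`
and `s⁻(G) ≥ n`. -/
theorem stmt_16 {V : Type*} [Fintype V] [DecidableEq V] (G : SimpleGraph V) [DecidableRel G.Adj]
    (hconn : G.Connected)
    (h : (indepNum G : ℝ) * (cliqueNum G : ℝ) ≤ (Fintype.card V : ℝ) / 17) :
    (Fintype.card V : ℝ) ≤ sPlus G ∧ (Fintype.card V : ℝ) ≤ sMinus G := by
  obtain ⟨F, a, hF, hF0, hFA, hrow, ha, hp, hα⟩ := exists_good_weights G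
  set A : Matrix V V ℝ := G.adjMatrix ℝ with hAdef
  have heig : adjEig G = (adj_isHermitian G).eigenvalues := by
    unfold adjEig
    congr!
  have hplus : sPlus G = ∑ i, if 0 < (1 : ℝ) * (adj_isHermitian G).eigenvalues i then
      (adj_isHermitian G).eigenvalues i ^ 2 else 0 := by
    simp only [sPlus, heig, one_mul]
  have hminus : sMinus G = ∑ i, if 0 < (-1 : ℝ) * (adj_isHermitian G).eigenvalues i then
      (adj_isHermitian G).eigenvalues i ^ 2 else 0 := by
    simp only [sMinus, heig, neg_mul, one_mul, neg_pos]
  have hA0 : A.trace = 0 := G.trace_adjMatrix ℝ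
  have hFtr : F.trace = 0 := Finset.sum_eq_zero fun i _ => by
    have := hFA i i
    rw [hAdef, SimpleGraph.adjMatrix_apply, if_neg (G.irrefl)] at this
    rw [diag_apply]
    linarith [hF0 i i]
  have hsq0 : ∀ i j, 0 ≤ (F * F) i j := fun i j => by
    rw [mul_apply]
    exact Finset.sum_nonneg fun k _ => mul_nonneg (hF0 i k) (hF0 k j)
  have hcube0 : 0 ≤ (F * (F * F)).trace := Finset.sum_nonneg fun i _ => by
    rw [diag_apply, mul_apply]
    exact Finset.sum_nonneg fun j _ => mul_nonneg (hF0 i j) (hsq0 j i)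
  have hcubeA : 5 * (F * (F * F)).trace ≤ (A * (F * F)).trace := by
    rw [trace, trace, Finset.mul_sum]
    refine Finset.sum_le_sum fun i _ => ?_
    rw [diag_apply, diag_apply, mul_apply, mul_apply, Finset.mul_sum]
    refine Finset.sum_le_sum fun j _ => ?_
    rw [← mul_assoc]
    exact mul_le_mul_of_nonneg_right (hFA i j) (hsq0 j i)
  have hfourth := trace_fourth_le hF hF0 fun i => by rw [hrow]; linarith [ha i]
  have hS : (A * F).trace = Fintype.card V - ∑ i, a i := by
    have : (A * F).trace = ∑ i, ∑ j, F i j := by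
      simp only [trace, diag_apply, mul_apply]
      refine Finset.sum_congr rfl fun i _ => Finset.sum_congr rfl fun j _ => ?_
      rw [hF.apply i j]
      by_cases hij : G.Adj i j
      · simp [hAdef, hij]
      · have := hFA i j
        simp only [hAdef, SimpleGraph.adjMatrix_apply, if_neg hij] at this ⊢
        linarith [hF0 i j]
    simp [this, hrow, Finset.sum_sub_distrib]
  have hs2 : ∑ i, (∑ j, F i j) ^ 2 = Fintype.card V - 2 * ∑ i, a i + ∑ i, a i ^ 2 := by
    have : ∀ i, (∑ j, F i j) ^ 2 = 1 - 2 * a i + a i ^ 2 := fun i => by rw [hrow]; ring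
    simp [this, Finset.sum_add_distrib, Finset.sum_sub_distrib, Finset.mul_sum]
  have hclique : cliqueNum G * (A * (F * F)).trace ≤
      (cliqueNum G - 1) * ∑ i, (∑ j, F i j) ^ 2 := by
    have : (A * (F * F)).trace = ∑ v, F v ⬝ᵥ A *ᵥ F v := by
      rw [← Matrix.mul_assoc, trace_mul_comm]
      simp only [trace, diag_apply]
      refine Finset.sum_congr rfl fun v _ => ?_
      rw [mul_apply]
      refine Finset.sum_congr rfl fun j _ => ?_
      rw [mul_apply]
      congr 1
      exact Finset.sum_congr rfl fun k _ => by rw [hF.apply v k]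
    rw [this, Finset.mul_sum, Finset.mul_sum]
    exact Finset.sum_le_sum fun v _ => motzkin_straus G (card_le_cliqueNum G) _ (hF0 v)
  have hω : (1 : ℝ) ≤ cliqueNum G := by
    obtain ⟨v⟩ := hconn.nonempty
    have := card_le_cliqueNum G {v} (by simp)
    exact_mod_cast this
  have ha2 : 0 ≤ ∑ i, a i ^ 2 := Finset.sum_nonneg fun i _ => sq_nonneg _
  have hα0 : (0 : ℝ) ≤ indepNum G := Nat.cast_nonneg _
  constructor
  · have key := sum_signed_sq_eigenvalues_ge_of_weights (adj_isHermitian G) hA0 hF hFtr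
      (one_pow 2)
    rw [← hplus] at key
    nlinarith [mul_le_mul_of_nonneg_left hω hα0]
  · have key := sum_signed_sq_eigenvalues_ge_of_weights (adj_isHermitian G) hA0 hF hFtr
      (σ := -1) (by norm_num)
    rw [← hminus] at key
    set ω : ℝ := (cliqueNum G : ℝ)
    set p := ∑ i, a i
    set q := ∑ i, (∑ j, F i j) ^ 2
    have hpω : ω * p ≤ q := by
      have h1 : (ω + 2) * p ≤ (3 * ω) * (5 * indepNum G) := by
        have hp0 : 0 ≤ (F * F).trace := Finset.sum_nonneg fun i _ => hsq0 i i
        exact mul_le_mul (by linarith) hα (by linarith) (by linarith)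
      nlinarith
    have hW : (A * (F * F)).trace ≤ q - p := by
      have : ω * (A * (F * F)).trace ≤ ω * (q - p) := by linarith
      exact le_of_mul_le_mul_left this (by linarith)
    linarith

end SquareEnergy
end

section
/- Let G be a simple graph of order n ≥ 17 that contains a 16-th power of a Hamiltonian cycle, i.e., there is a bijection φ : ℤ/nℤ → V(G) such that φ(i) is adjacent to φ(i + j) for every i ∈ ℤ/nℤ and every j ∈ {1, 2, …, 16}. Then s⁻(G) ≥ n − 1. -/
open Matrix

namespace SquareEnergy

theorem value_add {V : Type*} [Fintype V] {A X Y : Matrix V V ℝ} (h : X * Y = 0) :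
    -2 * (A * (X + Y)).trace - ((X + Y) * (X + Y)).trace =
      (-2 * (A * X).trace - (X * X).trace) + (-2 * (A * Y).trace - (Y * Y).trace) := by
  have h1 : (Y * X).trace = 0 := by rw [trace_mul_comm, h, trace_zero]
  simp only [Matrix.mul_add, Matrix.add_mul, trace_add, h, h1, trace_zero]
  ring

section Certificate

variable {V : Type*} [Fintype V] [DecidableEq V]

theorem neg_two_mul_trace_sub_le {A X : Matrix V V ℝ} (hA : A.IsHermitian) (hX : X.PosSemidef) :
    -2 * (A * X).trace - (X * X).trace ≤
      ∑ i, if hA.eigenvalues i < 0 then hA.eigenvalues i ^ 2 else 0 := by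
  set U : Matrix V V ℝ := ↑hA.eigenvectorUnitary with hU
  have hUU : U * star U = 1 := Unitary.coe_mul_star_self hA.eigenvectorUnitary
  set Y := star U * X * U with hY
  have hYpsd : Y.PosSemidef := by
    have := hX.conjTranspose_mul_mul_same U
    simpa [hY, star_eq_conjTranspose] using this
  have hAX : (A * X).trace = ∑ i, hA.eigenvalues i * Y i i := by
    have hA' : A = U * diagonal hA.eigenvalues * star U := by
      have := hA.spectral_theorem
      rw [Unitary.conjStarAlgAut_apply] at this
      simpa [Function.comp_def] using this
    calc (A * X).trace = (U * (diagonal hA.eigenvalues * star U * X)).trace := by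
          conv_lhs => rw [hA']
          simp only [Matrix.mul_assoc]
      _ = (diagonal hA.eigenvalues * Y).trace := by
          rw [trace_mul_comm, hY]; simp only [Matrix.mul_assoc]
      _ = _ := by simp [trace, diagonal_mul]
  have hXX : (X * X).trace = ∑ i, ∑ j, Y i j ^ 2 := by
    calc (X * X).trace = (X * X * (U * star U)).trace := by rw [hUU, Matrix.mul_one]
      _ = (star U * (X * X * U)).trace := by
          rw [← Matrix.mul_assoc, trace_mul_comm]
      _ = (star U * X * (U * star U) * X * U).trace := by
          rw [hUU, Matrix.mul_one]; simp only [Matrix.mul_assoc]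
      _ = (Y * Y).trace := by rw [hY]; simp only [Matrix.mul_assoc]
      _ = _ := by
          simp only [trace, diag_apply, mul_apply]
          refine Finset.sum_congr rfl fun i _ => Finset.sum_congr rfl fun j _ => ?_
          have := hYpsd.isHermitian.apply i j
          simp only [star_trivial] at this
          rw [this, sq]
  rw [hAX, hXX, Finset.mul_sum, ← Finset.sum_sub_distrib]
  refine Finset.sum_le_sum fun i _ => ?_
  have h1 : Y i i ^ 2 ≤ ∑ j, Y i j ^ 2 :=
    Finset.single_le_sum (f := fun j => Y i j ^ 2) (fun j _ => sq_nonneg _) (Finset.mem_univ i)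
  have h2 : 0 ≤ Y i i := hYpsd.diag_nonneg
  split_ifs with h
  · nlinarith [sq_nonneg (hA.eigenvalues i + Y i i)]
  · nlinarith [mul_nonneg (not_lt.mp h) h2]

/-- A positive semidefinite matrix supported on `S` witnessing that the part of `A` on `S`
contributes at least `c` to the negative square energy. -/
def HasCertificate (A : Matrix V V ℝ) (S : Finset V) (c : ℝ) : Prop :=
  ∃ X : Matrix V V ℝ, X.PosSemidef ∧ (∀ i j, X i j ≠ 0 → i ∈ S ∧ j ∈ S) ∧
    c ≤ -2 * (A * X).trace - (X * X).trace

theorem HasCertificate.union {A : Matrix V V ℝ} {S T : Finset V} {c d : ℝ}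
    (hS : HasCertificate A S c) (hT : HasCertificate A T d) (hST : Disjoint S T) :
    HasCertificate A (S ∪ T) (c + d) := by
  obtain ⟨X, hX, hXS, hXc⟩ := hS
  obtain ⟨Y, hY, hYT, hYd⟩ := hT
  refine ⟨X + Y, hX.add hY, fun i j hij => ?_, ?_⟩
  · by_cases h : X i j = 0
    · have h' : Y i j ≠ 0 := by simpa [h] using hij
      simp [hYT i j h']
    · simp [hXS i j h]
  · have : X * Y = 0 := by
      ext i k
      rw [mul_apply]
      refine Finset.sum_eq_zero fun j _ => ?_
      by_contra h
      exact Finset.disjoint_left.mp hST (hXS i j (left_ne_zero_of_mul h)).2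
        (hYT j k (right_ne_zero_of_mul h)).1
    rw [value_add this]
    linarith

/-- The indicator vector of `S`. -/
def indVec (S : Finset V) : V → ℝ := fun i => if i ∈ S then 1 else 0

theorem indVec_dotProduct (S : Finset V) (f : V → ℝ) : indVec S ⬝ᵥ f = ∑ i ∈ S, f i := by
  simp [indVec, dotProduct, Finset.sum_ite_mem]

theorem mulVec_indVec (A : Matrix V V ℝ) (S : Finset V) (i : V) :
    (A *ᵥ indVec S) i = ∑ j ∈ S, A i j := by
  simp [indVec, mulVec, dotProduct, Finset.sum_ite_mem]

theorem indVec_dotProduct_indVec_self (S : Finset V) : indVec S ⬝ᵥ indVec S = S.card := by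
  rw [indVec_dotProduct, Finset.sum_congr rfl fun i hi => by rw [indVec, if_pos hi]]
  simp

theorem indVec_dotProduct_indVec_of_disjoint {S T : Finset V} (h : Disjoint S T) :
    indVec S ⬝ᵥ indVec T = 0 := by
  rw [indVec_dotProduct]
  exact Finset.sum_eq_zero fun i hi => by rw [indVec, if_neg (Finset.disjoint_left.mp h hi)]

/-- The orthogonal projection onto the vectors supported on `S` with coordinate sum zero. -/
noncomputable def centering (S : Finset V) : Matrix V V ℝ :=
  diagonal (indVec S) - (S.card : ℝ)⁻¹ • vecMulVec (indVec S) (indVec S)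

theorem centering_transpose {V : Type*} [DecidableEq V] (S : Finset V) :
    (centering S)ᵀ = centering S := by
  simp [centering, transpose_vecMulVec]

theorem diagonal_indVec_mulVec_indVec (S : Finset V) :
    diagonal (indVec S) *ᵥ indVec S = indVec S := by
  ext i
  simp [mulVec_diagonal, indVec]

theorem centering_mulVec_self (S : Finset V) : centering S *ᵥ indVec S = 0 := by
  rcases S.eq_empty_or_nonempty with rfl | hS
  · ext i; simp [mulVec_indVec]
  · have : (S.card : ℝ) ≠ 0 := by exact_mod_cast hS.card_ne_zero
    rw [centering, sub_mulVec, diagonal_indVec_mulVec_indVec, smul_mulVec, vecMulVec_mulVec,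
      indVec_dotProduct_indVec_self, op_smul_eq_smul, smul_smul, inv_mul_cancel₀ this, one_smul,
      sub_self]

theorem centering_mulVec_of_disjoint {S T : Finset V} (h : Disjoint S T) :
    centering S *ᵥ indVec T = 0 := by
  rw [centering, sub_mulVec, smul_mulVec, vecMulVec_mulVec,
    indVec_dotProduct_indVec_of_disjoint h]
  ext i
  by_cases hi : i ∈ S
  · simp [mulVec_diagonal, indVec, Finset.disjoint_left.mp h hi]
  · simp [mulVec_diagonal, indVec, hi]

theorem centering_mul_self (S : Finset V) : centering S * centering S = centering S := by
  have h1 : centering S * diagonal (indVec S) = centering S := by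
    ext i j
    by_cases hj : j ∈ S <;> by_cases hij : i = j <;>
      simp [centering, mul_diagonal, indVec, vecMulVec_apply, hj, hij]
  conv_lhs => arg 2; rw [centering]
  rw [Matrix.mul_sub, h1, Matrix.mul_smul, mul_vecMulVec, centering_mulVec_self]
  simp

theorem centering_posSemidef (S : Finset V) : (centering S).PosSemidef := by
  have := posSemidef_conjTranspose_mul_self (centering S)
  rwa [conjTranspose_eq_transpose_of_trivial, centering_transpose, centering_mul_self] at this

theorem centering_support {V : Type*} [DecidableEq V] (S : Finset V) (i j : V)
    (h : centering S i j ≠ 0) :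
    i ∈ S ∧ j ∈ S := by
  by_contra hc
  apply h
  by_cases hi : i ∈ S <;> by_cases hj : j ∈ S <;> by_cases hij : i = j <;>
    simp_all [centering, indVec, vecMulVec_apply]

theorem trace_centering {S : Finset V} (hS : S.Nonempty) :
    (centering S).trace = S.card - 1 := by
  have : (S.card : ℝ) ≠ 0 := by exact_mod_cast hS.card_ne_zero
  rw [centering, trace_sub, trace_smul, trace_vecMulVec, indVec_dotProduct_indVec_self,
    trace_diagonal]
  simp [indVec, this]

end Certificate

section Graph

variable {V : Type*} [Fintype V] [DecidableEq V] (G : SimpleGraph V) [DecidableRel G.Adj]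

theorem indVec_dotProduct_adjMatrix_mulVec {S T : Finset V}
    (h : ∀ i ∈ S, ∀ j ∈ T, G.Adj i j) :
    indVec S ⬝ᵥ (G.adjMatrix ℝ *ᵥ indVec T) = S.card * T.card := by
  simp only [indVec_dotProduct, mulVec_indVec]
  rw [Finset.sum_congr rfl fun i hi => Finset.sum_congr rfl fun j hj => by
    rw [SimpleGraph.adjMatrix_apply, if_pos (h i hi j hj)]]
  simp

theorem indVec_dotProduct_adjMatrix_mulVec_self {S : Finset V} (h : G.IsClique (S : Set V)) :
    indVec S ⬝ᵥ (G.adjMatrix ℝ *ᵥ indVec S) = S.card * (S.card - 1) := by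
  simp only [indVec_dotProduct, mulVec_indVec]
  have : ∀ i ∈ S, ∑ j ∈ S, G.adjMatrix ℝ i j = (S.card : ℝ) - 1 := by
    intro i hi
    rw [← Finset.add_sum_erase S _ hi, SimpleGraph.adjMatrix_apply, if_neg (G.loopless.irrefl i),
      Finset.sum_congr rfl fun j hj => by
        rw [SimpleGraph.adjMatrix_apply,
          if_pos (h hi (Finset.mem_of_mem_erase hj) (Finset.ne_of_mem_erase hj).symm)]]
    rw [Finset.sum_const, Finset.card_erase_of_mem hi, nsmul_eq_mul,
      Nat.cast_pred (Finset.card_pos.mpr ⟨i, hi⟩)]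
    ring
  rw [Finset.sum_congr rfl this, Finset.sum_const, nsmul_eq_mul]

theorem trace_adjMatrix_mul_vecMulVec {V : Type*} [Fintype V] (G : SimpleGraph V)
    [DecidableRel G.Adj] (f : V → ℝ) :
    (G.adjMatrix ℝ * vecMulVec f f).trace = f ⬝ᵥ (G.adjMatrix ℝ *ᵥ f) := by
  rw [mul_vecMulVec, trace_vecMulVec, dotProduct_comm]

theorem value_centering {S : Finset V} (hS : S.Nonempty) (h : G.IsClique (S : Set V)) :
    -2 * (G.adjMatrix ℝ * centering S).trace - (centering S * centering S).trace =
      S.card - 1 := by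
  have h0 : (S.card : ℝ) ≠ 0 := by exact_mod_cast hS.card_ne_zero
  have h1 : (G.adjMatrix ℝ * diagonal (indVec S)).trace = 0 := by
    simp [trace, mul_diagonal]
  rw [centering_mul_self, trace_centering hS, centering, Matrix.mul_sub, trace_sub, h1,
    Matrix.mul_smul, trace_smul, trace_adjMatrix_mul_vecMulVec,
    indVec_dotProduct_adjMatrix_mulVec_self G h, smul_eq_mul]
  field_simp
  ring

theorem HasCertificate.of_isClique {S : Finset V} (hS : S.Nonempty)
    (h : G.IsClique (S : Set V)) : HasCertificate (G.adjMatrix ℝ) S (S.card - 1) :=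
  ⟨centering S, centering_posSemidef S, centering_support S, (value_centering G hS h).ge⟩

/-- A clique together with a further vertex adjacent to many, but not all, of its vertices. -/
theorem HasCertificate.of_clique_insert {v : V} {N R : Finset V} (hN : 6 ≤ N.card)
    (hR : R.Nonempty) (hNR : Disjoint N R) (hvN : v ∉ N) (hvR : v ∉ R)
    (hclique : G.IsClique ((N ∪ R : Finset V) : Set V)) (hadj : ∀ x ∈ N, G.Adj v x)
    (hnadj : ∀ x ∈ R, ¬ G.Adj v x) :
    HasCertificate (G.adjMatrix ℝ) (insert v (N ∪ R)) (N.card + R.card + 1) := by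
  have hd : (6 : ℝ) ≤ N.card := by exact_mod_cast hN
  have hr : (1 : ℝ) ≤ R.card := by exact_mod_cast hR.card_pos
  set d : ℝ := (N.card : ℝ) with hd_def
  set r : ℝ := (R.card : ℝ) with hr_def
  have hNne : N.Nonempty := Finset.card_pos.mp (by omega)
  have hvN' : Disjoint {v} N := Finset.disjoint_singleton_left.mpr hvN
  have hvR' : Disjoint {v} R := Finset.disjoint_singleton_left.mpr hvR
  have hNc : G.IsClique (N : Set V) := hclique.subset (by simp)
  have hRc : G.IsClique (R : Set V) := hclique.subset (by simp)
  set w : V → ℝ := indVec {v} - (2 / d) • indVec N + r⁻¹ • indVec R with hw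
  set q : ℝ := 1 + 4 / d + 1 / r with hq
  have hd0 : d ≠ 0 := by positivity
  have hr0 : r ≠ 0 := by positivity
  have hq0 : 0 < q := by positivity
  have hq1 : q ≤ 8 / 3 := by
    have h1 : 4 / d ≤ 2 / 3 := by rw [div_le_div_iff₀ (by positivity) (by norm_num)]; linarith
    have h2 : 1 / r ≤ 1 := by rw [div_le_one (by positivity)]; exact hr
    rw [hq]; linarith
  have hww : w ⬝ᵥ w = q := by
    simp only [hw, dotProduct_add, dotProduct_sub, add_dotProduct, sub_dotProduct,
      dotProduct_smul, smul_dotProduct, indVec_dotProduct_indVec_self,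
      indVec_dotProduct_indVec_of_disjoint hvN', indVec_dotProduct_indVec_of_disjoint hvN'.symm,
      indVec_dotProduct_indVec_of_disjoint hvR', indVec_dotProduct_indVec_of_disjoint hvR'.symm,
      indVec_dotProduct_indVec_of_disjoint hNR, indVec_dotProduct_indVec_of_disjoint hNR.symm,
      smul_eq_mul, Finset.card_singleton, ← hd_def, ← hr_def, hq]
    field_simp
    push_cast
    ring
  have hwAw : w ⬝ᵥ (G.adjMatrix ℝ *ᵥ w) = -2 - q := by
    have e1 := indVec_dotProduct_adjMatrix_mulVec G (S := {v}) (by simpa using hadj)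
    have e2 := indVec_dotProduct_adjMatrix_mulVec G (T := {v})
      (by simpa using fun x hx => (hadj x hx).symm)
    have e3 : indVec {v} ⬝ᵥ (G.adjMatrix ℝ *ᵥ indVec R) = 0 := by
      simp only [indVec_dotProduct, mulVec_indVec, Finset.sum_singleton]
      exact Finset.sum_eq_zero fun x hx => by simp [hnadj x hx]
    have e4 : indVec R ⬝ᵥ (G.adjMatrix ℝ *ᵥ indVec {v}) = 0 := by
      simp only [indVec_dotProduct, mulVec_indVec, Finset.sum_singleton]
      exact Finset.sum_eq_zero fun x hx => by simp [G.adj_comm x v, hnadj x hx]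
    have hcross : ∀ x ∈ N, ∀ y ∈ R, G.Adj x y := fun x hx y hy =>
      hclique (by simp [hx]) (by simp [hy]) (fun h => Finset.disjoint_left.mp hNR hx (h ▸ hy))
    have e5 := indVec_dotProduct_adjMatrix_mulVec G hcross
    have e6 := indVec_dotProduct_adjMatrix_mulVec G
      (fun y hy x hx => (hcross x hx y hy).symm)
    have e7 := indVec_dotProduct_adjMatrix_mulVec_self G hNc
    have e8 := indVec_dotProduct_adjMatrix_mulVec_self G hRc
    have e9 : indVec {v} ⬝ᵥ (G.adjMatrix ℝ *ᵥ indVec {v}) = 0 := by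
      simp only [indVec_dotProduct, mulVec_indVec, Finset.sum_singleton]
      simp
    simp only [hw, mulVec_add, mulVec_sub, mulVec_smul, dotProduct_add, dotProduct_sub,
      add_dotProduct, sub_dotProduct, dotProduct_smul, smul_dotProduct, e1, e2, e3, e4, e5, e6,
      e7, e8, e9, smul_eq_mul, Finset.card_singleton, ← hd_def, ← hr_def, hq]
    field_simp
    push_cast
    ring
  have hcross : centering N * centering R = 0 := by
    have h1 : centering N * diagonal (indVec R) = 0 := by
      ext i j
      rw [mul_diagonal]
      by_cases hj : j ∈ R
      · have : centering N i j = 0 := by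
          by_contra h
          exact Finset.disjoint_left.mp hNR (centering_support N i j h).2 hj
        simp [this]
      · simp [indVec, hj]
    rw [centering.eq_1 R, Matrix.mul_sub, h1, Matrix.mul_smul, mul_vecMulVec,
      centering_mulVec_of_disjoint hNR]
    simp
  have hw0 : (centering N + centering R) *ᵥ w = 0 := by
    simp only [hw, add_mulVec, mulVec_add, mulVec_sub, mulVec_smul, centering_mulVec_self,
      centering_mulVec_of_disjoint hvN'.symm, centering_mulVec_of_disjoint hvR'.symm,
      centering_mulVec_of_disjoint hNR, centering_mulVec_of_disjoint hNR.symm]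
    simp
  refine ⟨centering N + centering R + (2 / q) • vecMulVec w w, ?_, ?_, ?_⟩
  · refine ((centering_posSemidef N).add (centering_posSemidef R)).add ?_
    have := posSemidef_vecMulVec_self_star w
    exact (by simpa using this : (vecMulVec w w).PosSemidef).smul (by positivity)
  · have hsupp : ∀ i, i ∉ insert v (N ∪ R) → w i = 0 := by
      intro i hi
      simp only [Finset.mem_insert, Finset.mem_union, not_or] at hi
      simp [hw, indVec, hi]
    intro i j hij
    by_contra hc
    apply hij
    have h1 : ∀ T ⊆ N ∪ R, centering T i j = 0 := by
      intro T hT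
      by_contra h
      have := centering_support T i j h
      exact hc ⟨Finset.mem_insert_of_mem (hT this.1), Finset.mem_insert_of_mem (hT this.2)⟩
    have h2 : w i * w j = 0 := by
      by_contra h
      exact hc ⟨not_imp_comm.mp (hsupp i) (left_ne_zero_of_mul h),
        not_imp_comm.mp (hsupp j) (right_ne_zero_of_mul h)⟩
    simp [h1 N Finset.subset_union_left, h1 R Finset.subset_union_right, vecMulVec_apply, h2]
  · rw [value_add (by rw [Matrix.mul_smul, mul_vecMulVec, hw0]; simp), value_add hcross,
      value_centering G hNne hNc, value_centering G hR hRc, Matrix.mul_smul, trace_smul,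
      trace_adjMatrix_mul_vecMulVec, hwAw, Matrix.smul_mul, Matrix.mul_smul, trace_smul,
      trace_smul, vecMulVec_mul_vecMulVec, trace_vecMulVec, dotProduct_smul, hww, ← hd_def,
      ← hr_def]
    have h3 : 3 ≤ 8 / q := by rw [le_div_iff₀ hq0]; linarith
    simp only [smul_eq_mul]
    have h4 : -2 * (2 / q * (-2 - q)) - 2 / q * (2 / q * (q * q)) = 8 / q := by
      field_simp
      ring
    linarith

/-- A sequence of vertices, each adjacent to its sixteen predecessors, splits greedily into
blocks carrying certificates. -/
theorem HasCertificate.of_path_power {n : ℕ} {f : ℕ → V}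
    (hinj : ∀ x < n, ∀ y < n, f x = f y → x = y)
    (hadj : ∀ x y, x < y → y ≤ x + 16 → y < n → G.Adj (f x) (f y)) (a : ℕ) (ha : a ≤ n) :
    HasCertificate (G.adjMatrix ℝ) ((Finset.Ico a n).image f) ((n : ℝ) - a - 1) := by
  induction hl : n - a using Nat.strong_induction_on generalizing a with
  | _ l ih =>
  have hcliq : ∀ b ≤ n, (∀ x y, a ≤ x → x < y → y < b → G.Adj (f x) (f y)) →
      G.IsClique (((Finset.Ico a b).image f : Finset V) : Set V) := by
    intro b _ h u hu v hv huv
    simp only [Finset.coe_image, Set.mem_image, Finset.coe_Ico, Set.mem_Ico] at hu hv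
    obtain ⟨x, hx, rfl⟩ := hu
    obtain ⟨y, hy, rfl⟩ := hv
    rcases lt_trichotomy x y with hxy | rfl | hxy
    · exact h x y hx.1 hxy hy.2
    · exact absurd rfl huv
    · exact (h y x hy.1 hxy hx.2).symm
  have hcard : ∀ s : Finset ℕ, (∀ x ∈ s, x < n) → (s.image f).card = s.card := fun s hs =>
    Finset.card_image_of_injOn fun x hx y hy h => hinj x (hs x hx) y (hs y hy) h
  rcases ha.eq_or_lt with rfl | han
  · exact ⟨0, PosSemidef.zero, by simp, by simp⟩
  by_cases hall : ∃ y, y < n ∧ ∃ x, a ≤ x ∧ x < y ∧ ¬ G.Adj (f x) (f y)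
  · classical
    obtain ⟨hj, x₀, hax, hxj, hx₀⟩ := Nat.find_spec hall
    have hmin : ∀ x y, a ≤ x → x < y → y < Nat.find hall → G.Adj (f x) (f y) := by
      intro x y hx hxy hy
      by_contra hc
      exact Nat.find_min hall hy ⟨hy.trans hj, x, hx, hxy, hc⟩
    generalize Nat.find hall = j at hj hxj hx₀ hmin
    have hx16 : x₀ + 16 < j := by
      by_contra hc
      exact hx₀ (hadj x₀ j hxj (by omega) hj)
    set I := Finset.Ico a j
    set P := I.filter fun x => G.Adj (f j) (f x)
    set Q := I.filter fun x => ¬ G.Adj (f j) (f x)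
    have hPlt : ∀ x ∈ P, x < j := fun x hx => (Finset.mem_Ico.mp (Finset.mem_filter.mp hx).1).2
    have hQlt : ∀ x ∈ Q, x < j := fun x hx => (Finset.mem_Ico.mp (Finset.mem_filter.mp hx).1).2
    have hPQ : P ∪ Q = I := Finset.filter_union_filter_not_eq _ _
    have hPQd : Disjoint P Q := Finset.disjoint_filter_filter_not _ _ _
    have hPQc : P.card + Q.card = j - a := by
      rw [← Finset.card_union_of_disjoint hPQd, hPQ, Nat.card_Ico]
    have hPc := hcard P fun x hx => (hPlt x hx).trans hj
    have hQc := hcard Q fun x hx => (hQlt x hx).trans hj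
    have himg : P.image f ∪ Q.image f = I.image f := by rw [← Finset.image_union, hPQ]
    have hnotin : ∀ s : Finset ℕ, (∀ x ∈ s, x < j) → f j ∉ s.image f := by
      intro s hs h
      obtain ⟨x, hx, hxj⟩ := Finset.mem_image.mp h
      exact (hs x hx).ne (hinj x ((hs x hx).trans hj) j hj hxj)
    have hP16 : 16 ≤ P.card := by
      have : Finset.Ico (j - 16) j ⊆ P := by
        intro x hx
        rw [Finset.mem_Ico] at hx
        exact Finset.mem_filter.mpr ⟨Finset.mem_Ico.mpr (by omega),
          (hadj x j hx.2 (by omega) hj).symm⟩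
      have := Finset.card_le_card this
      rw [Nat.card_Ico] at this
      omega
    have hblock := HasCertificate.of_clique_insert G (v := f j) (N := P.image f)
      (R := Q.image f) (by omega)
      ⟨f x₀, Finset.mem_image_of_mem f (Finset.mem_filter.mpr
        ⟨Finset.mem_Ico.mpr ⟨hax, hxj⟩, fun h => hx₀ h.symm⟩)⟩
      (by
        rw [Finset.disjoint_left]
        intro u hu hu'
        obtain ⟨x, hx, rfl⟩ := Finset.mem_image.mp hu
        obtain ⟨y, hy, hxy⟩ := Finset.mem_image.mp hu'
        exact (Finset.mem_filter.mp hy).2 (hxy ▸ (Finset.mem_filter.mp hx).2))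
      (hnotin P hPlt) (hnotin Q hQlt) (by rw [himg]; exact hcliq j hj.le hmin)
      (by
        intro u hu
        obtain ⟨x, hx, rfl⟩ := Finset.mem_image.mp hu
        exact (Finset.mem_filter.mp hx).2)
      (by
        intro u hu
        obtain ⟨x, hx, rfl⟩ := Finset.mem_image.mp hu
        exact (Finset.mem_filter.mp hx).2)
    rw [himg, hPc, hQc] at hblock
    have hrest := ih (n - (j + 1)) (by omega) (j + 1) (by omega) rfl
    have hins : insert (f j) (I.image f) = (Finset.Ico a (j + 1)).image f := by
      rw [← Finset.image_insert]
      congr 1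
      ext x
      simp only [I, Finset.mem_insert, Finset.mem_Ico]
      omega
    rw [hins] at hblock
    have hunion := hblock.union hrest (by
      rw [Finset.disjoint_left]
      intro u hu hu'
      obtain ⟨x, hx, rfl⟩ := Finset.mem_image.mp hu
      obtain ⟨y, hy, hxy⟩ := Finset.mem_image.mp hu'
      rw [Finset.mem_Ico] at hx hy
      have := hinj y hy.2 x (by omega) hxy
      omega)
    rw [← Finset.image_union, Finset.Ico_union_Ico_eq_Ico (by omega) (by omega)] at hunion
    convert hunion using 1
    have : (P.card : ℝ) + Q.card = j - a := by
      rw [← Nat.cast_sub (by omega)]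
      exact_mod_cast hPQc
    push_cast
    linarith
  · push Not at hall
    have := HasCertificate.of_isClique G (S := (Finset.Ico a n).image f)
      ⟨f a, Finset.mem_image_of_mem f (Finset.mem_Ico.mpr ⟨le_rfl, han⟩)⟩
      (hcliq n le_rfl fun x y hx hxy hy => hall y hy x hx hxy)
    rwa [hcard _ (fun x hx => (Finset.mem_Ico.mp hx).2), Nat.card_Ico, Nat.cast_sub ha] at this

theorem HasCertificate.le_sMinus {S : Finset V} {c : ℝ}
    (h : HasCertificate (G.adjMatrix ℝ) S c) : c ≤ sMinus G := by
  obtain ⟨X, hX, -, hc⟩ := h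
  refine hc.trans ?_
  have key := neg_two_mul_trace_sub_le (adj_isHermitian G) hX
  obtain rfl : ‹DecidableRel G.Adj› = Classical.decRel G.Adj := Subsingleton.elim _ _
  exact key

end Graph

/-- If `G` has order `n ≥ 17` and contains a 16-th power of a Hamiltonian cycle, i.e. there is a
bijection `φ : ℤ/nℤ → V(G)` with `φ(i)` adjacent to `φ(i + j)` for all `i` and `1 ≤ j ≤ 16`,
then `s⁻(G) ≥ n − 1`. -/
theorem stmt_17 {V : Type*} [Fintype V] [DecidableEq V] (G : SimpleGraph V) [DecidableRel G.Adj]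
    (hn : 17 ≤ Fintype.card V)
    (hham : ∃ φ : ZMod (Fintype.card V) ≃ V,
      ∀ i : ZMod (Fintype.card V), ∀ j : ℕ, 1 ≤ j → j ≤ 16 → G.Adj (φ i) (φ (i + (j : ZMod (Fintype.card V))))) :
    (Fintype.card V : ℝ) - 1 ≤ sMinus G := by
  obtain ⟨φ, hφ⟩ := hham
  have : NeZero (Fintype.card V) := ⟨by omega⟩
  have hcert := HasCertificate.of_path_power G (n := Fintype.card V)
    (f := fun k => φ (k : ZMod (Fintype.card V)))
    (fun x hx y hy h => by
      have := (ZMod.natCast_eq_natCast_iff' x y _).mp (φ.injective h)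
      rwa [Nat.mod_eq_of_lt hx, Nat.mod_eq_of_lt hy] at this)
    (fun x y hxy hy _ => by
      have := hφ x (y - x) (by omega) (by omega)
      rwa [← Nat.cast_add, Nat.add_sub_cancel' hxy.le] at this)
    0 (Nat.zero_le _)
  simpa using hcert.le_sMinus

end SquareEnergy
end

section
/- Let n ≥ 3 be an odd integer and let C_n denote the cycle graph on n vertices. If n ≡ 3 (mod 4), then s⁺(C_n) = n − 1 + 1/cos(π/n) and s⁻(C_n) = n + 1 − 1/cos(π/n). If n ≡ 1 (mod 4), then s⁺(C_n) = n + 1 − 1/cos(π/n) and s⁻(C_n) = n − 1 + 1/cos(π/n). -/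
open Matrix

namespace SquareEnergy

open Polynomial in
/-- If `V * A = diagonal d * V` with `V` invertible, the characteristic polynomial of `A` splits
with roots `d`. -/
theorem charpoly_eq_prod_of_mul_eq_diagonal_mul {ι K : Type*} [Fintype ι] [DecidableEq ι] [Field K]
    {A V : Matrix ι ι K} {d : ι → K} (hV : V.det ≠ 0) (h : V * A = diagonal d * V) :
    A.charpoly = ∏ i, (X - C (d i)) := by
  have hu : IsUnit V.det := isUnit_iff_ne_zero.mpr hV
  have hA : A = V⁻¹ * (diagonal d * V) := by
    rw [← h, ← Matrix.mul_assoc, Matrix.nonsing_inv_mul _ hu, Matrix.one_mul]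
  rw [hA, Matrix.charpoly_mul_comm, Matrix.mul_assoc, Matrix.mul_nonsing_inv _ hu, Matrix.mul_one,
    Matrix.charpoly_diagonal]

theorem vandermonde_mul_adjMatrix_cycleGraph {m : ℕ} (x : Fin (m + 3) → ℂ)
    (hx : ∀ k, x k ^ (m + 3) = 1) :
    vandermonde x * (SimpleGraph.cycleGraph (m + 3)).adjMatrix ℂ =
      diagonal (fun k => x k + (x k)⁻¹) * vandermonde x := by
  ext k v
  have hx0 : x k ≠ 0 := by
    intro h0
    simpa [h0] using hx k
  have hsucc : ∀ u : Fin (m + 3), x k ^ (u + 1).val = x k ^ u.val * x k := by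
    intro u
    rw [Fin.val_add, ← pow_eq_pow_mod _ (hx k), Fin.val_one, pow_succ]
  have hpred : x k ^ (v - 1).val = x k ^ v.val * (x k)⁻¹ := by
    rw [eq_mul_inv_iff_mul_eq₀ hx0, ← hsucc, sub_add_cancel]
  have hne : v - 1 ≠ v + 1 := by
    rw [Ne, sub_eq_iff_eq_add, add_assoc, left_eq_add, Fin.ext_iff, Fin.val_add, Fin.val_one,
      Nat.mod_eq_of_lt (by omega)]
    simp
  rw [SimpleGraph.mul_adjMatrix_apply, SimpleGraph.cycleGraph_neighborFinset,
    Finset.sum_pair hne, diagonal_mul]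
  simp only [vandermonde_apply]
  rw [hsucc, hpred]
  ring

open Polynomial in
theorem charpoly_adjMatrix_cycleGraph (n : ℕ) (hn : 3 ≤ n) :
    ((SimpleGraph.cycleGraph n).adjMatrix ℝ).charpoly =
      ∏ k : Fin n, (X - C (2 * Real.cos (k.val * (2 * Real.pi / n)))) := by
  obtain ⟨m, rfl⟩ : ∃ m, n = m + 3 := ⟨n - 3, by omega⟩
  have hζ := Complex.isPrimitiveRoot_exp (m + 3) (by omega)
  set ζ := Complex.exp (2 * Real.pi * Complex.I / ((m + 3 : ℕ) : ℂ)) with hζdef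
  have hdet : (vandermonde fun k : Fin (m + 3) => ζ ^ k.val).det ≠ 0 := by
    rw [det_vandermonde_ne_zero_iff]
    intro a b hab
    exact Fin.ext (hζ.pow_inj a.isLt b.isLt hab)
  have key := charpoly_eq_prod_of_mul_eq_diagonal_mul hdet
    (vandermonde_mul_adjMatrix_cycleGraph (fun k : Fin (m + 3) => ζ ^ k.val)
      (fun k => by rw [← pow_mul, mul_comm, pow_mul, hζ.pow_eq_one, one_pow]))
  apply Polynomial.map_injective (algebraMap ℝ ℂ) (algebraMap ℝ ℂ).injective
  rw [← Matrix.charpoly_map, Polynomial.map_prod]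
  have hmap : ((SimpleGraph.cycleGraph (m + 3)).adjMatrix ℝ).map (algebraMap ℝ ℂ) =
      (SimpleGraph.cycleGraph (m + 3)).adjMatrix ℂ := by
    ext i j
    simp [SimpleGraph.adjMatrix_apply, apply_ite]
  rw [hmap, key]
  refine Finset.prod_congr rfl fun k _ => ?_
  rw [Polynomial.map_sub, Polynomial.map_X, Polynomial.map_C]
  congr 2
  rw [hζdef, ← Complex.exp_nat_mul, ← Complex.exp_neg]
  simp only [Complex.coe_algebraMap, Complex.ofReal_mul, Complex.ofReal_cos, Complex.ofReal_ofNat,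
    Complex.two_cos, Complex.ofReal_div, Complex.ofReal_natCast]
  congr 2 <;> ring

open Polynomial in
theorem sum_adjEig_cycleGraph (n : ℕ) (hn : 3 ≤ n) (f : ℝ → ℝ) :
    ∑ i, f (adjEig (SimpleGraph.cycleGraph n) i) =
      ∑ k ∈ Finset.range n, f (2 * Real.cos (k * (2 * Real.pi / n))) := by
  let := Classical.decRel (SimpleGraph.cycleGraph n).Adj
  have h1 : ((SimpleGraph.cycleGraph n).adjMatrix ℝ).charpoly =
      ∏ k : Fin n, (X - C (2 * Real.cos (k.val * (2 * Real.pi / n)))) := by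
    convert charpoly_adjMatrix_cycleGraph n hn
  have h2 := (adj_isHermitian (SimpleGraph.cycleGraph n)).roots_charpoly_eq_eigenvalues
  rw [h1, Polynomial.roots_prod _ _ (Finset.prod_ne_zero_iff.mpr fun k _ => X_sub_C_ne_zero _)] at h2
  simp only [roots_X_sub_C, Multiset.bind_singleton] at h2
  have h3 := congrArg (fun s => (s.map f).sum) h2
  simp only [Multiset.map_map] at h3
  rw [← Fin.sum_univ_eq_sum_range (fun k : ℕ => f (2 * Real.cos (k * (2 * Real.pi / n))))]
  exact h3.symm

theorem two_mul_sin_mul_sum_sq_two_mul_cos (θ : ℝ) (N : ℕ) :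
    2 * Real.sin θ * ∑ k ∈ Finset.range N, (2 * Real.cos (k * θ)) ^ 2 =
      4 * N * Real.sin θ + 2 * (Real.sin ((2 * N - 1) * θ) + Real.sin θ) := by
  induction N with
  | zero => simp
  | succ N ih =>
    rw [Finset.sum_range_succ, mul_add, ih]
    push_cast
    have e1 : (2 * ((N : ℝ) + 1) - 1) * θ = 2 * (N * θ) + θ := by ring
    have e2 : (2 * (N : ℝ) - 1) * θ = 2 * (N * θ) - θ := by ring
    rw [e1, e2, Real.sin_add, Real.sin_sub, Real.cos_two_mul]
    ring

theorem cos_mul_two_pi_div_neg {n k : ℕ} (h1 : n < 4 * k) (h2 : 4 * k < 3 * n) :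
    Real.cos (k * (2 * Real.pi / n)) < 0 := by
  have hn : (0 : ℝ) < n := by exact_mod_cast (show 0 < n by omega)
  have h1' : (n : ℝ) < 4 * k := by exact_mod_cast h1
  have h2' : (4 * k : ℝ) < 3 * n := by exact_mod_cast h2
  have e : k * (2 * Real.pi / n) = (4 * k / n) * (Real.pi / 2) := by ring
  have g1 : 1 < (4 * k / n : ℝ) := by rwa [lt_div_iff₀ hn, one_mul]
  have g2 : (4 * k / n : ℝ) < 3 := by rwa [div_lt_iff₀ hn]
  rw [e]
  apply Real.cos_neg_of_pi_div_two_lt_of_lt <;> nlinarith [Real.pi_pos]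

theorem cos_mul_two_pi_div_pos {n k : ℕ} (h : 4 * k < n) :
    0 < Real.cos (k * (2 * Real.pi / n)) := by
  have hn : (0 : ℝ) < n := by exact_mod_cast (show 0 < n by omega)
  have h' : (4 * k : ℝ) < n := by exact_mod_cast h
  have e : k * (2 * Real.pi / n) = (4 * k / n) * (Real.pi / 2) := by ring
  have g1 : 0 ≤ (4 * k / n : ℝ) := by positivity
  have g2 : (4 * k / n : ℝ) < 1 := by rwa [div_lt_iff₀ hn, one_mul]
  rw [e]
  apply Real.cos_pos_of_mem_Ioo
  constructor <;> nlinarith [Real.pi_pos]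

theorem cos_mul_two_pi_div_neg_iff {n k : ℕ} (hodd : Odd n) (hk : k < n) :
    Real.cos (k * (2 * Real.pi / n)) < 0 ↔ n / 4 + 1 ≤ k ∧ k < n - n / 4 := by
  obtain ⟨m, rfl⟩ := hodd
  constructor
  · intro h
    by_contra hc
    rcases Nat.lt_or_ge (4 * k) (2 * m + 1) with h4 | h4
    · exact (cos_mul_two_pi_div_pos h4).not_gt h
    · have hpos := cos_mul_two_pi_div_pos (n := 2 * m + 1) (k := 2 * m + 1 - k) (by omega)
      rw [Nat.cast_sub hk.le, sub_mul, mul_div_cancel₀ _ (by positivity), Real.cos_two_pi_sub]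
        at hpos
      exact hpos.not_gt h
  · rintro ⟨h1, h2⟩
    exact cos_mul_two_pi_div_neg (by omega) (by omega)

theorem sin_two_pi_div_pos {n : ℕ} (hn : 3 ≤ n) : 0 < Real.sin (2 * Real.pi / n) := by
  have hn' : (3 : ℝ) ≤ n := by exact_mod_cast hn
  apply Real.sin_pos_of_pos_of_lt_pi (by positivity)
  rw [div_lt_iff₀ (by linarith)]
  nlinarith [Real.pi_pos]

theorem sPlus_add_sMinus_cycleGraph (n : ℕ) (hn : 3 ≤ n) :
    sPlus (SimpleGraph.cycleGraph n) + sMinus (SimpleGraph.cycleGraph n) = 2 * n := by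
  have h : sPlus (SimpleGraph.cycleGraph n) + sMinus (SimpleGraph.cycleGraph n) =
      ∑ i, (adjEig (SimpleGraph.cycleGraph n) i) ^ 2 := by
    rw [sPlus, sMinus, ← Finset.sum_add_distrib]
    refine Finset.sum_congr rfl fun i _ => ?_
    rcases lt_trichotomy (adjEig (SimpleGraph.cycleGraph n) i) 0 with h | h | h
    · simp [h, h.not_gt]
    · simp [h]
    · simp [h, h.not_gt]
  have hs := sin_two_pi_div_pos hn
  have hn0 : (n : ℝ) ≠ 0 := by exact_mod_cast (show n ≠ 0 by omega)
  have hS := two_mul_sin_mul_sum_sq_two_mul_cos (2 * Real.pi / n) n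
  have e : (2 * (n : ℝ) - 1) * (2 * Real.pi / n) = -(2 * Real.pi / n) + (2 : ℕ) * (2 * Real.pi) := by
    push_cast
    field_simp
    ring
  rw [e, Real.sin_add_nat_mul_two_pi, Real.sin_neg] at hS
  rw [h, sum_adjEig_cycleGraph n hn (fun x => x ^ 2)]
  apply mul_left_cancel₀ (mul_pos two_pos hs).ne'
  linear_combination hS

theorem sMinus_cycleGraph (n : ℕ) (hn : 3 ≤ n) (hodd : Odd n) :
    sMinus (SimpleGraph.cycleGraph n) = 2 * (n - 2 * (n / 4 : ℕ) - 1) -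
      2 * Real.sin ((2 * (n / 4 : ℕ) + 1) * (2 * Real.pi / n)) / Real.sin (2 * Real.pi / n) := by
  have hs := sin_two_pi_div_pos hn
  have hn0 : (n : ℝ) ≠ 0 := by exact_mod_cast (show n ≠ 0 by omega)
  have h : sMinus (SimpleGraph.cycleGraph n) =
      ∑ k ∈ Finset.Ico (n / 4 + 1) (n - n / 4), (2 * Real.cos (k * (2 * Real.pi / n))) ^ 2 := by
    rw [sMinus, sum_adjEig_cycleGraph n hn (fun x => if x < 0 then x ^ 2 else 0),
      ← Finset.sum_filter]
    refine Finset.sum_congr ?_ fun _ _ => rfl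
    ext k
    simp only [Finset.mem_filter, Finset.mem_range, Finset.mem_Ico]
    have hneg : 2 * Real.cos (k * (2 * Real.pi / n)) < 0 ↔ Real.cos (k * (2 * Real.pi / n)) < 0 := by
      constructor <;> intro h <;> linarith
    rw [hneg]
    constructor
    · rintro ⟨hk, h⟩
      exact (cos_mul_two_pi_div_neg_iff hodd hk).mp h
    · intro h
      have hk : k < n := by omega
      exact ⟨hk, (cos_mul_two_pi_div_neg_iff hodd hk).mpr h⟩
  have h1 := two_mul_sin_mul_sum_sq_two_mul_cos (2 * Real.pi / n) (n - n / 4)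
  have h2 := two_mul_sin_mul_sum_sq_two_mul_cos (2 * Real.pi / n) (n / 4 + 1)
  rw [h, Finset.sum_Ico_eq_sub _ (by omega)]
  rw [Nat.cast_sub (Nat.div_le_self n 4)] at h1
  rw [Nat.cast_add, Nat.cast_one] at h2
  generalize ((n / 4 : ℕ) : ℝ) = K at *
  have e1 : (2 * ((n : ℝ) - K) - 1) * (2 * Real.pi / n) =
      -((2 * K + 1) * (2 * Real.pi / n)) + (2 : ℕ) * (2 * Real.pi) := by
    push_cast
    field_simp
    ring
  have e2 : 2 * (K + 1) - 1 = 2 * K + 1 := by ring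
  rw [e1, Real.sin_add_nat_mul_two_pi, Real.sin_neg] at h1
  rw [e2] at h2
  apply mul_left_cancel₀ (mul_pos two_pos hs).ne'
  rw [mul_sub, h1, h2]
  field_simp
  ring

/-- For odd `n ≥ 3`: if `n ≡ 3 (mod 4)` then `s⁺(C_n) = n − 1 + 1/cos(π/n)` and
`s⁻(C_n) = n + 1 − 1/cos(π/n)`; if `n ≡ 1 (mod 4)` then `s⁺(C_n) = n + 1 − 1/cos(π/n)` and
`s⁻(C_n) = n − 1 + 1/cos(π/n)`. -/
theorem stmt_19 (n : ℕ) (hn : 3 ≤ n) (hodd : Odd n) :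
    (n % 4 = 3 →
      sPlus (SimpleGraph.cycleGraph n) = n - 1 + 1 / Real.cos (Real.pi / n) ∧
      sMinus (SimpleGraph.cycleGraph n) = n + 1 - 1 / Real.cos (Real.pi / n)) ∧
    (n % 4 = 1 →
      sPlus (SimpleGraph.cycleGraph n) = n + 1 - 1 / Real.cos (Real.pi / n) ∧
      sMinus (SimpleGraph.cycleGraph n) = n - 1 + 1 / Real.cos (Real.pi / n)) := by
  have hn0 : (n : ℝ) ≠ 0 := by exact_mod_cast (show n ≠ 0 by omega)
  have hs := sin_two_pi_div_pos hn
  have hsum := sPlus_add_sMinus_cycleGraph n hn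
  have hminus := sMinus_cycleGraph n hn hodd
  have hdouble : Real.sin (2 * Real.pi / n) =
      2 * Real.sin (Real.pi / n) * Real.cos (Real.pi / n) := by
    rw [← Real.sin_two_mul, mul_div_assoc]
  have hne : Real.sin (Real.pi / n) ≠ 0 ∧ Real.cos (Real.pi / n) ≠ 0 := by
    constructor <;> intro h <;> simp [hdouble, h] at hs
  have hquot : 2 * Real.sin (Real.pi / n) / Real.sin (2 * Real.pi / n) =
      1 / Real.cos (Real.pi / n) := by
    rw [hdouble]
    field_simp [hne.1, hne.2]
  constructor
  · intro hmod
    have hK : (n : ℝ) = 4 * (n / 4 : ℕ) + 3 := by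
      exact_mod_cast (show n = 4 * (n / 4) + 3 by omega)
    have e : (2 * ((n / 4 : ℕ) : ℝ) + 1) * (2 * Real.pi / n) = Real.pi - Real.pi / n := by
      field_simp
      linear_combination -hK
    rw [e, Real.sin_pi_sub, hquot] at hminus
    constructor <;> linarith
  · intro hmod
    have hK : (n : ℝ) = 4 * (n / 4 : ℕ) + 1 := by
      exact_mod_cast (show n = 4 * (n / 4) + 1 by omega)
    have e : (2 * ((n / 4 : ℕ) : ℝ) + 1) * (2 * Real.pi / n) = Real.pi / n + Real.pi := by
      field_simp
      linear_combination -hK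
    rw [e, Real.sin_add_pi, mul_neg, neg_div, hquot] at hminus
    constructor <;> linarith

end SquareEnergy
end
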